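/- arXiv:1904.06911 — 2 statements merged into one kernel-verified Lean document; each statement's English description precedes it below -/
import Mathlib

section
/- Let P be a centrally symmetric convex polygon in ℝ² with 2m vertices, where m ≥ 6. Then for every lattice Λ ⊆ ℝ² and every positive integer k ≤ 6, P + Λ is not a k-fold lattice tiling of ℝ²; that is, τ*(P) ≥ 7. -/
open Set Pointwise

noncomputable section

/-- A point of the plane `ℝ²`. -/
abbrev Pt : Type := ℝ × ℝ

/-- The standard integer lattice `ℤ² ⊆ ℝ²`. -/
def IntLattice : Set Pt := {p : Pt | ∃ a b : ℤ, p = ((a : ℝ), (b : ℝ))}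

/-- A lattice in `ℝ²` is the image of `ℤ²` under an invertible linear map. -/
def IsLattice (L : Set Pt) : Prop :=
  ∃ B : Pt ≃ₗ[ℝ] Pt, L = B '' IntLattice

/-- `K + L` is a `k`-fold lattice tiling of the plane: `L` is a lattice, every point lies in
at least `k` translates `K + l` (`l ∈ L`), and every point lies in at most `k` translates
`interior K + l`. -/
def IsKFoldLatticeTiling (K L : Set Pt) (k : ℕ) : Prop :=
  IsLattice L ∧
  (∀ p : Pt, (k : ℕ∞) ≤ {l ∈ L | p - l ∈ K}.encard) ∧
  (∀ p : Pt, {l ∈ L | p - l ∈ interior K}.encard ≤ (k : ℕ∞))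

/-- A discrete multiset of points of the plane, given as a family `x : I → ℝ²`:
every bounded set contains `x i` for only finitely many indices. -/
def IsDiscreteFamily {I : Type} (x : I → Pt) : Prop :=
  ∀ B : Set Pt, Bornology.IsBounded B → {i : I | x i ∈ B}.Finite

/-- `K + X` is a `k`-fold translative tiling of the plane, for the discrete multiset
`X = (x i)_{i ∈ I}`: every point lies in `K + x i` for at least `k` indices, and in
`interior K + x i` for at most `k` indices. -/
def IsKFoldTranslativeTiling {I : Type} (K : Set Pt) (x : I → Pt) (k : ℕ) : Prop :=
  IsDiscreteFamily x ∧
  (∀ p : Pt, (k : ℕ∞) ≤ {i : I | p - x i ∈ K}.encard) ∧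
  (∀ p : Pt, {i : I | p - x i ∈ interior K}.encard ≤ (k : ℕ∞))

/-- A convex polygon with exactly `n` vertices: a compact convex set with nonempty interior
which is the convex hull of its finitely many (`n`) extreme points. -/
def IsConvexPolygon (P : Set Pt) (n : ℕ) : Prop :=
  Convex ℝ P ∧ IsCompact P ∧ (interior P).Nonempty ∧
  (Set.extremePoints ℝ P).Finite ∧ (Set.extremePoints ℝ P).ncard = n ∧
  P = convexHull ℝ (Set.extremePoints ℝ P)

/-- `[a, b]` is an edge of the polygon `P`: a nondegenerate segment which is an extreme
(face) subset of `P`. -/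
def IsEdgeOf (P : Set Pt) (a b : Pt) : Prop :=
  a ≠ b ∧ IsExtreme ℝ P (segment ℝ a b)

/-- The set of midpoints of the edges of `P`. -/
def edgeMidpoints (P : Set Pt) : Set Pt :=
  {u : Pt | ∃ a b : Pt, IsEdgeOf P a b ∧ u = midpoint ℝ a b}

/-- `P` is centrally symmetric (about some center `c`). -/
def CentrallySymmetric (P : Set Pt) : Prop :=
  ∃ c : Pt, ∀ x : Pt, x ∈ P ↔ c + c - x ∈ P

/-- `D` is a parallelogram. -/
def IsParallelogram (D : Set Pt) : Prop :=
  ∃ v a b : Pt, LinearIndependent ℝ ![a, b] ∧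
    D = convexHull ℝ ({v, v + a, v + b, v + a + b} : Set Pt)

/-- The octagon `P₈(α)`, with vertices `±(α−1, 2), ±(α, −2), ±(1−α, 0), ±(1+α, −1)`. -/
def P8 (α : ℝ) : Set Pt :=
  convexHull ℝ ({(α - 1, 2), (α, -2), (1 - α, 0), (1 + α, -1),
                 (1 - α, -2), (-α, 2), (α - 1, 0), (-(1 + α), 1)} : Set Pt)

/-- The ten points `D₁`. -/
def D1 : Set Pt :=
  {(-1, 1/2), (1/2, 1), (3/2, 1), (2, 1/2), (2, 0),
   (1, -1/2), (-1/2, -1), (-3/2, -1), (-2, -1/2), (-2, 0)}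

/-- The ten points `D₂`. -/
def D2 : Set Pt :=
  {(1/2, -1), (3/2, -1/2), (2, 0), (3/2, 1/2), (1/2, 1),
   (-1/2, 1), (-3/2, 1/2), (-2, 0), (-3/2, -1/2), (-1/2, -1)}

/-- The set `(1/2)Λ = {λ/2 : λ ∈ Λ}`. -/
def halfSet (L : Set Pt) : Set Pt := (fun l : Pt => (2⁻¹ : ℝ) • l) '' L

/-- A cyclic enumeration `v : ZMod n → ℝ²` of the vertices of a convex polygon `P` with `n`
vertices: `v` is injective, its range is the vertex set of `P`, and consecutive vertices are
joined by edges of `P`. -/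
def IsCyclicVertexEnum (P : Set Pt) (n : ℕ) (v : ZMod n → Pt) : Prop :=
  Function.Injective v ∧ Set.range v = Set.extremePoints ℝ P ∧
  ∀ i : ZMod n, IsEdgeOf P (v i) (v (i + 1))

def D2z (a b : ℤ × ℤ) : ℤ := a.1 * b.2 - a.2 * b.1

def sz (a : ℤ × ℤ) : ℕ := a.1.natAbs + a.2.natAbs
def dz (a b : ℤ × ℤ) : ℕ := (D2z a b).natAbs

def candB : List (ℤ × ℤ) :=
  (List.range 9).flatMap fun (i : ℕ) => (List.range (9 - i)).flatMap fun (j : ℕ) =>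
    [((i : ℤ) + 1, (j : ℤ) + 1), ((i : ℤ) + 1, -(j : ℤ) - 1)]

def checkD (a b c : ℤ × ℤ) (s : ℕ) : Bool :=
  candB.all fun d => 
    Nat.ble 23 (s + sz d + dz a d + dz b d + dz c d) || Nat.beq (dz a d) 0 || Nat.beq (dz b d) 0 || Nat.beq (dz c d) 0
def checkC (a b : ℤ × ℤ) (s : ℕ) : Bool :=
  candB.all fun c => 
    Nat.ble 18 (s + sz c + dz a c + dz b c) || Nat.beq (dz a c) 0 || Nat.beq (dz b c) 0 ||
      checkD a b c (s + sz c + dz a c + dz b c)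
def checkB (a : ℤ × ℤ) (s : ℕ) : Bool :=
  candB.all fun b => Nat.ble 14 (s + sz b + dz a b) || Nat.beq (dz a b) 0 || checkC a b (s + sz b + dz a b)
def checkA : Bool := candB.all fun a => checkB a (sz a)

set_option maxRecDepth 100000 in
theorem checkA_true : checkA = true := by decide +kernel

theorem mem_candB (a : ℤ × ℤ) (h1 : 0 < a.1) (h2 : a.2 ≠ 0) (h : sz a ≤ 10) : a ∈ candB := by
  obtain ⟨x, y⟩ := a
  simp only [sz] at h
  change 0 < x at h1
  change y ≠ 0 at h2
  simp only [candB, List.mem_flatMap, List.mem_range]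
  have hx : 1 ≤ x.natAbs := by omega
  have hy : 1 ≤ y.natAbs := by omega
  refine ⟨x.natAbs - 1, by omega, y.natAbs - 1, ?_, ?_⟩
  · omega
  simp only [List.mem_cons, Prod.mk.injEq, List.not_mem_nil, or_false]
  rcases lt_or_gt_of_ne h2 with hy | hy
  · right; exact ⟨by omega, by omega⟩
  · left; exact ⟨by omega, by omega⟩

theorem quad_pos (a b c d : ℤ × ℤ) (a1 : 0 < a.1) (b1 : 0 < b.1) (c1 : 0 < c.1) (d1 : 0 < d.1)
    (a2 : a.2 ≠ 0) (b2 : b.2 ≠ 0) (c2 : c.2 ≠ 0) (d2 : d.2 ≠ 0)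
    (hab : dz a b ≠ 0) (hac : dz a c ≠ 0) (had : dz a d ≠ 0)
    (hbc : dz b c ≠ 0) (hbd : dz b d ≠ 0) (hcd : dz c d ≠ 0) :
    23 ≤ sz a + sz b + sz c + sz d + dz a b + dz a c + dz a d + dz b c + dz b d + dz c d := by
  by_contra hlt
  have sa : 2 ≤ sz a := by simp only [sz]; omega
  have sb : 2 ≤ sz b := by simp only [sz]; omega
  have sc : 2 ≤ sz c := by simp only [sz]; omega
  have sd : 2 ≤ sz d := by simp only [sz]; omega
  have h := checkA_true
  unfold checkA at h
  have h := List.all_eq_true.mp h a (mem_candB a a1 a2 (by omega))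
  unfold checkB at h
  have h := List.all_eq_true.mp h b (mem_candB b b1 b2 (by omega))
  simp only [Bool.or_eq_true, Nat.ble_eq, Nat.beq_eq, hab, or_false] at h
  rcases h with h | h
  · omega
  unfold checkC at h
  have h := List.all_eq_true.mp h c (mem_candB c c1 c2 (by omega))
  simp only [Bool.or_eq_true, Nat.ble_eq, Nat.beq_eq, hac, hbc, or_false] at h
  rcases h with h | h
  · omega
  unfold checkD at h
  have h := List.all_eq_true.mp h d (mem_candB d d1 d2 (by omega))
  simp only [Bool.or_eq_true, Nat.ble_eq, Nat.beq_eq, had, hbd, hcd, or_false] at h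
  omega

/-- normalise the sign of the first coordinate -/
def nrm (a : ℤ × ℤ) : ℤ × ℤ := if 0 < a.1 then a else (-a.1, -a.2)

theorem sz_nrm (a : ℤ × ℤ) : sz (nrm a) = sz a := by
  unfold nrm sz; split_ifs <;> simp
theorem dz_nrm (a b : ℤ × ℤ) : dz (nrm a) (nrm b) = dz a b := by
  unfold nrm dz D2z
  split_ifs
  · rfl
  · rw [← Int.natAbs_neg]; congr 1; simp; ring
  · rw [← Int.natAbs_neg]; congr 1; simp; ring
  · congr 1; simp
theorem nrm_pos (a : ℤ × ℤ) (h : a.1 ≠ 0) : 0 < (nrm a).1 := by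
  unfold nrm; split_ifs
  · assumption
  · dsimp only; omega
theorem nrm_snd (a : ℤ × ℤ) (h : a.2 ≠ 0) : (nrm a).2 ≠ 0 := by
  unfold nrm; split_ifs <;> simp <;> omega

theorem quad (a b c d : ℤ × ℤ) (a1 : a.1 ≠ 0) (b1 : b.1 ≠ 0) (c1 : c.1 ≠ 0) (d1 : d.1 ≠ 0)
    (a2 : a.2 ≠ 0) (b2 : b.2 ≠ 0) (c2 : c.2 ≠ 0) (d2 : d.2 ≠ 0)
    (hab : dz a b ≠ 0) (hac : dz a c ≠ 0) (had : dz a d ≠ 0)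
    (hbc : dz b c ≠ 0) (hbd : dz b d ≠ 0) (hcd : dz c d ≠ 0) :
    23 ≤ sz a + sz b + sz c + sz d + dz a b + dz a c + dz a d + dz b c + dz b d + dz c d := by
  have := quad_pos (nrm a) (nrm b) (nrm c) (nrm d) (nrm_pos a a1) (nrm_pos b b1) (nrm_pos c c1)
    (nrm_pos d d1) (nrm_snd a a2) (nrm_snd b b2) (nrm_snd c c2) (nrm_snd d d2)
  simp only [dz_nrm, sz_nrm] at this
  exact this hab hac had hbc hbd hcd

theorem dz_comm (a b : ℤ × ℤ) : dz a b = dz b a := by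
  unfold dz D2z; rw [← Int.natAbs_neg]; congr 1; ring
theorem dz_self (a : ℤ × ℤ) : dz a a = 0 := by
  unfold dz D2z; rw [mul_comm, sub_self]; rfl

theorem unimod (e : Fin 6 → ℤ × ℤ) (h : ∀ i j, i ≠ j → dz (e i) (e j) ≠ 0)
    (h01 : dz (e 0) (e 1) = 1) : 48 ≤ ∑ i, ∑ j, dz (e i) (e j) := by
  let f : Fin 6 → ℤ × ℤ := fun l => (D2z (e l) (e 1), D2z (e 0) (e l))
  have hf : ∀ l m, dz (f l) (f m) = dz (e l) (e m) := by
    intro l m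
    have : D2z (f l) (f m) = D2z (e 0) (e 1) * D2z (e l) (e m) := by
      simp only [f, D2z]; ring
    unfold dz
    rw [this, Int.natAbs_mul]
    unfold dz at h01
    rw [h01, one_mul]
  have hs : ∀ l, sz (f l) = dz (e l) (e 1) + dz (e 0) (e l) := fun l => rfl
  have hx : ∀ l, l ≠ 1 → (f l).1 ≠ 0 := fun l hl => by
    have := h l 1 hl
    simpa [f, dz] using this
  have hy : ∀ l, l ≠ 0 → (f l).2 ≠ 0 := fun l hl => by
    have := h 0 l hl.symm
    simpa [f, dz] using this
  have key := quad (f 2) (f 3) (f 4) (f 5) (hx 2 (by decide)) (hx 3 (by decide)) (hx 4 (by decide))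
    (hx 5 (by decide)) (hy 2 (by decide)) (hy 3 (by decide)) (hy 4 (by decide)) (hy 5 (by decide))
  simp only [hf, hs] at key
  have key := key (h _ _ (by decide)) (h _ _ (by decide)) (h _ _ (by decide)) (h _ _ (by decide))
    (h _ _ (by decide)) (h _ _ (by decide))
  simp only [Fin.sum_univ_six, dz_self]
  rw [dz_comm (e 1) (e 0), dz_comm (e 2) (e 0), dz_comm (e 3) (e 0), dz_comm (e 4) (e 0),
    dz_comm (e 5) (e 0), dz_comm (e 2) (e 1), dz_comm (e 3) (e 1), dz_comm (e 4) (e 1),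
    dz_comm (e 5) (e 1), dz_comm (e 3) (e 2), dz_comm (e 4) (e 2), dz_comm (e 5) (e 2),
    dz_comm (e 4) (e 3), dz_comm (e 5) (e 3), dz_comm (e 5) (e 4)]
  rw [dz_comm (e 2) (e 1), dz_comm (e 3) (e 1), dz_comm (e 4) (e 1),
    dz_comm (e 5) (e 1)] at key
  omega

theorem exists_perm (i j : Fin 6) (h : i ≠ j) : ∃ σ : Equiv.Perm (Fin 6), σ 0 = i ∧ σ 1 = j := by
  refine ⟨(Equiv.swap 0 i).trans (Equiv.swap (Equiv.swap 0 i 1) j) , ?_, ?_⟩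
  · simp only [Equiv.trans_apply, Equiv.swap_apply_left]
    refine Equiv.swap_apply_of_ne_of_ne ?_ h
    intro hh
    have : Equiv.swap 0 i 0 = Equiv.swap 0 i 1 := by rw [Equiv.swap_apply_left]; exact hh
    exact absurd ((Equiv.swap 0 i).injective this) (by decide)
  · simp

theorem zono (e : Fin 6 → ℤ × ℤ) (h : ∀ i j, i ≠ j → dz (e i) (e j) ≠ 0) :
    48 ≤ ∑ i, ∑ j, dz (e i) (e j) := by
  by_cases h1 : ∃ i j, i ≠ j ∧ dz (e i) (e j) = 1
  · obtain ⟨i, j, hij, hd⟩ := h1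
    obtain ⟨σ, h0, h1⟩ := exists_perm i j hij
    have := unimod (e ∘ σ) (fun a b hab => h _ _ (fun hh => hab (σ.injective hh)))
      (by simp [h0, h1, hd])
    refine this.trans (le_of_eq ?_)
    rw [← Equiv.sum_comp σ (fun a => ∑ j, dz (e a) (e j))]
    refine Finset.sum_congr rfl fun a _ => ?_
    exact Equiv.sum_comp σ (fun b => dz (e (σ a)) (e b))
  · push Not at h1
    have h2 : ∀ i j, i ≠ j → 2 ≤ dz (e i) (e j) := fun i j hij => by
      have := h i j hij; have := h1 i j hij; omega
    have : ∀ i, 10 ≤ ∑ j, dz (e i) (e j) := by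
      intro i
      calc 10 = ∑ j : Fin 6, if i = j then 0 else 2 := by revert i; decide
        _ ≤ _ := Finset.sum_le_sum fun j _ => by
          split_ifs with hij
          · simp
          · exact h2 i j hij
    calc 48 ≤ ∑ i : Fin 6, 10 := by decide
      _ ≤ _ := Finset.sum_le_sum fun i _ => this i

def TriConv (S : Set (ℤ × ℤ)) : Prop :=
  ∀ a ∈ S, ∀ b ∈ S, ∀ c ∈ S, 0 < D2z a b → 0 < D2z b c → 0 < D2z a b + D2z b c - D2z a c

theorem edge_adj {S : Set (ℤ × ℤ)} (hT : TriConv S) {a b d : ℤ × ℤ}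
    (ha : a ∈ S) (hb : b ∈ S) (hd : d ∈ S) (hab : 0 < D2z a b) (hbd : 0 < D2z b d) :
    0 < D2z (b - a) (d - b) := by
  have := hT a ha b hb d hd hab hbd
  have e : D2z (b - a) (d - b) = D2z a b + D2z b d - D2z a d := by
    simp only [D2z, Prod.fst_sub, Prod.snd_sub]; ring
  omega

theorem edge_last {S : Set (ℤ × ℤ)} (hneg : ∀ a ∈ S, -a ∈ S) (hT : TriConv S) {a b c : ℤ × ℤ}
    (ha : a ∈ S) (hb : b ∈ S) (hc : c ∈ S) (hab : 0 < D2z a b) (hac : 0 < D2z a c) :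
    0 < D2z (b - a) (-a - c) := by
  have h1 : D2z (-c) a = D2z a c := by simp only [D2z, Prod.fst_neg, Prod.snd_neg]; ring
  have := hT (-c) (hneg c hc) a ha b hb (by omega) hab
  have e : D2z (b - a) (-a - c) = D2z (-c) a + D2z a b - D2z (-c) b := by
    simp only [D2z, Prod.fst_sub, Prod.snd_sub, Prod.fst_neg, Prod.snd_neg]; ring
  omega

theorem edge_gen {S : Set (ℤ × ℤ)} (hneg : ∀ a ∈ S, -a ∈ S) (hT : TriConv S) {a b c d : ℤ × ℤ}
    (ha : a ∈ S) (hb : b ∈ S) (hc : c ∈ S) (hd : d ∈ S) (hab : 0 < D2z a b) (hac : 0 < D2z a c)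
    (had : 0 < D2z a d) (hbc : 0 < D2z b c) (hcd : 0 < D2z c d) :
    0 < D2z (b - a) (d - c) := by
  have h1 := edge_adj hT ha hb hc hab hbc
  have h2 := edge_last hneg hT ha hb hc hab hac
  have hc' : D2z c (-a) = D2z a c := by simp only [D2z, Prod.fst_neg, Prod.snd_neg]; ring
  have hd' : D2z d (-a) = D2z a d := by simp only [D2z, Prod.fst_neg, Prod.snd_neg]; ring
  have h3 := edge_adj hT hc hd (hneg a ha) hcd (by omega)
  have h4 := edge_adj hT hb hc hd hbc hcd
  have h5 := edge_adj hT hb hc (hneg a ha) hbc (by omega)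
  have key : D2z (b - a) (d - c) * D2z (c - b) (-a - c) =
      D2z (b - a) (c - b) * D2z (d - c) (-a - d) + D2z (b - a) (-a - c) * D2z (c - b) (d - c) := by
    simp only [D2z, Prod.fst_sub, Prod.snd_sub, Prod.fst_neg, Prod.snd_neg]; ring
  have : 0 < D2z (b - a) (d - c) * D2z (c - b) (-a - c) := by rw [key]; positivity
  exact pos_of_mul_pos_left this h5.le

theorem dz_of_pos {a b : ℤ × ℤ} (h : 0 < D2z a b) : (dz a b : ℤ) = D2z a b := by
  unfold dz; omega

theorem ring24 {S : Set (ℤ × ℤ)} (hneg : ∀ a ∈ S, -a ∈ S) (hT : TriConv S)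
    (u : Fin 6 → ℤ × ℤ) (hu : ∀ i, u i ∈ S) (hpos : ∀ i j, i < j → 0 < D2z (u i) (u j)) :
    24 ≤ D2z (u 0) (u 1) + D2z (u 1) (u 2) + D2z (u 2) (u 3) + D2z (u 3) (u 4) + D2z (u 4) (u 5)
      + D2z (u 0) (u 5) := by
  obtain ⟨w, hwd⟩ : ∃ w : Fin 7 → ℤ × ℤ, w = fun i => if h : i.val < 6 then u ⟨i.val, h⟩ else - u 0 :=
    ⟨_, rfl⟩
  have hw : ∀ i, w i ∈ S := by
    intro i
    rw [hwd]; dsimp only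
    split_ifs
    · exact hu _
    · exact hneg _ (hu 0)
  have hn : ∀ a, D2z a (- u 0) = D2z (u 0) a := fun a => by
    simp only [D2z, Prod.fst_neg, Prod.snd_neg]; ring
  have hwp : ∀ i j : Fin 7, i.val < j.val → ¬ (i.val = 0 ∧ j.val = 6) → 0 < D2z (w i) (w j) := by
    intro i j hij hn0
    have hi : i.val < 6 := by omega
    rw [hwd]; dsimp only
    rw [dif_pos hi]
    split_ifs with hj
    · exact hpos _ _ hij
    · rw [hn]
      refine hpos _ _ ?_
      rw [Fin.lt_def]
      have : i.val ≠ 0 := fun h => hn0 ⟨h, by have := j.2; omega⟩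
      change 0 < i.val
      omega
  let e : Fin 6 → ℤ × ℤ := fun i => w i.succ - w i.castSucc
  have he : ∀ i j, i < j → 0 < D2z (e i) (e j) := by
    intro i j hij
    have hi := i.2
    have hj := j.2
    rw [Fin.lt_def] at hij
    by_cases h1 : i.succ = j.castSucc
    · have h1' := congrArg Fin.val h1
      simp only [Fin.val_succ, Fin.val_castSucc] at h1'
      simp only [e]
      rw [← h1]
      refine edge_adj hT (hw i.castSucc) (hw i.succ) (hw j.succ)
        (hwp _ _ ?_ ?_) (hwp _ _ ?_ ?_)
      all_goals
        simp only [Fin.val_succ, Fin.val_castSucc]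
        omega
    · by_cases h2 : i.val = 0 ∧ j.val = 5
      · obtain ⟨h20, h25⟩ := h2
        obtain rfl : i = 0 := Fin.ext h20
        obtain rfl : j = 5 := Fin.ext h25
        simp only [e, hwd]
        exact edge_last hneg hT (hu 0) (hu 1) (hu 5) (hpos _ _ (by decide)) (hpos _ _ (by decide))
      · simp only [Fin.ext_iff, Fin.val_succ, Fin.val_castSucc] at h1
        refine edge_gen hneg hT (hw i.castSucc) (hw i.succ) (hw j.castSucc) (hw j.succ) 
          (hwp _ _ ?_ ?_) (hwp _ _ ?_ ?_) (hwp _ _ ?_ ?_) (hwp _ _ ?_ ?_) (hwp _ _ ?_ ?_)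
        all_goals
          simp only [Fin.val_succ, Fin.val_castSucc]
          omega
  have hz := zono e (fun i j hij => by
    rcases lt_or_gt_of_ne hij with h | h
    · have := he i j h
      have := dz_of_pos this
      omega
    · rw [dz_comm]
      have := he j i h
      have := dz_of_pos this
      omega)
  simp only [Fin.sum_univ_six, dz_self] at hz
  rw [dz_comm (e 1) (e 0), dz_comm (e 2) (e 0), dz_comm (e 3) (e 0), dz_comm (e 4) (e 0),
    dz_comm (e 5) (e 0), dz_comm (e 2) (e 1), dz_comm (e 3) (e 1), dz_comm (e 4) (e 1),
    dz_comm (e 5) (e 1), dz_comm (e 3) (e 2), dz_comm (e 4) (e 2), dz_comm (e 5) (e 2),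
    dz_comm (e 4) (e 3), dz_comm (e 5) (e 3), dz_comm (e 5) (e 4)] at hz
  zify at hz
  rw [dz_of_pos (he 0 1 (by decide)), dz_of_pos (he 0 2 (by decide)), dz_of_pos (he 0 3 (by decide)),
    dz_of_pos (he 0 4 (by decide)), dz_of_pos (he 0 5 (by decide)), dz_of_pos (he 1 2 (by decide)),
    dz_of_pos (he 1 3 (by decide)), dz_of_pos (he 1 4 (by decide)), dz_of_pos (he 1 5 (by decide)),
    dz_of_pos (he 2 3 (by decide)), dz_of_pos (he 2 4 (by decide)), dz_of_pos (he 2 5 (by decide)),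
    dz_of_pos (he 3 4 (by decide)), dz_of_pos (he 3 5 (by decide)), dz_of_pos (he 4 5 (by decide))] at hz
  have e0 : e 0 = u 1 - u 0 := by simp only [e, hwd]; rfl
  have e1 : e 1 = u 2 - u 1 := by simp only [e, hwd]; rfl
  have e2 : e 2 = u 3 - u 2 := by simp only [e, hwd]; rfl
  have e3 : e 3 = u 4 - u 3 := by simp only [e, hwd]; rfl
  have e4 : e 4 = u 5 - u 4 := by simp only [e, hwd]; rfl
  have e5 : e 5 = - u 0 - u 5 := by simp only [e, hwd]; rfl
  rw [e0, e1, e2, e3, e4, e5] at hz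
  simp only [D2z, Prod.fst_sub, Prod.snd_sub, Prod.fst_neg, Prod.snd_neg] at hz ⊢
  linarith

def dt (a b : Pt) : ℝ := a.1 * b.2 - a.2 * b.1
def dot (n x : Pt) : ℝ := n.1 * x.1 + n.2 * x.2

theorem dot_convex (n : Pt) (c : ℝ) : Convex ℝ {x : Pt | dot n x ≤ c} := by
  intro x hx y hy a b ha hb hab
  simp only [mem_ofPred_eq, dot, Prod.fst_add, Prod.snd_add, Prod.smul_fst, Prod.smul_snd,
    smul_eq_mul] at *
  have : a * (n.1 * x.1 + n.2 * x.2) + b * (n.1 * y.1 + n.2 * y.2) ≤ a * c + b * c := by gcongr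
  calc _ = a * (n.1 * x.1 + n.2 * x.2) + b * (n.1 * y.1 + n.2 * y.2) := by ring
    _ ≤ _ := this
    _ = c := by rw [← add_mul, hab, one_mul]

theorem dot_add (n x y : Pt) : dot n (x + y) = dot n x + dot n y := by
  simp only [dot, Prod.fst_add, Prod.snd_add]; ring
theorem dot_sub (n x y : Pt) : dot n (x - y) = dot n x - dot n y := by
  simp only [dot, Prod.fst_sub, Prod.snd_sub]; ring
theorem dot_smul (n x : Pt) (c : ℝ) : dot n (c • x) = c * dot n x := by
  simp only [dot, Prod.smul_fst, Prod.smul_snd, smul_eq_mul]; ring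
theorem dot_neg (n x : Pt) : dot n (-x) = - dot n x := by
  simp only [dot, Prod.fst_neg, Prod.snd_neg]; ring

theorem dot_self_pos {n : Pt} (hn : n ≠ 0) : 0 < dot n n := by
  unfold dot
  by_contra h
  push Not at h
  have h1 : n.1 = 0 := by nlinarith [mul_self_nonneg n.1, mul_self_nonneg n.2]
  have h2 : n.2 = 0 := by nlinarith [mul_self_nonneg n.1, mul_self_nonneg n.2]
  exact hn (Prod.ext h1 h2)

/-- a nonzero functional bounded on `P` is strictly smaller on interior points: value at zero -/
theorem zero_lt_of_bound {P : Set Pt} (h0 : (0 : Pt) ∈ interior P) (n : Pt) (hn : n ≠ 0) (c : ℝ)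
    (h : ∀ x ∈ P, dot n x ≤ c) : 0 < c := by
  have hcont : Filter.Tendsto (fun t : ℝ => t • n) (nhds 0) (nhds (0 : Pt)) := by
    have : Continuous (fun t : ℝ => t • n) := by fun_prop
    simpa using this.tendsto 0
  have h1 : ∀ᶠ t : ℝ in nhds 0, t • n ∈ P :=
    hcont.eventually (mem_interior_iff_mem_nhds.mp h0)
  obtain ⟨t, ht, htp⟩ := (h1.filter_mono nhdsWithin_le_nhds |>.and
    (self_mem_nhdsWithin : ∀ᶠ t : ℝ in nhdsWithin 0 (Ioi 0), t ∈ Ioi 0)).exists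
  have := h _ ht
  rw [dot_smul] at this
  have hp : 0 < dot n n := dot_self_pos hn
  have htp' : 0 < t := htp
  have : 0 < t * dot n n := by positivity
  linarith

theorem exposed_of_extreme {P : Set Pt} (hP : Convex ℝ P) (hfin : (extremePoints ℝ P).Finite) {v : Pt}
    (hv : v ∈ extremePoints ℝ P) :
    ∃ f : Pt, ∀ x ∈ extremePoints ℝ P, x ≠ v → dot f x < dot f v := by
  have hnot : v ∉ convexHull ℝ (extremePoints ℝ P \ {v}) := by
    have h1 := (hP.mem_extremePoints_iff_mem_sdiff_convexHull_sdiff).mp hv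
    intro h2
    exact h1.2 (convexHull_mono (sdiff_subset_sdiff_left (extremePoints_subset)) h2)
  have hcl : IsClosed (convexHull ℝ (extremePoints ℝ P \ {v})) :=
    (hfin.subset sdiff_subset).isClosed_convexHull ℝ
  obtain ⟨f, c, hf1, hf2⟩ := geometric_hahn_banach_closed_point (convex_convexHull ℝ _) hcl hnot
  have hfe : ∀ x : Pt, f x = dot (f (1, 0), f (0, 1)) x := by
    intro x
    have : x = x.1 • ((1, 0) : Pt) + x.2 • ((0, 1) : Pt) := by ext <;> simp
    conv_lhs => rw [this]
    rw [map_add, map_smul, map_smul]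
    simp only [dot, smul_eq_mul]; ring
  refine ⟨(f (1, 0), f (0, 1)), fun x hx hxv => ?_⟩
  rw [← hfe, ← hfe]
  exact (hf1 x (subset_convexHull ℝ _ ⟨hx, hxv⟩)).trans hf2

theorem edge_exists {P : Set Pt} (hP : Convex ℝ P) (hfin : (extremePoints ℝ P).Finite)
    (hhull : P = convexHull ℝ (extremePoints ℝ P)) (h0 : (0 : Pt) ∈ interior P)
    (hcard : 2 ≤ (extremePoints ℝ P).ncard) {v : Pt} (hv : v ∈ extremePoints ℝ P) :
    ∃ w ∈ extremePoints ℝ P, ∃ n : Pt, 0 < dt v w ∧ dot n v = 1 ∧ dot n w = 1 ∧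
      ∀ x ∈ P, dot n x ≤ 1 := by
  obtain ⟨f, hf⟩ := exposed_of_extreme hP hfin hv
  have hne : (extremePoints ℝ P \ {v}).Nonempty := by
    by_contra h
    rw [not_nonempty_iff_eq_empty, sdiff_eq_empty] at h
    have := ncard_le_ncard h (finite_singleton v)
    rw [ncard_singleton] at this
    omega
  obtain ⟨w, ⟨hw, hwv⟩, hmin⟩ := exists_max_image (extremePoints ℝ P \ {v})
    (fun x => dt f (x - v) / dot f (v - x)) (hfin.subset sdiff_subset) hne
  have hpos : ∀ x ∈ extremePoints ℝ P, x ≠ v → 0 < dot f (v - x) := fun x hx hxv => by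
    rw [dot_sub]; have := hf x hx hxv; linarith
  have hwp := hpos w hw hwv
  have hf0 : 0 < dot f f := by
    apply dot_self_pos
    rintro rfl
    simp [dot] at hwp
  have hV : ∀ x ∈ extremePoints ℝ P, 0 ≤ dt (w - v) (x - v) := by
    intro x hx
    by_cases hxv : x = v
    · subst hxv; simp [dt]
    have hxp := hpos x hx hxv
    have h1 := hmin x ⟨hx, hxv⟩
    rw [div_le_div_iff₀ hxp hwp] at h1
    have h2 : dt f (w - v) * dot f (v - x) - dt f (x - v) * dot f (v - w)
        = dot f f * dt (w - v) (x - v) := by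
      simp only [dot, dt, Prod.fst_sub, Prod.snd_sub]; ring
    have h3 : 0 ≤ dot f f * dt (w - v) (x - v) := by linarith
    exact nonneg_of_mul_nonneg_right h3 hf0
  let n' : Pt := ((w - v).2, -(w - v).1)
  have hn' : ∀ x, dot n' x = - dt (w - v) x := fun x => by
    simp only [dot, dt, n', Prod.fst_sub, Prod.snd_sub]; ring
  have hPle : ∀ x ∈ P, dot n' x ≤ dt v w := by
    have : P ⊆ {x : Pt | dot n' x ≤ dt v w} := by
      rw [hhull]
      refine convexHull_min (fun x hx => ?_) (dot_convex _ _)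
      have := hV x hx
      change dot n' x ≤ dt v w
      rw [hn']
      have e : dt (w - v) (x - v) = dt (w - v) x + dt v w := by
        simp only [dt, Prod.fst_sub, Prod.snd_sub]; ring
      linarith
    exact this
  have hn0 : n' ≠ 0 := by
    intro h
    apply hwv
    have h1 := congrArg Prod.fst h
    have h2 := congrArg Prod.snd h
    simp only [n', Prod.fst_sub, Prod.snd_sub, Prod.fst_zero, Prod.snd_zero] at h1 h2
    exact Prod.ext (by linarith) (by linarith)
  have hpos' := zero_lt_of_bound h0 n' hn0 _ hPle
  have hd : ∀ x, dot ((dt v w)⁻¹ • n') x = (dt v w)⁻¹ * dot n' x := fun x => by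
    simp only [dot, Prod.smul_fst, Prod.smul_snd, smul_eq_mul]; ring
  refine ⟨w, hw, (dt v w)⁻¹ • n', hpos', ?_, ?_, ?_⟩
  · rw [hd, hn']
    have : - dt (w - v) v = dt v w := by simp only [dt, Prod.fst_sub, Prod.snd_sub]; ring
    rw [this, inv_mul_cancel₀ hpos'.ne']
  · rw [hd, hn']
    have : - dt (w - v) w = dt v w := by simp only [dt, Prod.fst_sub, Prod.snd_sub]; ring
    rw [this, inv_mul_cancel₀ hpos'.ne']
  · intro x hx
    rw [hd, inv_mul_le_iff₀ hpos', mul_one]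
    exact hPle x hx

/-- the kernel of a nonzero functional is a line -/
theorem ker_line {n d y : Pt} (hn : n ≠ 0) (hd : d ≠ 0) (h1 : dot n d = 0) (h2 : dot n y = 0) :
    ∃ c : ℝ, y = c • d := by
  have hdd := dot_self_pos hd
  have hnn := dot_self_pos hn
  have hdet : dt d y = 0 := by
    have : dot n n * dt d y = 0 := by
      have : dot n n * dt d y = dot n d * (n.1 * y.2 - n.2 * y.1) - dot n y * (n.1 * d.2 - n.2 * d.1) := by
        simp only [dot, dt]; ring
      rw [this, h1, h2]; ring
    exact (mul_eq_zero.mp this).resolve_left hnn.ne'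
  refine ⟨dot d y / dot d d, ?_⟩
  have e1 : y.1 * dot d d = dot d y * d.1 := by
    simp only [dot, dt] at *; linear_combination (-d.2) * hdet
  have e2 : y.2 * dot d d = dot d y * d.2 := by
    simp only [dot, dt] at *; linear_combination (d.1) * hdet
  ext
  · simp only [Prod.smul_fst, smul_eq_mul]; field_simp; linarith
  · simp only [Prod.smul_snd, smul_eq_mul]; field_simp; linarith

theorem extreme_on_line {P : Set Pt} {n v w x : Pt} (hv : v ∈ extremePoints ℝ P)
    (hw : w ∈ extremePoints ℝ P) (hvw : v ≠ w) (hx : x ∈ extremePoints ℝ P)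
    (nv : dot n v = 1) (nw : dot n w = 1) (nx : dot n x = 1) : x = v ∨ x = w := by
  have hn : n ≠ 0 := by rintro rfl; simp [dot] at nv
  obtain ⟨c, hc⟩ := ker_line (y := x - v) hn (sub_ne_zero.mpr hvw.symm)
    (by rw [dot_sub, nv, nw, sub_self]) (by rw [dot_sub, nx, nv, sub_self])
  have hxe : x = v + c • (w - v) := by rw [← hc]; abel
  rcases lt_trichotomy c 0 with h | h | h
  · -- v between x and w
    exfalso
    have : v ∈ openSegment ℝ x w := by
      have h1c : 0 < 1 - c := by linarith
      refine ⟨1 / (1 - c), -c / (1 - c), by positivity, div_pos (by linarith) h1c, by field_simp; ring, ?_⟩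
      rw [hxe]
      ext <;> simp <;> field_simp <;> ring
    have h2 := hv.2 hx.1 hw.1 this
    have h3 := (mem_extremePoints.mp hv).2 x hx.1 w hw.1 this
    exact hvw h3.2.symm
  · left; rw [hxe, h]; simp
  rcases lt_trichotomy c 1 with h' | h' | h'
  · exfalso
    have : x ∈ openSegment ℝ v w := by
      refine ⟨1 - c, c, by linarith, h, by ring, ?_⟩
      rw [hxe]
      ext <;> simp <;> ring
    have h3 := (mem_extremePoints.mp hx).2 v hv.1 w hw.1 this
    exact hvw (h3.1.trans h3.2.symm)
  · right; rw [hxe, h']; simp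
  · exfalso
    have : w ∈ openSegment ℝ v x := by
      refine ⟨1 - 1 / c, 1 / c, ?_, by positivity, by ring, ?_⟩
      · rw [sub_pos, div_lt_one h]; exact h'
      · rw [hxe]
        ext <;> simp <;> field_simp <;> ring
    have h3 := (mem_extremePoints.mp hw).2 v hv.1 x hx.1 this
    exact hvw h3.1

theorem normal_inj {P : Set Pt} {n v w v' w' : Pt} (hv : v ∈ extremePoints ℝ P)
    (hw : w ∈ extremePoints ℝ P) (hv' : v' ∈ extremePoints ℝ P) (hw' : w' ∈ extremePoints ℝ P)
    (h : 0 < dt v w) (h' : 0 < dt v' w')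
    (nv : dot n v = 1) (nw : dot n w = 1) (nv' : dot n v' = 1) (nw' : dot n w' = 1) : v = v' := by
  have hne : ∀ a b, 0 < dt a b → a ≠ b := by
    rintro a b hab rfl; simp only [dt] at hab; linarith
  rcases extreme_on_line hv hw (hne _ _ h) hv' nv nw nv' with e | e
  · exact e.symm
  rcases extreme_on_line hv hw (hne _ _ h) hw' nv nw nw' with f | f
  · subst e f
    exfalso
    simp only [dt] at h h'
    linarith
  · exact absurd (e.trans f.symm) (hne _ _ h')

def cz (z : ℤ × ℤ) : Pt := ((z.1 : ℝ), (z.2 : ℝ))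

theorem smul_mem_int {P : Set Pt} (hP : Convex ℝ P) (hsym : ∀ x ∈ P, -x ∈ P)
    (h0 : (0 : Pt) ∈ interior P) {x : Pt} (hx : x ∈ P) {s : ℝ} (hs : |s| < 1) :
    s • x ∈ interior P := by
  have key : ∀ y ∈ P, ∀ t : ℝ, 0 < t → t < 1 → t • y ∈ interior P := by
    intro y hy t ht ht1
    refine hP.openSegment_interior_self_subset_interior h0 hy ⟨1 - t, t, by linarith, ht, by ring, ?_⟩
    simp
  obtain ⟨h1, h2⟩ := abs_lt.mp hs
  rcases lt_trichotomy s 0 with h | h | h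
  · have := key (-x) (hsym x hx) (-s) (by linarith) (by linarith)
    simpa using this
  · rw [h, zero_smul]; exact h0
  · exact key x hx s h h2

theorem bad_countable {P : Set Pt} (hP : Convex ℝ P) (hsym : ∀ x ∈ P, -x ∈ P)
    (h0 : (0 : Pt) ∈ interior P) {n v w : Pt} (hv : v ∈ P) (hvw : v ≠ w)
    (nv : dot n v = 1) (nw : dot n w = 1) (l : Pt) :
    {t : ℝ | v + t • (w - v) - l ∈ P ∧ v + t • (w - v) - l ∉ interior P ∧
      |dot n (v + t • (w - v) - l)| < 1}.Countable := by
  have hn : n ≠ 0 := by rintro rfl; simp [dot] at nv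
  have hnt : ∀ t : ℝ, dot n (v + t • (w - v) - l) = 1 - dot n l := fun t => by
    rw [dot_sub, dot_add, dot_smul, dot_sub, nv, nw]; ring
  by_cases hs : |1 - dot n l| < 1
  swap
  · convert countable_empty
    ext t
    simp only [mem_ofPred_eq, mem_empty_iff_false, iff_false, hnt]
    tauto
  set s := 1 - dot n l with hsd
  have hz := smul_mem_int hP hsym h0 hv hs
  obtain ⟨c, hc⟩ := ker_line (d := w - v) (y := v - l - s • v) hn (sub_ne_zero.mpr hvw.symm)
    (by rw [dot_sub, nv, nw, sub_self]) (by rw [dot_sub, dot_sub, dot_smul, nv, hsd]; ring)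
  have hpt : ∀ t : ℝ, v + t • (w - v) - l = s • v + (c + t) • (w - v) := fun t => by
    rw [add_smul, ← hc]; abel
  have hside : ∀ t1 t2 r : ℝ, 0 < r → r < 1 → c + t1 = r * (c + t2) → v + t2 • (w - v) - l ∈ P →
      v + t1 • (w - v) - l ∈ interior P := by
    intro t1 t2 r hr hr1 he h2
    refine hP.openSegment_interior_self_subset_interior hz h2 ⟨1 - r, r, by linarith, hr, by ring, ?_⟩
    rw [hpt t1, hpt t2, he]
    module
  have hsub : ∀ t1 ∈ {t : ℝ | v + t • (w - v) - l ∈ P ∧ v + t • (w - v) - l ∉ interior P},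
      ∀ t2 ∈ {t : ℝ | v + t • (w - v) - l ∈ P ∧ v + t • (w - v) - l ∉ interior P},
      ¬ (∃ r, 0 < r ∧ r < 1 ∧ c + t1 = r * (c + t2)) := by
    rintro t1 h1 t2 h2 ⟨r, hr, hr1, he⟩
    exact h1.2 (hside t1 t2 r hr hr1 he h2.1)
  have hne : ∀ t : ℝ, v + t • (w - v) - l ∉ interior P → c + t ≠ 0 := by
    intro t ht h
    apply ht
    rw [hpt, h, zero_smul, add_zero]; exact hz
  have hA : ({t : ℝ | (v + t • (w - v) - l ∈ P ∧ v + t • (w - v) - l ∉ interior P) ∧ 0 < c + t}).Subsingleton := by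
    rintro t1 ⟨h1, p1⟩ t2 ⟨h2, p2⟩
    by_contra hne
    rcases lt_or_gt_of_ne hne with h | h
    · exact hsub t1 h1 t2 h2 ⟨(c + t1) / (c + t2), by positivity, by rw [div_lt_one p2]; linarith,
        by field_simp⟩
    · exact hsub t2 h2 t1 h1 ⟨(c + t2) / (c + t1), by positivity, by rw [div_lt_one p1]; linarith,
        by field_simp⟩
  have hB : ({t : ℝ | (v + t • (w - v) - l ∈ P ∧ v + t • (w - v) - l ∉ interior P) ∧ c + t < 0}).Subsingleton := by
    rintro t1 ⟨h1, p1⟩ t2 ⟨h2, p2⟩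
    have p1' : c + t1 < 0 := p1
    have p2' : c + t2 < 0 := p2
    by_contra hne
    rcases lt_or_gt_of_ne hne with h | h
    · exact hsub t2 h2 t1 h1 ⟨(c + t2) / (c + t1), div_pos_of_neg_of_neg p2 p1,
        by rw [div_lt_one_of_neg p1]; linarith, by rw [div_mul_cancel₀ _ p1'.ne]⟩
    · exact hsub t1 h1 t2 h2 ⟨(c + t1) / (c + t2), div_pos_of_neg_of_neg p1 p2,
        by rw [div_lt_one_of_neg p2]; linarith, by rw [div_mul_cancel₀ _ p2'.ne]⟩
  refine (hA.countable.union hB.countable).mono ?_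
  rintro t ⟨h1, h2, -⟩
  rcases lt_or_gt_of_ne (hne t h2) with h | h
  · right; exact ⟨⟨h1, h2⟩, h⟩
  · left; exact ⟨⟨h1, h2⟩, h⟩

theorem exists_generic {P : Set Pt} (hP : Convex ℝ P) (hsym : ∀ x ∈ P, -x ∈ P)
    (h0 : (0 : Pt) ∈ interior P) {n v w : Pt} (hv : v ∈ P) (hvw : v ≠ w)
    (nv : dot n v = 1) (nw : dot n w = 1) :
    ∃ q ∈ openSegment ℝ v w, ∀ z : ℤ × ℤ, q - cz z ∈ P → q - cz z ∉ interior P →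
      ¬ |dot n (q - cz z)| < 1 := by
  have hc : (⋃ z : ℤ × ℤ, {t : ℝ | v + t • (w - v) - cz z ∈ P ∧ v + t • (w - v) - cz z ∉ interior P ∧
      |dot n (v + t • (w - v) - cz z)| < 1}).Countable :=
    countable_iUnion fun z => bad_countable hP hsym h0 hv hvw nv nw (cz z)
  obtain ⟨t, ht, ht2⟩ := (hc.dense_compl ℝ).exists_mem_open (isOpen_Ioo (a := (0:ℝ)) (b := 1))
    ⟨1 / 2, by norm_num, by norm_num⟩
  refine ⟨v + t • (w - v), ⟨1 - t, t, by linarith [ht2.2], ht2.1, by ring, by module⟩, ?_⟩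
  intro z h1 h2 h3
  exact ht (mem_iUnion.mpr ⟨z, h1, h2, h3⟩)

theorem finite_near (p : Pt) (R : ℝ) : {z : ℤ × ℤ | ‖p - cz z‖ ≤ R}.Finite := by
  refine ((finite_Icc ⌊p.1 - R⌋ ⌈p.1 + R⌉).prod (finite_Icc ⌊p.2 - R⌋ ⌈p.2 + R⌉)).subset ?_
  intro z hz
  have hz : ‖p - cz z‖ ≤ R := hz
  have h1 := (norm_fst_le (p - cz z)).trans hz
  have h2 := (norm_snd_le (p - cz z)).trans hz
  simp only [cz, Prod.fst_sub, Prod.snd_sub, Real.norm_eq_abs, abs_le] at h1 h2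
  refine ⟨⟨?_, ?_⟩, ⟨?_, ?_⟩⟩
  · exact_mod_cast (Int.floor_le _).trans (by linarith : p.1 - R ≤ z.1)
  · exact_mod_cast (by linarith : (z.1 : ℝ) ≤ p.1 + R).trans (Int.le_ceil _)
  · exact_mod_cast (Int.floor_le _).trans (by linarith : p.2 - R ≤ z.2)
  · exact_mod_cast (by linarith : (z.2 : ℝ) ≤ p.2 + R).trans (Int.le_ceil _)

theorem half_point {P : Set Pt} (hP : Convex ℝ P) (hcpt : IsCompact P) (hsym : ∀ x ∈ P, -x ∈ P)
    (h0 : (0 : Pt) ∈ interior P) (k : ℕ)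
    (hcov : ∀ p : Pt, (k : ℕ∞) ≤ {z : ℤ × ℤ | p - cz z ∈ P}.encard)
    (hpack : ∀ p : Pt, {z : ℤ × ℤ | p - cz z ∈ interior P}.encard ≤ (k : ℕ∞))
    {n v w : Pt} (hv : v ∈ P) (hw : w ∈ P) (hvw : v ≠ w)
    (nv : dot n v = 1) (nw : dot n w = 1) (hn : ∀ x ∈ P, dot n x ≤ 1) :
    ∃ q ∈ openSegment ℝ v w, ∃ z : ℤ × ℤ, cz z - q ∈ P ∧ dot n (cz z - q) = 1 := by
  obtain ⟨q, hq, hgen⟩ := exists_generic hP hsym h0 hv hvw nv nw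
  refine ⟨q, hq, ?_⟩
  by_contra hcon
  push Not at hcon
  have hqP : q ∈ P := hP.segment_subset hv hw (openSegment_subset_segment ℝ _ _ hq)
  have hnq : dot n q = 1 := by
    obtain ⟨a, b, ha, hb, hab, rfl⟩ := hq
    rw [dot_add, dot_smul, dot_smul, nv, nw]; linarith
  set A := {z : ℤ × ℤ | q - cz z ∈ interior P} with hA
  have hAfin : A.Finite := by
    have : A.encard ≤ k := hpack q
    exact finite_of_encard_le_coe this
  obtain ⟨R, hR⟩ := hcpt.isBounded.exists_norm_le
  have hF := finite_near q (R + ‖q‖)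
  have hT1 : ∀ z : ℤ × ℤ, Filter.Tendsto (fun ε : ℝ => (1 + ε) • q - cz z) (nhdsWithin 0 (Ioi 0))
      (nhds (q - cz z)) := by
    intro z
    have : Continuous (fun ε : ℝ => (1 + ε) • q - cz z) := by fun_prop
    have := this.tendsto 0
    simp only [add_zero, one_smul] at this
    exact this.mono_left nhdsWithin_le_nhds
  have hT2 : ∀ z : ℤ × ℤ, Filter.Tendsto (fun ε : ℝ => (1 - ε) • q - cz z) (nhdsWithin 0 (Ioi 0))
      (nhds (q - cz z)) := by
    intro z
    have : Continuous (fun ε : ℝ => (1 - ε) • q - cz z) := by fun_prop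
    have := this.tendsto 0
    simp only [sub_zero, one_smul] at this
    exact this.mono_left nhdsWithin_le_nhds
  have hεpos : ∀ᶠ ε : ℝ in nhdsWithin 0 (Ioi 0), 0 < ε := self_mem_nhdsWithin
  have hεlt : ∀ᶠ ε : ℝ in nhdsWithin 0 (Ioi 0), ε < 1 :=
    (eventually_lt_nhds (by norm_num : (0 : ℝ) < 1)).filter_mono nhdsWithin_le_nhds
  have hout : ∀ z : ℤ × ℤ, q - cz z ∈ P → dot n (q - cz z) = 1 → ∀ ε : ℝ, 0 < ε →
      (1 + ε) • q - cz z ∉ P := by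
    intro z _ h1 ε hε h2
    have := hn _ h2
    rw [dot_sub, dot_smul, hnq] at this
    rw [dot_sub, hnq] at h1
    linarith
  have h0A : (0 : ℤ × ℤ) ∉ A := by
    intro h
    have hev := (hT1 0).eventually (mem_interior_iff_mem_nhds.mp h)
    obtain ⟨ε, h1, h2⟩ := (hev.and hεpos).exists
    refine hout 0 (interior_subset h) ?_ ε h2 h1
    rw [dot_sub, hnq]; simp [dot, cz]
  have hev1 : ∀ᶠ ε : ℝ in nhdsWithin 0 (Ioi 0), ∀ z ∈ {z : ℤ × ℤ | ‖q - cz z‖ ≤ R + ‖q‖},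
      z ∉ A → (1 + ε) • q - cz z ∉ P := by
    rw [Filter.eventually_all_finite hF]
    intro z _
    by_cases hzA : z ∈ A
    · exact Filter.Eventually.of_forall fun _ h => absurd hzA h
    by_cases hzP : q - cz z ∈ P
    · have hge := hgen z hzP hzA
      have hle := hn _ hzP
      have hle' := hn _ (hsym _ hzP)
      rw [dot_neg] at hle'
      have h1 : dot n (q - cz z) = 1 := by
        by_contra hne
        have hlt : dot n (q - cz z) < 1 := lt_of_le_of_ne hle hne
        have : dot n (q - cz z) ≤ -1 := by
          by_contra hh
          exact hge (abs_lt.mpr ⟨by linarith, hlt⟩)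
        refine hcon z ?_ ?_
        · have := hsym _ hzP; rwa [neg_sub] at this
        · rw [← neg_sub, dot_neg]; linarith
      filter_upwards [hεpos] with ε hε _ using hout z hzP h1 ε hε
    · filter_upwards [(hT1 z).eventually (hcpt.isClosed.isOpen_compl.mem_nhds hzP)] with ε hε _ using hε
  have hev2 : ∀ᶠ ε : ℝ in nhdsWithin 0 (Ioi 0), ∀ z ∈ A, (1 - ε) • q - cz z ∈ interior P := by
    rw [Filter.eventually_all_finite hAfin]
    intro z hz
    exact (hT2 z).eventually (isOpen_interior.mem_nhds hz)
  obtain ⟨ε, ⟨⟨h1, h2⟩, hp⟩, hl⟩ := (((hev1.and hev2).and hεpos).and hεlt).exists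
  have hub : (k : ℕ∞) ≤ A.encard := by
    refine (hcov ((1 + ε) • q)).trans (encard_le_encard ?_)
    intro z hz
    have hz : (1 + ε) • q - cz z ∈ P := hz
    by_contra hzA
    refine h1 z ?_ hzA hz
    have e : q - cz z = ((1 + ε) • q - cz z) - ε • q := by module
    change ‖q - cz z‖ ≤ R + ‖q‖
    rw [e]
    refine (norm_sub_le _ _).trans (add_le_add (hR _ hz) ?_)
    rw [norm_smul, Real.norm_eq_abs, abs_of_pos hp]
    nlinarith [norm_nonneg q]
  have hlb : A.encard + 1 ≤ k := by
    refine le_trans ?_ (hpack ((1 - ε) • q))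
    rw [← encard_insert_of_notMem h0A]
    refine encard_le_encard ?_
    intro z hz
    rcases hz with rfl | hz
    · change (1 - ε) • q - cz 0 ∈ interior P
      have : cz 0 = 0 := by simp [cz]
      rw [this, sub_zero]
      exact smul_mem_int hP hsym h0 hqP (abs_lt.mpr ⟨by linarith, by linarith⟩)
    · exact h2 z hz
  have hfin : A.encard ≠ ⊤ := encard_ne_top_iff.mpr hAfin
  have : A.encard + 1 ≤ A.encard := hlb.trans hub
  exact absurd this (not_le.mpr (ENat.lt_add_one_iff hfin |>.mpr le_rfl))

open MeasureTheory in
theorem vol_open_le {U : Set Pt} (hU : IsOpen U) (k : ℕ)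
    (hpack : ∀ p : Pt, {z : ℤ × ℤ | p - cz z ∈ U}.encard ≤ (k : ℕ∞)) :
    volume U ≤ k := by
  set I : Set Pt := Ico (0 : ℝ) 1 ×ˢ Ico (0 : ℝ) 1 with hI
  have hIm : MeasurableSet I := measurableSet_Ico.prod measurableSet_Ico
  have hIv : volume I = 1 := by
    rw [hI, Measure.volume_eq_prod, Measure.prod_prod]; simp
  have hcov : U ⊆ ⋃ z : ℤ × ℤ, (fun x => x + cz z) '' ({x | x + cz z ∈ U} ∩ I) := by
    intro x hx
    refine mem_iUnion.mpr ⟨(⌊x.1⌋, ⌊x.2⌋), x - cz (⌊x.1⌋, ⌊x.2⌋), ⟨?_, ?_⟩, by simp⟩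
    · change x - cz _ + cz _ ∈ U
      rwa [sub_add_cancel]
    · simp only [hI, cz, mem_prod, Prod.fst_sub, Prod.snd_sub, mem_Ico]
      refine ⟨⟨?_, ?_⟩, ⟨?_, ?_⟩⟩
      · linarith [Int.floor_le x.1]
      · linarith [Int.lt_floor_add_one x.1]
      · linarith [Int.floor_le x.2]
      · linarith [Int.lt_floor_add_one x.2]
  have hVm : ∀ z : ℤ × ℤ, MeasurableSet {x : Pt | x + cz z ∈ U} := fun z =>
    (hU.preimage (by fun_prop : Continuous fun x : Pt => x + cz z)).measurableSet
  calc volume U ≤ volume (⋃ z : ℤ × ℤ, (fun x => x + cz z) '' ({x | x + cz z ∈ U} ∩ I)) :=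
        measure_mono hcov
    _ ≤ ∑' z : ℤ × ℤ, volume ((fun x => x + cz z) '' ({x | x + cz z ∈ U} ∩ I)) :=
        measure_iUnion_le _
    _ = ∑' z : ℤ × ℤ, volume ({x | x + cz z ∈ U} ∩ I) := by
        congr 1; ext z
        rw [image_add_right, measure_preimage_add_right]
    _ = ∑' z : ℤ × ℤ, ∫⁻ x in I, {x | x + cz z ∈ U}.indicator 1 x := by
        congr 1; ext z
        rw [lintegral_indicator_one (hVm z), Measure.restrict_apply (hVm z)]
    _ = ∫⁻ x in I, ∑' z : ℤ × ℤ, {x | x + cz z ∈ U}.indicator 1 x := by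
        rw [lintegral_tsum]
        intro z
        exact (measurable_one.indicator (hVm z)).aemeasurable
    _ ≤ ∫⁻ x in I, (k : ENNReal) := by
        refine lintegral_mono fun x => ?_
        have e1 : (∑' z : ℤ × ℤ, {x | x + cz z ∈ U}.indicator (1 : Pt → ENNReal) x)
            = ({z : ℤ × ℤ | x + cz z ∈ U}.encard : ENNReal) := by
          rw [← ENNReal.tsum_set_one, tsum_subtype {z : ℤ × ℤ | x + cz z ∈ U} (fun _ => (1 : ENNReal))]
          rfl
        have e2 : {z : ℤ × ℤ | x + cz z ∈ U}.encard = {z : ℤ × ℤ | x - cz z ∈ U}.encard := by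
          have : {z : ℤ × ℤ | x + cz z ∈ U} = (fun z => -z) '' {z : ℤ × ℤ | x - cz z ∈ U} := by
            ext z
            have hz : cz (-z) = - cz z := by simp [cz]
            simp only [mem_ofPred_eq, image_neg_eq_neg, Set.mem_neg, hz, sub_neg_eq_add]
          rw [this, neg_injective.injOn.encard_image]
        change (∑' z : ℤ × ℤ, {x | x + cz z ∈ U}.indicator (1 : Pt → ENNReal) x) ≤ _
        rw [e1, e2]
        exact_mod_cast hpack x
    _ = k := by rw [setLIntegral_const, hIv, mul_one]

open MeasureTheory in
theorem vol_le {P : Set Pt} (hP : Convex ℝ P) (k : ℕ)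
    (hpack : ∀ p : Pt, {z : ℤ × ℤ | p - cz z ∈ interior P}.encard ≤ (k : ℕ∞)) :
    volume P ≤ k := by
  have h1 : volume (frontier P) = 0 := hP.addHaar_frontier volume
  calc volume P ≤ volume (interior P ∪ frontier P) := by
        refine measure_mono fun x hx => ?_
        by_cases h : x ∈ interior P
        · exact Or.inl h
        · exact Or.inr ⟨subset_closure hx, h⟩
    _ ≤ volume (interior P) + volume (frontier P) := measure_union_le _ _
    _ = volume (interior P) := by rw [h1, add_zero]
    _ ≤ k := vol_open_le isOpen_interior k hpack

/-- open triangle with apex `0` -/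
def tri (a b : Pt) : Set Pt := {x | ∃ s t : ℝ, 0 < s ∧ 0 < t ∧ s + t < 1 ∧ x = s • a + t • b}

open MeasureTheory in
theorem vol_std : volume {p : Pt | 0 < p.1 ∧ 0 < p.2 ∧ p.1 + p.2 < 1} = ENNReal.ofReal (1 / 2) := by
  have : {p : Pt | 0 < p.1 ∧ 0 < p.2 ∧ p.1 + p.2 < 1}
      = regionBetween (fun _ => (0 : ℝ)) (fun x => 1 - x) (Ioo 0 1) := by
    ext p
    simp only [regionBetween, mem_ofPred_eq, mem_Ioo]
    constructor
    · rintro ⟨h1, h2, h3⟩; exact ⟨⟨h1, by linarith⟩, h2, by linarith⟩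
    · rintro ⟨⟨h1, _⟩, h2, h3⟩; exact ⟨h1, h2, by linarith⟩
  rw [this, Measure.volume_eq_prod, volume_regionBetween_eq_integral]
  · congr 1
    rw [← integral_Ioc_eq_integral_Ioo, ← intervalIntegral.integral_of_le (by norm_num)]
    simp only [Pi.sub_apply, sub_zero]
    rw [intervalIntegral.integral_sub (by simp) (by simp)]
    simp; norm_num
  · exact (by fun_prop : Continuous fun _ : ℝ => (0:ℝ)).integrableOn_Icc.mono_set Ioo_subset_Icc_self
  · exact (by fun_prop : Continuous fun x : ℝ => 1 - x).integrableOn_Icc.mono_set Ioo_subset_Icc_self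
  · exact measurableSet_Ioo
  · intro x hx; linarith [hx.2]

open MeasureTheory in
theorem vol_tri (a b : Pt) (h : 0 < dt a b) : volume (tri a b) = ENNReal.ofReal (dt a b / 2) := by
  let M : Matrix (Fin 2) (Fin 2) ℝ := !![a.1, b.1; a.2, b.2]
  let f : Pt →ₗ[ℝ] Pt := Matrix.toLin (Module.Basis.finTwoProd ℝ) (Module.Basis.finTwoProd ℝ) M
  have hf : ∀ x : Pt, f x = x.1 • a + x.2 • b := by
    intro x
    simp only [f, M, Matrix.toLin_finTwoProd_apply]
    ext <;> simp <;> ring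
  have hdet : LinearMap.det f = dt a b := by
    simp only [f, LinearMap.det_toLin, M, Matrix.det_fin_two_of, dt]; ring
  have him : tri a b = f '' {p : Pt | 0 < p.1 ∧ 0 < p.2 ∧ p.1 + p.2 < 1} := by
    ext x
    constructor
    · rintro ⟨s, t, hs, ht, hst, rfl⟩
      exact ⟨(s, t), ⟨hs, ht, hst⟩, hf _⟩
    · rintro ⟨p, ⟨hs, ht, hst⟩, rfl⟩
      exact ⟨p.1, p.2, hs, ht, hst, hf _⟩
  rw [him, Measure.addHaar_image_linearMap, hdet, vol_std, abs_of_pos h, ← ENNReal.ofReal_mul h.le]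
  congr 1; ring

theorem tri_open (a b : Pt) (h : 0 < dt a b) : MeasurableSet (tri a b) := by
  have : tri a b = {x : Pt | 0 < dt x b ∧ 0 < dt a x ∧ dt x b + dt a x < dt a b} := by
    ext x
    constructor
    · rintro ⟨s, t, hs, ht, hst, rfl⟩
      have e1 : dt (s • a + t • b) b = s * dt a b := by simp [dt]; ring
      have e2 : dt a (s • a + t • b) = t * dt a b := by simp [dt]; ring
      simp only [mem_ofPred_eq, e1, e2]
      refine ⟨by positivity, by positivity, by nlinarith⟩
    · rintro ⟨h1, h2, h3⟩
      refine ⟨dt x b / dt a b, dt a x / dt a b, by positivity, by positivity, ?_, ?_⟩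
      · rw [← add_div, div_lt_one h]; exact h3
      · ext
        · simp only [Prod.fst_add, Prod.smul_fst, smul_eq_mul]
          field_simp
          simp only [dt]; ring
        · simp only [Prod.snd_add, Prod.smul_snd, smul_eq_mul]
          field_simp
          simp only [dt]; ring
  rw [this]
  have c1 : Continuous fun x : Pt => dt x b := by unfold dt; fun_prop
  have c2 : Continuous fun x : Pt => dt a x := by unfold dt; fun_prop
  exact ((isOpen_lt continuous_const c1).inter ((isOpen_lt continuous_const c2).inter
    (isOpen_lt (c1.add c2) continuous_const))).measurableSet

def nx (q : Fin 6 → Pt) (i : Fin 6) : Pt :=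
  if h : i.val + 1 < 6 then q ⟨i.val + 1, h⟩ else - q 0

theorem dt_neg_right (a b : Pt) : dt a (-b) = dt b a := by
  simp only [dt, Prod.fst_neg, Prod.snd_neg]; ring
theorem dt_neg_neg (a b : Pt) : dt (-a) (-b) = dt a b := by
  simp only [dt, Prod.fst_neg, Prod.snd_neg]; ring
theorem dt_self (a : Pt) : dt a a = 0 := by simp only [dt]; ring
theorem dt_swap (a b : Pt) : dt a b = - dt b a := by simp only [dt]; ring
theorem dt_comb_left (s t : ℝ) (a b c : Pt) : dt (s • a + t • b) c = s * dt a c + t * dt b c := by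
  simp [dt]; ring
theorem dt_comb_right (s t : ℝ) (a b c : Pt) : dt c (s • a + t • b) = s * dt c a + t * dt c b := by
  simp [dt]; ring

theorem nx_pos {q : Fin 6 → Pt} (hpos : ∀ i j, i < j → 0 < dt (q i) (q j))
    (i : Fin 6) : 0 < dt (q i) (nx q i) := by
  unfold nx
  split_ifs with h
  · exact hpos _ _ (by rw [Fin.lt_def]; simp)
  · rw [dt_neg_right]
    refine hpos _ _ ?_
    rw [Fin.lt_def]; change 0 < i.val; omega

theorem nx_nonneg {q : Fin 6 → Pt} (hpos : ∀ i j, i < j → 0 < dt (q i) (q j))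
    {i j : Fin 6} (hij : i < j) : 0 ≤ dt (nx q i) (q j) := by
  rw [Fin.lt_def] at hij
  have := j.2
  unfold nx
  rw [dif_pos (by omega)]
  rcases eq_or_ne (i.val + 1) j.val with h | h
  · have : (⟨i.val + 1, by omega⟩ : Fin 6) = j := Fin.ext h
    rw [this, dt_self]
  · exact (hpos _ _ (by rw [Fin.lt_def]; change i.val + 1 < j.val; omega)).le

theorem tri_upper {q : Fin 6 → Pt} (hpos : ∀ i j, i < j → 0 < dt (q i) (q j))
    (i : Fin 6) {x : Pt} (hx : x ∈ tri (q i) (nx q i)) : 0 < dt (q 0) x := by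
  obtain ⟨s, t, hs, ht, -, rfl⟩ := hx
  rw [dt_comb_right]
  unfold nx
  split_ifs with h
  · have h1 : 0 < dt (q 0) (q ⟨i.val + 1, h⟩) := hpos _ _ (by rw [Fin.lt_def]; change 0 < i.val + 1; omega)
    have h2 : 0 ≤ dt (q 0) (q i) := by
      rcases eq_or_ne i 0 with rfl | hi
      · rw [dt_self]
      · exact (hpos _ _ (Fin.pos_of_ne_zero hi)).le
    positivity
  · rw [dt_neg_right, dt_self]
    have : 0 < dt (q 0) (q i) := hpos _ _ (by rw [Fin.lt_def]; change 0 < i.val; omega)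
    simp only [mul_zero, add_zero]
    positivity

theorem tri_disj {q : Fin 6 → Pt} (hpos : ∀ i j, i < j → 0 < dt (q i) (q j))
    : Pairwise (Function.onFun Disjoint fun i => tri (q i) (nx q i)) := by
  have key : ∀ i j, i < j → Disjoint (tri (q i) (nx q i)) (tri (q j) (nx q j)) := by
    intro i j hij
    rw [Set.disjoint_left]
    rintro x ⟨s, t, hs, ht, -, rfl⟩ ⟨s', t', hs', ht', -, he⟩
    have h1 : 0 < dt (s • q i + t • nx q i) (q j) := by
      rw [dt_comb_left]
      have := hpos i j hij
      have := nx_nonneg hpos hij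
      positivity
    rw [he, dt_comb_left, dt_self, dt_swap] at h1
    have := nx_pos hpos j
    have : 0 < t' * dt (q j) (nx q j) := by positivity
    linarith
  intro i j hij
  rcases lt_or_gt_of_ne hij with h | h
  · exact key i j h
  · exact (key j i h).symm

open MeasureTheory in
theorem vol_half {q : Fin 6 → Pt} (hpos : ∀ i j, i < j → 0 < dt (q i) (q j))
    : volume (⋃ i, tri (q i) (nx q i)) =
    ENNReal.ofReal ((∑ i, dt (q i) (nx q i)) / 2) := by
  rw [measure_iUnion (tri_disj hpos) (fun i => tri_open _ _ (nx_pos hpos i)), tsum_fintype]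
  rw [Finset.sum_div, ENNReal.ofReal_sum_of_nonneg (fun i _ => by have := nx_pos hpos i; positivity)]
  exact Finset.sum_congr rfl fun i _ => vol_tri _ _ (nx_pos hpos i)

theorem tri_subset {Q : Set Pt} (hQ : Convex ℝ Q) (h0 : (0 : Pt) ∈ Q) {a b : Pt} (ha : a ∈ Q) (hb : b ∈ Q) :
    tri a b ⊆ Q := by
  rintro x ⟨s, t, hs, ht, hst, rfl⟩
  have h1 : (s / (s + t)) • a + (t / (s + t)) • b ∈ Q :=
    hQ ha hb (by positivity) (by positivity) (by field_simp)
  have h2 := hQ h0 h1 (by linarith : 0 ≤ 1 - (s + t)) (by positivity : 0 ≤ s + t) (by ring)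
  convert h2 using 1
  rw [smul_zero, zero_add, smul_add, smul_smul, smul_smul, mul_div_cancel₀ _ (by positivity),
    mul_div_cancel₀ _ (by positivity)]

open MeasureTheory in
theorem vol_poly {Q : Set Pt} (hQ : Convex ℝ Q) {q : Fin 6 → Pt}
    (hpos : ∀ i j, i < j → 0 < dt (q i) (q j)) (hq : ∀ i, q i ∈ Q) (hq' : ∀ i, - q i ∈ Q) :
    ENNReal.ofReal (∑ i, dt (q i) (nx q i)) ≤ volume Q := by
  have h0 : (0 : Pt) ∈ Q := by
    have := hQ (hq 0) (hq' 0) (by norm_num : (0 : ℝ) ≤ 1 / 2) (by norm_num : (0 : ℝ) ≤ 1 / 2) (by norm_num)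
    simpa using this
  let q' : Fin 6 → Pt := fun i => - q i
  have hpos' : ∀ i j, i < j → 0 < dt (q' i) (q' j) := fun i j h => by
    simp only [q', dt_neg_neg]; exact hpos i j h
  have hnx : ∀ i, nx q' i = - nx q i := by
    intro i; unfold nx; split_ifs <;> rfl
  have hnQ : ∀ i, nx q i ∈ Q := by
    intro i; unfold nx; split_ifs
    · exact hq _
    · exact hq' _
  have hnQ' : ∀ i, - nx q i ∈ Q := by
    intro i; unfold nx; split_ifs
    · exact hq' _
    · rw [neg_neg]; exact hq _
  have hd : Disjoint (⋃ i, tri (q i) (nx q i)) (⋃ i, tri (q' i) (nx q' i)) := by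
    rw [Set.disjoint_left]
    intro x h1 h2
    obtain ⟨i, hi⟩ := mem_iUnion.mp h1
    obtain ⟨j, hj⟩ := mem_iUnion.mp h2
    have h3 := tri_upper hpos i hi
    have h4 := tri_upper hpos' j hj
    have : dt (q' 0) x = - dt (q 0) x := by simp [q', dt]; ring
    linarith
  have hm : MeasurableSet (⋃ i, tri (q' i) (nx q' i)) :=
    MeasurableSet.iUnion fun i => tri_open _ _ (nx_pos hpos' i)
  have hsum : ∑ i, dt (q' i) (nx q' i) = ∑ i, dt (q i) (nx q i) :=
    Finset.sum_congr rfl fun i _ => by rw [hnx]; exact dt_neg_neg _ _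
  have hnn : 0 ≤ ∑ i, dt (q i) (nx q i) := Finset.sum_nonneg fun i _ => (nx_pos hpos i).le
  calc ENNReal.ofReal (∑ i, dt (q i) (nx q i))
      = ENNReal.ofReal ((∑ i, dt (q i) (nx q i)) / 2) + ENNReal.ofReal ((∑ i, dt (q i) (nx q i)) / 2) := by
        rw [← ENNReal.ofReal_add (by positivity) (by positivity), add_halves]
    _ = volume ((⋃ i, tri (q i) (nx q i)) ∪ (⋃ i, tri (q' i) (nx q' i))) := by
        rw [measure_union hd hm, vol_half hpos, vol_half hpos', hsum]
    _ ≤ volume Q := by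
        refine measure_mono (union_subset (iUnion_subset fun i => ?_) (iUnion_subset fun i => ?_))
        · exact tri_subset hQ h0 (hq i) (hnQ i)
        · rw [hnx]; exact tri_subset hQ h0 (hq' i) (hnQ' i)

open MeasureTheory in
/-- a proper closed subset of a convex body has strictly smaller volume -/
theorem vol_lt {P Q : Set Pt} (hP : Convex ℝ P) (hi : (interior P).Nonempty) (hQc : IsClosed Q)
    (hQP : Q ⊆ P) {v : Pt} (hv : v ∈ P) (hvQ : v ∉ Q) (hfin : volume P ≠ ⊤) : volume Q < volume P := by
  have hne : (interior P \ Q).Nonempty := by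
    by_contra h
    rw [not_nonempty_iff_eq_empty, sdiff_eq_empty] at h
    have : closure (interior P) ⊆ Q := hQc.closure_subset_iff.mpr h
    rw [hP.closure_interior_eq_closure_of_nonempty_interior hi] at this
    exact hvQ (this (subset_closure hv))
  have hopen : IsOpen (interior P \ Q) := isOpen_interior.sdiff hQc
  have hp := hopen.measure_pos volume hne
  have hQf : volume Q ≠ ⊤ := ne_top_of_le_ne_top hfin (measure_mono hQP)
  calc volume Q < volume Q + volume (interior P \ Q) := ENNReal.lt_add_right hQf hp.ne'
    _ = volume (Q ∪ (interior P \ Q)) := by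
      rw [measure_union disjoint_sdiff_right hopen.measurableSet]
    _ ≤ volume P := measure_mono (union_subset hQP (sdiff_subset.trans interior_subset))

/-- `z / 2` is a boundary point of `P` in the relative interior of the edge with normal `n`. -/
def EP (P : Set Pt) (z : ℤ × ℤ) (n : Pt) : Prop :=
  (∀ x ∈ P, dot n x ≤ 1) ∧ dot n (cz z) = 2 ∧ (1 / 2 : ℝ) • cz z ∈ P ∧
  (∀ h : Pt, (∀ x ∈ P, dot h x ≤ 1) → dot h (cz z) = 2 → h = n) ∧
  ∃ v ∈ P, dot n v = 1 ∧ v ≠ (1 / 2 : ℝ) • cz z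

theorem cz_neg (z : ℤ × ℤ) : cz (-z) = - cz z := by
  simp [cz]

theorem dot_neg_left (n x : Pt) : dot (-n) x = - dot n x := by
  simp only [dot, Prod.fst_neg, Prod.snd_neg]; ring

theorem dot_neg_neg (n x : Pt) : dot (-n) (-x) = dot n x := by
  rw [dot_neg_left, dot_neg, neg_neg]

theorem EP.neg {P : Set Pt} (hsym : ∀ x ∈ P, -x ∈ P) {z : ℤ × ℤ} {n : Pt} (h : EP P z n) :
    EP P (-z) (-n) := by
  obtain ⟨h1, h2, h3, h4, v, hv, nv, hne⟩ := h
  refine ⟨fun x hx => ?_, ?_, ?_, fun g hg hg2 => ?_, -v, hsym v hv, ?_, ?_⟩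
  · have := h1 _ (hsym x hx)
    rw [dot_neg_left]; rwa [dot_neg] at this
  · rw [cz_neg, dot_neg_neg, h2]
  · rw [cz_neg, smul_neg]; exact hsym _ h3
  · have := h4 (-g) (fun x hx => by
      have := hg _ (hsym x hx)
      rw [dot_neg_left]; rwa [dot_neg] at this) (by rw [cz_neg, dot_neg] at hg2; rw [dot_neg_left, hg2])
    rw [← this, neg_neg]
  · rw [dot_neg_neg, nv]
  · rw [cz_neg, smul_neg]; intro h; exact hne (neg_injective h)

theorem EP.abs_lt {P : Set Pt} (hsym : ∀ x ∈ P, -x ∈ P) {z z' : ℤ × ℤ} {n n' : Pt}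
    (h : EP P z n) (h' : EP P z' n') (h1 : n ≠ n') (h2 : n ≠ -n') : |dot n (cz z')| < 2 := by
  have a1 := h.1 _ h'.2.2.1
  have a2 := h.1 _ (hsym _ h'.2.2.1)
  rw [dot_smul] at a1
  rw [dot_neg, dot_smul] at a2
  rw [_root_.abs_lt]
  constructor
  · apply lt_of_le_of_ne (by linarith)
    intro he
    have := h'.2.2.2.1 (-n) (fun x hx => by
      have := h.1 _ (hsym x hx)
      rw [dot_neg_left]; rwa [dot_neg] at this) (by rw [dot_neg_left, ← he]; norm_num)
    exact h2 (by rw [← this, neg_neg])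
  · apply lt_of_le_of_ne (by linarith)
    intro he
    exact h1 (h'.2.2.2.1 n h.1 he)

theorem dot_inj {v w n h : Pt} (hvw : 0 < dt v w) (h1 : dot n v = dot h v) (h2 : dot n w = dot h w) :
    h = n := by
  simp only [dt, dot] at *
  have e1 : (h.1 - n.1) * (v.1 * w.2 - v.2 * w.1) = 0 := by linear_combination v.2 * h2 - w.2 * h1
  have e2 : (h.2 - n.2) * (v.1 * w.2 - v.2 * w.1) = 0 := by linear_combination w.1 * h1 - v.1 * h2
  have f1 := (mul_eq_zero.mp e1).resolve_right hvw.ne'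
  have f2 := (mul_eq_zero.mp e2).resolve_right hvw.ne'
  exact Prod.ext (by linarith) (by linarith)

theorem ep_exists {P : Set Pt} (hP : Convex ℝ P) (hcpt : IsCompact P)
    (hfin : (extremePoints ℝ P).Finite) (hhull : P = convexHull ℝ (extremePoints ℝ P))
    (h0 : (0 : Pt) ∈ interior P) (hcard : 2 ≤ (extremePoints ℝ P).ncard)
    (hsym : ∀ x ∈ P, -x ∈ P) (k : ℕ)
    (hcov : ∀ p : Pt, (k : ℕ∞) ≤ {z : ℤ × ℤ | p - cz z ∈ P}.encard)
    (hpack : ∀ p : Pt, {z : ℤ × ℤ | p - cz z ∈ interior P}.encard ≤ (k : ℕ∞))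
    {v : Pt} (hv : v ∈ extremePoints ℝ P) :
    ∃ n : Pt, (∃ w ∈ extremePoints ℝ P, 0 < dt v w ∧ dot n v = 1 ∧ dot n w = 1) ∧
      ∃ z, EP P z n := by
  obtain ⟨w, hw, n, hvw, nv, nw, hn⟩ := edge_exists hP hfin hhull h0 hcard hv
  have hne : v ≠ w := by rintro rfl; rw [dt_self] at hvw; exact lt_irrefl _ hvw
  obtain ⟨q, hq, z, hz, nz⟩ := half_point hP hcpt hsym h0 k hcov hpack hv.1 hw.1 hne nv nw hn
  refine ⟨n, ⟨w, hw, hvw, nv, nw⟩, z, hn, ?_, ?_, ?_, v, hv.1, nv, ?_⟩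
  · obtain ⟨a, b, ha, hb, hab, rfl⟩ := hq
    rw [dot_sub, dot_add, dot_smul, dot_smul, nv, nw] at nz
    linarith
  · have hqP : q ∈ P := hP.openSegment_subset hv.1 hw.1 hq
    have := hP hqP hz (by norm_num : (0:ℝ) ≤ 1/2) (by norm_num : (0:ℝ) ≤ 1/2) (by norm_num)
    rwa [← smul_add, add_sub_cancel] at this
  · intro h hh h2
    have hz' := hh _ hz
    have hv' := hh _ hv.1
    have hw' := hh _ hw.1
    obtain ⟨a, b, ha, hb, hab, rfl⟩ := hq
    rw [dot_sub, dot_add, dot_smul, dot_smul, h2] at hz'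
    have e1 : dot h v = 1 := by nlinarith
    have e2 : dot h w = 1 := by nlinarith
    exact dot_inj hvw (by rw [nv, e1]) (by rw [nw, e2])
  · intro he
    have hqP : q ∈ P := hP.openSegment_subset hv.1 hw.1 hq
    have hm : v ∈ openSegment ℝ q (cz z - q) := by
      refine ⟨1/2, 1/2, by norm_num, by norm_num, by norm_num, ?_⟩
      rw [← smul_add, add_sub_cancel, he]
    have h3 := (mem_extremePoints.mp hv).2 q hqP _ hz hm
    have hqv : q = v := h3.1
    obtain ⟨a, b, ha, hb, hab, rfl⟩ := hq
    have h4 : b • (w - v) = 0 := by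
      have : a = 1 - b := by linarith
      subst this
      rw [sub_smul, one_smul] at hqv
      rw [smul_sub]
      have := sub_eq_zero.mpr hqv
      rw [← this]; abel
    rcases smul_eq_zero.mp h4 with h5 | h5
    · linarith
    · exact hne (sub_eq_zero.mp h5).symm

theorem dt_cz (a b : ℤ × ℤ) : dt (cz a) (cz b) = (D2z a b : ℝ) := by
  simp [dt, cz, D2z]

theorem dt_half (a b : Pt) : dt ((1 / 2 : ℝ) • a) ((1 / 2 : ℝ) • b) = dt a b / 4 := by
  simp only [dt, Prod.smul_fst, Prod.smul_snd, smul_eq_mul]; ring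

theorem tri_of_dot {a b c : ℤ × ℤ} {n : Pt} (hb : dot n (cz b) = 2) (ha : |dot n (cz a)| < 2)
    (hc : |dot n (cz c)| < 2) (hab : 0 < D2z a b) (hbc : 0 < D2z b c) :
    0 < D2z a b + D2z b c - D2z a c := by
  have key : (D2z a c : ℝ) * dot n (cz b) = D2z b c * dot n (cz a) + D2z a b * dot n (cz c) := by
    simp only [D2z, dot, cz]; push_cast; ring
  rw [hb] at key
  have h1 : (0 : ℝ) < D2z a b := by exact_mod_cast hab
  have h2 : (0 : ℝ) < D2z b c := by exact_mod_cast hbc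
  have ha' := (_root_.abs_lt.mp ha).2
  have hc' := (_root_.abs_lt.mp hc).2
  have : (0 : ℝ) < D2z a b + D2z b c - D2z a c := by nlinarith
  exact_mod_cast this

theorem D2z_neg_left (a b : ℤ × ℤ) : D2z (-a) b = - D2z a b := by
  simp only [D2z, Prod.fst_neg, Prod.snd_neg]; ring
theorem D2z_neg_right (a b : ℤ × ℤ) : D2z a (-b) = - D2z a b := by
  simp only [D2z, Prod.fst_neg, Prod.snd_neg]; ring
theorem D2z_self (a : ℤ × ℤ) : D2z a a = 0 := by
  simp only [D2z]; ring

theorem core_final {P : Set Pt} (hP : Convex ℝ P)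
    (hsym : ∀ x ∈ P, -x ∈ P) (h0 : (0 : Pt) ∈ interior P) (hvol : MeasureTheory.volume P ≤ 6)
    (u : Fin 6 → ℤ × ℤ) (N : Fin 6 → Pt) (hE : ∀ i, EP P (u i) (N i))
    (hN : ∀ i j, i ≠ j → |dot (N i) (cz (u j))| < 2)
    (hpos : ∀ i j, i < j → 0 < D2z (u i) (u j)) : False := by
  let S : Set (ℤ × ℤ) := {a | ∃ i, a = u i ∨ a = - u i}
  have hneg : ∀ a ∈ S, -a ∈ S := by
    rintro a ⟨i, rfl | rfl⟩
    · exact ⟨i, Or.inr rfl⟩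
    · exact ⟨i, Or.inl (neg_neg _)⟩
  have hT : TriConv S := by
    intro a ha b hb c hc hab hbc
    obtain ⟨i, hb⟩ := hb
    have hlt : ∀ x ∈ S, D2z x b ≠ 0 → |dot (N i) (cz x)| < 2 := by
      rintro x ⟨j, hx⟩ hne
      have hij : i ≠ j := by
        rintro rfl
        apply hne
        rcases hx with rfl | rfl <;> rcases hb with rfl | rfl <;>
          simp [D2z_neg_left, D2z_neg_right, D2z_self]
      rcases hx with rfl | rfl
      · exact hN i j hij
      · rw [cz_neg, dot_neg, abs_neg]; exact hN i j hij
    have h1 := hlt a ha hab.ne'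
    have h2 := hlt c hc (by
      intro h; simp only [D2z] at h hbc; linarith)
    rcases hb with rfl | rfl
    · exact tri_of_dot (hE i).2.1 h1 h2 hab hbc
    · refine tri_of_dot (n := - N i) ?_ ?_ ?_ hab hbc
      · rw [cz_neg, dot_neg_neg, (hE i).2.1]
      · rwa [dot_neg_left, abs_neg]
      · rwa [dot_neg_left, abs_neg]
  have h24 := ring24 hneg hT u (fun i => ⟨i, Or.inl rfl⟩) hpos
  let q : Fin 6 → Pt := fun i => (1 / 2 : ℝ) • cz (u i)
  let X : Set Pt := range q ∪ range (fun i => - q i)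
  let Q : Set Pt := convexHull ℝ X
  have hXP : X ⊆ P := by
    rintro x (⟨i, rfl⟩ | ⟨i, rfl⟩)
    · exact (hE i).2.2.1
    · exact hsym _ (hE i).2.2.1
  have hQP : Q ⊆ P := convexHull_min hXP hP
  have hXfin : X.Finite := (finite_range _).union (finite_range _)
  have hQc : IsClosed Q := hXfin.isClosed_convexHull ℝ
  have hvolQ := vol_poly (Q := Q) (q := q) (convex_convexHull ℝ X) (fun i j hij => by
      simp only [q]
      rw [dt_half, dt_cz]
      have : (0 : ℝ) < D2z (u i) (u j) := by exact_mod_cast hpos i j hij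
      linarith)
    (fun i => subset_convexHull ℝ X (Or.inl ⟨i, rfl⟩))
    (fun i => subset_convexHull ℝ X (Or.inr ⟨i, rfl⟩))
  have hsum : (6 : ℝ) ≤ ∑ i, dt (q i) (nx q i) := by
    rw [Fin.sum_univ_six]
    have e0 : nx q 0 = q 1 := rfl
    have e1 : nx q 1 = q 2 := rfl
    have e2 : nx q 2 = q 3 := rfl
    have e3 : nx q 3 = q 4 := rfl
    have e4 : nx q 4 = q 5 := rfl
    have e5 : nx q 5 = - q 0 := rfl
    rw [e0, e1, e2, e3, e4, e5, dt_neg_right]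
    simp only [q, dt_half, dt_cz]
    have : ((24 : ℤ) : ℝ) ≤ _ := Int.cast_le.mpr h24
    push_cast at this
    linarith
  obtain ⟨v, hv, nv, hvne⟩ := (hE 0).2.2.2.2
  have hvQ : v ∉ Q := by
    intro hvQ
    -- points of `X` other than `q 0` satisfy a strict inequality
    let Y : Set Pt := {q 0} ∪ {x | dot (N 0) x < 1}
    have hXY : X ⊆ Y := by
      have hq : ∀ j, dot (N 0) (q j) = dot (N 0) (cz (u j)) / 2 := fun j => by
        simp only [q, dot_smul]; ring
      rintro x (⟨i, rfl⟩ | ⟨i, rfl⟩)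
      · by_cases hi : i = 0
        · subst hi; exact Or.inl rfl
        · right
          have := (_root_.abs_lt.mp (hN 0 i (Ne.symm hi))).2
          change dot (N 0) (q i) < 1
          rw [hq]; linarith
      · right
        change dot (N 0) (-q i) < 1
        rw [dot_neg, hq]
        by_cases hi : i = 0
        · subst hi; rw [(hE 0).2.1]; norm_num
        · have := (_root_.abs_lt.mp (hN 0 i (Ne.symm hi))).1
          linarith
    have hq0 : dot (N 0) (q 0) = 1 := by
      simp only [q, dot_smul, (hE 0).2.1]; norm_num
    have hYc : Convex ℝ Y := by
      intro x hx y hy a b ha hb hab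
      have hle : ∀ t ∈ Y, dot (N 0) t ≤ 1 := by
        rintro t (rfl | ht)
        · exact hq0.le
        · exact le_of_lt ht
      rcases eq_or_lt_of_le ha with rfl | ha
      · have : b = 1 := by linarith
        subst this; simpa using hy
      rcases eq_or_lt_of_le hb with rfl | hb
      · have : a = 1 := by linarith
        subst this; simpa using hx
      by_cases hxy : x = q 0 ∧ y = q 0
      · rw [hxy.1, hxy.2, ← add_smul, hab, one_smul]; exact Or.inl rfl
      · right
        change dot (N 0) (a • x + b • y) < 1
        rw [dot_add, dot_smul, dot_smul]
        have hx1 := hle x hx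
        have hy1 := hle y hy
        rcases hx with hx | hx
        · rcases hy with hy | hy
          · exact absurd ⟨hx, hy⟩ hxy
          · have hy : dot (N 0) y < 1 := hy
            nlinarith
        · have hx : dot (N 0) x < 1 := hx
          nlinarith
    rcases convexHull_min hXY hYc hvQ with h | h
    · exact hvne h
    · exact absurd nv (ne_of_lt h)
  have hfin : MeasureTheory.volume P ≠ ⊤ := ne_top_of_le_ne_top (by norm_num) hvol
  have hlt := vol_lt hP ⟨0, h0⟩ hQc hQP hv hvQ hfin
  have h6 : (6 : ENNReal) ≤ ENNReal.ofReal (∑ i, dt (q i) (nx q i)) := by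
    have := ENNReal.ofReal_le_ofReal hsum
    simpa using this
  exact absurd (lt_of_le_of_lt (h6.trans hvolQ) hlt) (not_lt.mpr hvol)

/-- An irrational linear form on `ℤ²`. -/
def phi (z : ℤ × ℤ) : ℝ := z.1 + √2 * z.2

theorem phi_neg (z : ℤ × ℤ) : phi (-z) = - phi z := by
  simp [phi]; ring

theorem phi_ne {z : ℤ × ℤ} (hz : z ≠ 0) : phi z ≠ 0 := by
  intro h
  simp only [phi] at h
  by_cases h2 : z.2 = 0
  · rw [h2] at h
    simp at h
    exact hz (Prod.ext h h2)
  · have := (irrational_sqrt_two.mul_intCast h2).intCast_add z.1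
    exact this.ne_zero h

theorem key_diff {a b : ℤ × ℤ} (ha : phi a ≠ 0) (hb : phi b ≠ 0) :
    ((b.2 : ℝ) / phi b - a.2 / phi a) * (phi a * phi b) = D2z a b := by
  field_simp
  simp only [phi, D2z]
  push_cast
  ring

/-- The upper half plane, closed on one side. -/
def up (n : Pt) : Prop := 0 < n.2 ∨ (n.2 = 0 ∧ 0 < n.1)

theorem up_or {n : Pt} (hn : n ≠ 0) : up n ∨ up (-n) := by
  simp only [up, Prod.fst_neg, Prod.snd_neg]
  rcases lt_trichotomy n.2 0 with h | h | h
  · right; left; linarith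
  · rcases lt_trichotomy n.1 0 with h1 | h1 | h1
    · right; right; constructor <;> linarith
    · exact absurd (Prod.ext h1 h) hn
    · left; right; exact ⟨h, h1⟩
  · left; left; exact h

theorem not_up_neg {n : Pt} (h : up n) : ¬ up (-n) := by
  simp only [up, Prod.fst_neg, Prod.snd_neg] at *
  rintro (h1 | h1) <;> rcases h with h | ⟨h, h'⟩ <;> linarith

theorem EP.ne_zero {P : Set Pt} {z : ℤ × ℤ} {n : Pt} (h : EP P z n) : z ≠ 0 ∧ n ≠ 0 := by
  constructor
  · rintro rfl
    have := h.2.1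
    simp [dot, cz] at this
  · rintro rfl
    have := h.2.1
    simp [dot] at this

theorem EP.det_ne {P : Set Pt} (hsym : ∀ x ∈ P, -x ∈ P) {z z' : ℤ × ℤ} {n n' : Pt}
    (h : EP P z n) (h' : EP P z' n') (h1 : n ≠ n') (h2 : n ≠ -n') : D2z z z' ≠ 0 := by
  intro hd
  have a := h.abs_lt hsym h' h1 h2
  have b := h'.abs_lt hsym h h1.symm (by rintro rfl; exact h2 (neg_neg _).symm)
  have key : dot n (cz z') * dot n' (cz z) = 4 := by
    have e : dot n (cz z') * dot n' (cz z) - dot n (cz z) * dot n' (cz z')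
        = (D2z z z' : ℝ) * (n.2 * n'.1 - n.1 * n'.2) := by
      simp only [dot, cz, D2z]; push_cast; ring
    rw [hd, h.2.1, h'.2.1] at e
    push_cast at e
    linarith
  have : |dot n (cz z')| * |dot n' (cz z)| = 4 := by rw [← abs_mul, key]; norm_num
  nlinarith [abs_nonneg (dot n (cz z')), abs_nonneg (dot n' (cz z))]

open Classical in
theorem core {P : Set Pt} (hP : Convex ℝ P) (hcpt : IsCompact P)
    (hfin : (extremePoints ℝ P).Finite) (hhull : P = convexHull ℝ (extremePoints ℝ P))
    (h0 : (0 : Pt) ∈ interior P) (hcard : 12 ≤ (extremePoints ℝ P).ncard)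
    (hsym : ∀ x ∈ P, -x ∈ P) (k : ℕ) (hk : k ≤ 6)
    (hcov : ∀ p : Pt, (k : ℕ∞) ≤ {z : ℤ × ℤ | p - cz z ∈ P}.encard)
    (hpack : ∀ p : Pt, {z : ℤ × ℤ | p - cz z ∈ interior P}.encard ≤ (k : ℕ∞)) : False := by
  have hex : ∀ v : Pt, ∃ n : Pt, v ∈ extremePoints ℝ P →
      (∃ w ∈ extremePoints ℝ P, 0 < dt v w ∧ dot n v = 1 ∧ dot n w = 1) ∧ ∃ z, EP P z n := by
    intro v
    by_cases hv : v ∈ extremePoints ℝ P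
    · obtain ⟨n, hn⟩ := ep_exists hP hcpt hfin hhull h0 (by omega) hsym k hcov hpack hv
      exact ⟨n, fun _ => hn⟩
    · exact ⟨0, fun h => absurd h hv⟩
  choose nn hnn using hex
  have hinj : ∀ v ∈ extremePoints ℝ P, ∀ v' ∈ extremePoints ℝ P, nn v = nn v' → v = v' := by
    intro v hv v' hv' he
    obtain ⟨⟨w, hw, h1, h2, h3⟩, -⟩ := hnn v hv
    obtain ⟨⟨w', hw', h1', h2', h3'⟩, -⟩ := hnn v' hv'
    rw [← he] at h2' h3'
    exact normal_inj hv hw hv' hw' h1 h1' h2 h3 h2' h3'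
  let A : Finset Pt := hfin.toFinset
  have hA : 12 ≤ A.card := by rwa [ncard_eq_toFinset_card _ hfin] at hcard
  let f : Pt → Pt := fun v => if up (nn v) then nn v else - nn v
  have hf : ∀ v, f v = nn v ∨ f v = - nn v := fun v => by
    simp only [f]; split_ifs <;> simp
  have hcardT : 6 ≤ (A.image f).card := by
    have := Finset.card_le_mul_card_image (f := f) A 2 (by
      intro b hb
      by_contra hlt
      push Not at hlt
      obtain ⟨x, y, z, hx, hy, hz, hxy, hxz, hyz⟩ := Finset.two_lt_card_iff.mp hlt
      simp only [Finset.mem_filter, A, Finite.mem_toFinset] at hx hy hz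
      have ne : ∀ {x y}, x ∈ extremePoints ℝ P → y ∈ extremePoints ℝ P → x ≠ y → nn x ≠ nn y :=
        fun hx hy h h' => h (hinj _ hx _ hy h')
      have n1 := ne hx.1 hy.1 hxy
      have n2 := ne hx.1 hz.1 hxz
      have n3 := ne hy.1 hz.1 hyz
      have tr : ∀ x, f x = b → nn x = b ∨ nn x = -b := by
        intro x hx
        rcases hf x with h | h
        · left; rw [← h, hx]
        · right; rw [← hx, h, neg_neg]
      rcases tr x hx.2 with hx | hx <;> rcases tr y hy.2 with hy | hy <;>
        rcases tr z hz.2 with hz | hz <;> rw [hx, hy] at n1 <;> rw [hx, hz] at n2 <;>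
        rw [hy, hz] at n3 <;>
        first | exact n1 rfl | exact n2 rfl | exact n3 rfl)
    omega
  have hT : ∀ n ∈ A.image f, up n ∧ ∃ z, EP P z n := by
    intro n hn
    obtain ⟨v, hv, rfl⟩ := Finset.mem_image.mp hn
    simp only [A, Finite.mem_toFinset] at hv
    obtain ⟨-, z, hz⟩ := hnn v hv
    simp only [f]
    split_ifs with h
    · exact ⟨h, z, hz⟩
    · exact ⟨(up_or hz.ne_zero.2).resolve_left h, -z, hz.neg hsym⟩
  obtain ⟨T, hTs, hTc⟩ := Finset.exists_subset_card_eq hcardT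
  have hz : ∀ n : Pt, ∃ z, n ∈ T → EP P z n := by
    intro n
    by_cases h : n ∈ T
    · obtain ⟨z, hz⟩ := (hT n (hTs h)).2
      exact ⟨z, fun _ => hz⟩
    · exact ⟨0, fun h' => absurd h' h⟩
  choose zz hzz using hz
  let key : Pt → ℝ := fun n => ((zz n).2 : ℝ) / phi (zz n)
  have hsep : ∀ n ∈ T, ∀ n' ∈ T, n ≠ n' → n ≠ -n' := by
    rintro n hn n' hn' - rfl
    exact not_up_neg (hT _ (hTs hn')).1 (hT _ (hTs hn)).1
  have hkey : Set.InjOn key T := by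
    intro n hn n' hn' he
    by_contra hne
    have h1 := (hzz n hn).det_ne hsym (hzz n' hn') hne (hsep n hn n' hn' hne)
    have h2 := key_diff (phi_ne (hzz n hn).ne_zero.1) (phi_ne (hzz n' hn').ne_zero.1)
    have he : ((zz n).2 : ℝ) / phi (zz n) = ((zz n').2 : ℝ) / phi (zz n') := he
    rw [he, sub_self, zero_mul] at h2
    exact h1 (by exact_mod_cast h2.symm)
  have hKc : (T.image key).card = 6 := by rw [Finset.card_image_of_injOn hkey, hTc]
  let e := (T.image key).orderEmbOfFin hKc
  have hm : ∀ i, ∃ n ∈ T, key n = e i := fun i =>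
    Finset.mem_image.mp (Finset.orderEmbOfFin_mem _ hKc i)
  choose m hmT hme using hm
  have hmne : ∀ i j, i ≠ j → m i ≠ m j := by
    intro i j hij h
    apply hij
    apply e.injective
    rw [← hme, ← hme, h]
  have hu : ∀ i, ∃ (u : ℤ × ℤ) (N : Pt), EP P u N ∧ 0 < phi u ∧ (u.2 : ℝ) / phi u = e i ∧
      (N = m i ∨ N = - m i) := by
    intro i
    have h1 := hzz _ (hmT i)
    rcases lt_or_gt_of_ne (phi_ne h1.ne_zero.1) with h | h
    · refine ⟨-zz (m i), -m i, h1.neg hsym, by rw [phi_neg]; linarith, ?_, Or.inr rfl⟩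
      rw [← hme, phi_neg]
      simp only [key, Prod.snd_neg, Int.cast_neg, neg_div_neg_eq]
    · exact ⟨zz (m i), m i, h1, h, hme i, Or.inl rfl⟩
  choose u N hE hphi hue hNm using hu
  have hvol : MeasureTheory.volume P ≤ 6 := by
    refine (vol_le hP k hpack).trans ?_
    exact_mod_cast hk
  refine core_final hP hsym h0 hvol u N hE ?_ ?_
  · intro i j hij
    have h1 := hmne i j hij
    have h2 := hsep _ (hmT i) _ (hmT j) h1
    have h3 : - m i ≠ m j := fun h => h2 (by rw [← h, neg_neg])
    refine (hE i).abs_lt hsym (hE j) ?_ ?_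
    · rcases hNm i with h | h <;> rcases hNm j with h' | h' <;> rw [h, h'] <;> simpa
    · rcases hNm i with h | h <;> rcases hNm j with h' | h' <;> rw [h, h'] <;> simpa
  · intro i j hij
    have h2 := key_diff (hphi i).ne' (hphi j).ne'
    rw [hue, hue] at h2
    have : (0 : ℝ) < D2z (u i) (u j) := by
      rw [← h2]
      exact mul_pos (sub_pos.mpr (e.strictMono hij)) (mul_pos (hphi i) (hphi j))
    exact_mod_cast this

theorem image_extreme (T : Pt ≃ᵃ[ℝ] Pt) (P : Set Pt) :
    extremePoints ℝ (T '' P) = T '' extremePoints ℝ P := by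
  have hseg : ∀ a b x : Pt, T x ∈ openSegment ℝ (T a) (T b) ↔ x ∈ openSegment ℝ a b := by
    intro a b x
    have := image_openSegment ℝ (T : Pt →ᵃ[ℝ] Pt) a b
    simp only [AffineEquiv.coe_toAffineMap] at this
    rw [← this, T.injective.mem_set_image]
  ext y
  obtain ⟨x, rfl⟩ := T.surjective y
  rw [T.injective.mem_set_image, mem_extremePoints, mem_extremePoints, T.injective.mem_set_image]
  constructor
  · rintro ⟨h1, h2⟩
    refine ⟨h1, fun a ha b hb hx => ?_⟩
    have := h2 (T a) ⟨a, ha, rfl⟩ (T b) ⟨b, hb, rfl⟩ ((hseg a b x).mpr hx)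
    exact ⟨T.injective this.1, T.injective this.2⟩
  · rintro ⟨h1, h2⟩
    refine ⟨h1, ?_⟩
    rintro _ ⟨a, ha, rfl⟩ _ ⟨b, hb, rfl⟩ hx
    have := h2 a ha b hb ((hseg a b x).mp hx)
    exact ⟨by rw [this.1], by rw [this.2]⟩

theorem image_int (T : Pt ≃ᵃ[ℝ] Pt) (P : Set Pt) : interior (T '' P) = T '' interior P := by
  let H : Pt ≃ₜ Pt :=
    { T.toEquiv with
      continuous_toFun := (T : Pt →ᵃ[ℝ] Pt).continuous_of_finiteDimensional
      continuous_invFun := (T.symm : Pt →ᵃ[ℝ] Pt).continuous_of_finiteDimensional }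
  exact (H.image_interior P).symm

theorem count_eq (B : Pt ≃ₗ[ℝ] Pt) (T : Pt ≃ᵃ[ℝ] Pt) (c : Pt) (hT : ∀ x, T x = B.symm (x - c))
    (K : Set Pt) (p : Pt) :
    {z : ℤ × ℤ | p - cz z ∈ T '' K}.encard =
      {l ∈ B '' IntLattice | (B p + c) - l ∈ K}.encard := by
  have hinj : Function.Injective (fun z : ℤ × ℤ => B (cz z)) := by
    intro a b h
    have h := B.injective h
    simp only [cz, Prod.mk.injEq, Int.cast_inj] at h
    exact Prod.ext h.1 h.2
  rw [← hinj.encard_image]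
  congr 1
  have hmem : ∀ z : ℤ × ℤ, p - cz z ∈ T '' K ↔ B p + c - B (cz z) ∈ K := by
    intro z
    have : p - cz z = T (B p + c - B (cz z)) := by
      rw [hT, show B p + c - B (cz z) - c = B (p - cz z) by rw [map_sub]; abel,
        LinearEquiv.symm_apply_apply]
    rw [this, T.injective.mem_set_image]
  ext l
  constructor
  · rintro ⟨z, hz, rfl⟩
    exact ⟨⟨cz z, ⟨z.1, z.2, rfl⟩, rfl⟩, (hmem z).mp hz⟩
  · rintro ⟨⟨x, ⟨a, b, rfl⟩, rfl⟩, hl⟩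
    exact ⟨(a, b), (hmem (a, b)).mpr hl, rfl⟩

/-- a centrally symmetric convex `2m`-gon with `m ≥ 6` admits no `k`-fold lattice
tiling of the plane for any positive `k ≤ 6`; that is, `τ*(P) ≥ 7`. -/
theorem many_gon_lattice_ge_seven (m : ℕ) (hm : 6 ≤ m) (P : Set Pt)
    (hP : IsConvexPolygon P (2 * m)) (hsym : CentrallySymmetric P) :
    ∀ (L : Set Pt) (k : ℕ), 0 < k → k ≤ 6 → ¬IsKFoldLatticeTiling P L k := by
  rintro L k - hk ⟨⟨B, rfl⟩, hcov, hpack⟩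
  obtain ⟨hconv, hcpt, hintr, hfin, hcard, hhull⟩ := hP
  obtain ⟨c, hc⟩ := hsym
  let T : Pt ≃ᵃ[ℝ] Pt := (AffineEquiv.constVAdd ℝ Pt (-c)).trans B.symm.toAffineEquiv
  have hT : ∀ x, T x = B.symm (x - c) := by
    intro x
    simp only [T, AffineEquiv.trans_apply, AffineEquiv.constVAdd_apply, vadd_eq_add]
    rw [sub_eq_neg_add]
    rfl
  have hconv' : Convex ℝ (T '' P) := hconv.affine_image (T : Pt →ᵃ[ℝ] Pt)
  have hsym' : ∀ x ∈ T '' P, -x ∈ T '' P := by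
    rintro _ ⟨x, hx, rfl⟩
    refine ⟨c + c - x, (hc x).mp hx, ?_⟩
    rw [hT, hT, ← map_neg]
    congr 1
    abel
  have h0 : (0 : Pt) ∈ interior (T '' P) := by
    obtain ⟨x, hx⟩ := hintr
    have hx' : T x ∈ interior (T '' P) := by
      rw [image_int]; exact ⟨x, hx, rfl⟩
    have hmem := hsym' _ (interior_subset hx')
    have := hconv'.combo_interior_self_mem_interior hx' hmem
      (by norm_num : (0 : ℝ) < 1 / 2) (by norm_num : (0 : ℝ) ≤ 1 / 2) (by norm_num)
    rwa [← smul_add, add_neg_cancel, smul_zero] at this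
  refine core (P := T '' P) hconv'
    (hcpt.image (T : Pt →ᵃ[ℝ] Pt).continuous_of_finiteDimensional) ?_ ?_ h0 ?_ hsym' k hk ?_ ?_
  · rw [image_extreme]; exact hfin.image _
  · rw [image_extreme]
    conv_lhs => rw [hhull]
    exact (T : Pt →ᵃ[ℝ] Pt).image_convexHull _
  · rw [image_extreme, ncard_image_of_injective _ T.injective, hcard]; omega
  · intro p
    rw [count_eq B T c hT]
    exact hcov _
  · intro p
    rw [image_int, count_eq B T c hT]
    exact hpack _
end
end

section
/- (Bolle's criterion) Let P be a convex polygon in ℝ² and let Λ ⊆ ℝ² be a lattice. Then P + Λ is a k-fold lattice tiling of ℝ² for some positive integer k if and only if the following three conditions hold: (1) P is centrally symmetric; (2) after translating P so that its center of symmetry is the origin, the relative interior of each edge of P contains a point of (1/2)Λ; (3) every edge G of P whose midpoint does not belong to (1/2)Λ is a lattice vector of Λ, i.e., the difference of the two endpoints of G belongs to Λ. -/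
open Set Pointwise

noncomputable section

open Filter Topology

/-- The determinant (cross product) of two plane vectors. -/
def D (u x : Pt) : ℝ := u.1 * x.2 - u.2 * x.1

theorem D_add (u x y : Pt) : D u (x + y) = D u x + D u y := by simp [D]; ring
theorem D_sub (u x y : Pt) : D u (x - y) = D u x - D u y := by simp [D]; ring
theorem D_neg (u x : Pt) : D u (-x) = - D u x := by simp [D]; ring
theorem D_smul (u x : Pt) (s : ℝ) : D u (s • x) = s * D u x := by simp [D]; ring
theorem D_add_left (u x y : Pt) : D (x + y) u = D x u + D y u := by simp [D]; ring
theorem D_sub_left (u x y : Pt) : D (x - y) u = D x u - D y u := by simp [D]; ring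
theorem D_neg_left (u x : Pt) : D (-x) u = - D x u := by simp [D]; ring
theorem D_smul_left (u x : Pt) (s : ℝ) : D (s • x) u = s * D x u := by simp [D]; ring
theorem D_self (u : Pt) : D u u = 0 := by simp [D]; ring
theorem D_comm (u v : Pt) : D u v = - D v u := by simp [D]; ring

theorem D_cont (u : Pt) : Continuous (fun x => D u x) := by unfold D; fun_prop

/-- perpendicular vector -/
def perp (u : Pt) : Pt := (-u.2, u.1)

theorem D_perp_pos {u : Pt} (hu : u ≠ 0) : 0 < D u (perp u) := by
  have : u.1 ≠ 0 ∨ u.2 ≠ 0 := by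
    by_contra h
    push Not at h
    exact hu (Prod.ext h.1 h.2)
  simp only [D, perp]
  rcases this with h | h
  · have := sq_pos_of_ne_zero h
    nlinarith [sq_nonneg u.2]
  · have := sq_pos_of_ne_zero h
    nlinarith [sq_nonneg u.1]

theorem exists_smul_of_D {u x : Pt} (hu : u ≠ 0) (h : D u x = 0) : ∃ s : ℝ, x = s • u := by
  have h2 := D_perp_pos hu
  simp only [D, perp] at h h2
  have hq : u.1 * u.1 + u.2 * u.2 ≠ 0 := by nlinarith
  refine ⟨(x.1 * u.1 + x.2 * u.2) / (u.1 * u.1 + u.2 * u.2), ?_⟩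
  ext
  · simp only [Prod.smul_fst, smul_eq_mul]
    rw [div_mul_eq_mul_div, eq_div_iff hq]
    linear_combination (-u.2) * h
  · simp only [Prod.smul_snd, smul_eq_mul]
    rw [div_mul_eq_mul_div, eq_div_iff hq]
    linear_combination (u.1) * h

theorem D_zero_trans {u x y : Pt} (hu : u ≠ 0) (h : D x u = 0) (h' : D y u = 0) : D x y = 0 := by
  obtain ⟨s, rfl⟩ := exists_smul_of_D hu (by rw [D_comm, h, neg_zero] : D u x = 0)
  obtain ⟨t, rfl⟩ := exists_smul_of_D hu (by rw [D_comm, h', neg_zero] : D u y = 0)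
  rw [D_smul, D_smul_left, D_self]; ring

theorem D_basis {u v x : Pt} (huv : D u v ≠ 0) (h : D x u = 0) (h' : D x v = 0) : x = 0 := by
  have hu : u ≠ 0 := by rintro rfl; simp [D] at huv
  obtain ⟨s, rfl⟩ := exists_smul_of_D hu (by rw [D_comm, h, neg_zero] : D u x = 0)
  rw [D_smul_left] at h'
  rcases mul_eq_zero.1 h' with h0 | h0
  · simp [h0]
  · exact absurd h0 huv

theorem D_basis' {u v x : Pt} (huv : D u v ≠ 0) (h : D u x = 0) (h' : D v x = 0) : x = 0 :=
  D_basis huv (by rw [D_comm, h, neg_zero]) (by rw [D_comm, h', neg_zero])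

/-- every linear functional is `D w`. -/
theorem exists_D (f : StrongDual ℝ Pt) : ∃ w : Pt, ∀ x, f x = D w x := by
  refine ⟨(f (0, 1), - f (1, 0)), fun x => ?_⟩
  have : x = x.1 • ((1 : ℝ), (0 : ℝ)) + x.2 • ((0 : ℝ), (1 : ℝ)) := by ext <;> simp
  conv_lhs => rw [this]
  rw [map_add, map_smul, map_smul]
  simp [D]; ring

/-- sign lemma -/
theorem sign_ev (x y : ℝ) (h : x ≠ 0 ∨ y ≠ 0) : ∀ᶠ δ in 𝓝[>] (0 : ℝ),
    x + δ * y ≠ 0 ∧ (0 < x + δ * y ↔ 0 < x ∨ (x = 0 ∧ 0 < y)) := by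
  have hc : Tendsto (fun δ : ℝ => x + δ * y) (𝓝[>] 0) (𝓝 x) := by
    have : Continuous (fun δ : ℝ => x + δ * y) := by fun_prop
    have h := (this.tendsto 0).mono_left (nhdsWithin_le_nhds (s := Set.Ioi 0))
    simpa using h
  rcases lt_trichotomy x 0 with hx | hx | hx
  · filter_upwards [hc.eventually (gt_mem_nhds hx)] with δ hδ
    refine ⟨hδ.ne, ⟨fun h => by linarith, ?_⟩⟩
    rintro (h | h) <;> linarith [h]
  · filter_upwards [self_mem_nhdsWithin] with δ hδ
    have hδ : 0 < δ := hδ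
    subst hx
    have hy : y ≠ 0 := by simpa using h
    simp [hδ, hδ.ne', hy]
  · filter_upwards [hc.eventually (lt_mem_nhds hx)] with δ hδ
    exact ⟨hδ.ne', ⟨fun _ => Or.inl hx, fun _ => hδ⟩⟩

/-- existence of generic directions -/
theorem exists_generic_s12 (S : Set Pt) (hS : S.Finite) (h0 : ∀ y ∈ S, y ≠ 0) :
    ∃ z : Pt, ∀ y ∈ S, D y z ≠ 0 := by
  have hfin : (⋃ y ∈ S, {t : ℝ | D y (1, t) = 0}).Finite := by
    refine hS.biUnion fun y hy => ?_
    refine Set.Subsingleton.finite fun t ht t' ht' => ?_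
    simp only [D, Set.mem_ofPred_eq] at ht ht'
    by_contra hne
    have h1 : y.1 * (t - t') = 0 := by linarith
    have h1 : y.1 = 0 := by
      rcases mul_eq_zero.1 h1 with h | h
      · exact h
      · exact absurd (sub_eq_zero.1 h) hne
    have h2 : y.2 = 0 := by rw [h1] at ht; linarith
    exact h0 y hy (Prod.ext h1 h2)
  obtain ⟨t, ht⟩ := hfin.infinite_compl.nonempty
  refine ⟨(1, t), fun y hy h => ht ?_⟩
  simp only [Set.mem_iUnion]
  exact ⟨y, hy, h⟩

theorem ev_exists {p : ℝ → Prop} (h : ∀ᶠ δ in 𝓝[>] (0 : ℝ), p δ) : ∃ δ, 0 < δ ∧ p δ := by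
  obtain ⟨δ, h1, h2⟩ := (h.and self_mem_nhdsWithin).exists
  exact ⟨δ, h2, h1⟩

/-- The oriented edges of a polygon. -/
def EE (P : Set Pt) : Set (Pt × Pt) :=
  {e | e.1 ∈ Set.extremePoints ℝ P ∧ e.2 ∈ Set.extremePoints ℝ P ∧ e.1 ≠ e.2 ∧
    ∀ x ∈ P, 0 ≤ D (e.2 - e.1) (x - e.1)}

theorem EE_finite {P : Set Pt} {n : ℕ} (hP : IsConvexPolygon P n) : (EE P).Finite :=
  (hP.2.2.2.1.prod hP.2.2.2.1).subset fun _ he => ⟨he.1, he.2.1⟩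

theorem D_strict {P : Set Pt} {w : Pt} {c : ℝ} (hw : w ≠ 0) (h : ∀ x ∈ P, c ≤ D w x)
    {o : Pt} (ho : o ∈ interior P) : c < D w o := by
  have hcont : Continuous (fun s : ℝ => o + s • (-perp w)) := by fun_prop
  have : ∀ᶠ s in 𝓝 (0 : ℝ), o + s • (-perp w) ∈ P := by
    apply hcont.tendsto 0
    simpa using mem_interior_iff_mem_nhds.1 ho
  obtain ⟨s, hs, hs'⟩ := ev_exists (this.filter_mono nhdsWithin_le_nhds)
  have h1 := h _ hs'
  rw [D_add, D_smul, D_neg] at h1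
  have := D_perp_pos hw
  nlinarith [mul_pos hs this]

theorem EE_face {P : Set Pt} {e : Pt × Pt} (he : e ∈ EE P) {x : Pt} (hx : x ∈ P)
    (h : D (e.2 - e.1) (x - e.1) = 0) : ∃ s : ℝ, 0 ≤ s ∧ s ≤ 1 ∧ x = e.1 + s • (e.2 - e.1) := by
  obtain ⟨h1, h2, hne, -⟩ := he
  have hu : e.2 - e.1 ≠ 0 := sub_ne_zero.2 hne.symm
  obtain ⟨s, hs⟩ := exists_smul_of_D hu h
  refine ⟨s, ?_, ?_, by rw [← hs]; abel⟩
  · by_contra hneg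
    push Not at hneg
    have := h1.2 h2.1 hx ?_
    · exact hne this.symm
    · refine ⟨-s / (1 - s), 1 / (1 - s), div_pos (by linarith) (by linarith),
        div_pos (by linarith) (by linarith), by rw [← add_div]; exact (div_eq_one_iff_eq (by linarith)).2 (by ring), ?_⟩
      have h3 : (1 - s) ≠ 0 := by linarith
      have hx' : x = e.1 + s • (e.2 - e.1) := by rw [← hs]; abel
      rw [hx']
      ext <;> simp <;> field_simp <;> ring
  · by_contra hneg
    push Not at hneg
    have := h2.2 h1.1 hx ?_
    · exact hne this
    · refine ⟨(s - 1) / s, 1 / s, div_pos (by linarith) (by linarith),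
        div_pos (by linarith) (by linarith), by field_simp; ring, ?_⟩
      have h3 : s ≠ 0 := by linarith
      have hx' : x = e.1 + s • (e.2 - e.1) := by rw [← hs]; abel
      rw [hx']
      ext <;> simp <;> field_simp <;> ring

/-- two distinct extreme points minimizing a common functional give an edge. -/
theorem EE_of_min {P : Set Pt} {a b w : Pt} (ha : a ∈ Set.extremePoints ℝ P)
    (hb : b ∈ Set.extremePoints ℝ P) {τ : ℝ} (hτ : 0 < τ) (hab : b - a = τ • w) (hne : a ≠ b)
    (h : ∀ x ∈ P, D w a ≤ D w x) : (a, b) ∈ EE P := by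
  refine ⟨ha, hb, hne, fun x hx => ?_⟩
  simp only [hab]
  rw [D_smul_left, D_sub]
  exact mul_nonneg hτ.le (by linarith [h x hx])

theorem EE_ext_face {P : Set Pt} {e : Pt × Pt} (he : e ∈ EE P) {x : Pt}
    (hx : x ∈ Set.extremePoints ℝ P) (h : D (e.2 - e.1) (x - e.1) = 0) : x = e.1 ∨ x = e.2 := by
  obtain ⟨s, h0, h1, rfl⟩ := EE_face he hx.1 h
  rcases h0.eq_or_lt with h0 | h0
  · left; simp [← h0]
  rcases h1.eq_or_lt with h1 | h1
  · right; simp [h1]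
  left
  symm
  apply hx.2 he.1.1 he.2.1.1
  exact ⟨1 - s, s, by linarith, h0, by ring, by ext <;> simp <;> ring⟩

theorem EE_uniq {P : Set Pt} {e e' : Pt × Pt} (he : e ∈ EE P) (he' : e' ∈ EE P) {σ : ℝ}
    (hσ : 0 < σ) (h : e'.2 - e'.1 = σ • (e.2 - e.1)) : e = e' := by
  have h1 := he.2.2.2 _ he'.1.1
  have h2 := he'.2.2.2 _ he.1.1
  rw [h, D_smul_left] at h2
  have h3 : D (e.2 - e.1) (e'.1 - e.1) = 0 := by
    have : D (e.2 - e.1) (e.1 - e'.1) = - D (e.2 - e.1) (e'.1 - e.1) := by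
      rw [← D_neg]; congr 1; abel
    have h4 := nonneg_of_mul_nonneg_right h2 hσ
    linarith
  have h4 : D (e.2 - e.1) (e'.2 - e.1) = 0 := by
    have : e'.2 - e.1 = (e'.1 - e.1) + σ • (e.2 - e.1) := by rw [← h]; abel
    rw [this, D_add, h3, D_smul, D_self]; ring
  have hu : e.2 - e.1 ≠ 0 := sub_ne_zero.2 he.2.2.1.symm
  rcases EE_ext_face he he'.1 h3 with h5 | h5 <;> rcases EE_ext_face he he'.2.1 h4 with h6 | h6
  · exact absurd (h5.trans h6.symm) he'.2.2.1
  · exact Prod.ext h5.symm h6.symm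
  · exfalso
    rw [h5, h6] at h
    have : (σ + 1) • (e.2 - e.1) = 0 := by rw [add_smul, ← h]; simp
    rcases smul_eq_zero.1 this with h7 | h7
    · linarith
    · exact hu h7
  · exact absurd (h5.trans h6.symm) he'.2.2.1

theorem mem_P_iff {P : Set Pt} {n : ℕ} (hP : IsConvexPolygon P n) (x : Pt) :
    x ∈ P ↔ ∀ e ∈ EE P, 0 ≤ D (e.2 - e.1) (x - e.1) := by
  refine ⟨fun hx e he => he.2.2.2 x hx, fun h => ?_⟩
  by_contra hx
  obtain ⟨hconv, hcomp, ⟨o', ho'⟩, hfin, -, hhull⟩ := hP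
  obtain ⟨o, ho, hgen⟩ : ∃ o ∈ interior P, ∀ y ∈ Set.extremePoints ℝ P, D (y - x) (o - x) ≠ 0 := by
    obtain ⟨z, hz⟩ := exists_generic_s12 ((fun y => y - x) '' Set.extremePoints ℝ P) (hfin.image _) (by
      rintro _ ⟨y, hy, rfl⟩
      refine sub_ne_zero.2 ?_
      rintro rfl
      exact hx hy.1)
    have hcont : Continuous (fun s : ℝ => o' + s • z) := by fun_prop
    have h1 : ∀ᶠ s in 𝓝 (0 : ℝ), o' + s • z ∈ interior P := by
      apply hcont.tendsto 0
      simpa using isOpen_interior.mem_nhds ho'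
    have h2 : ∀ᶠ s in 𝓝[>] (0 : ℝ), ∀ y ∈ Set.extremePoints ℝ P,
        D (y - x) (o' - x) + s * D (y - x) z ≠ 0 := by
      rw [Filter.eventually_all_finite hfin]
      intro y hy
      exact (sign_ev _ _ (Or.inr (hz _ ⟨y, hy, rfl⟩))).mono fun s hs => hs.1
    obtain ⟨s, hs, h3, h4⟩ := ev_exists ((h1.filter_mono nhdsWithin_le_nhds).and h2)
    refine ⟨_, h3, fun y hy => ?_⟩
    have := h4 y hy
    rwa [← D_smul, ← D_add, show o' - x + s • z = o' + s • z - x by abel] at this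
  obtain ⟨y, hyseg, hyP, hyint⟩ : ∃ y ∈ segment ℝ o x, y ∈ P ∧ y ∉ interior P := by
    by_contra hcon
    push Not at hcon
    have hpre : IsPreconnected (segment ℝ o x) := (convex_segment o x).isPreconnected
    obtain ⟨z, -, hz1, hz2⟩ := hpre (interior P) Pᶜ isOpen_interior hcomp.isClosed.isOpen_compl
      (fun z hz => by
        by_cases hzP : z ∈ P
        · exact Or.inl (hcon z hz hzP)
        · exact Or.inr hzP) ⟨o, left_mem_segment _ _ _, ho⟩ ⟨x, right_mem_segment _ _ _, hx⟩
    exact hz2 (interior_subset hz1)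
  obtain ⟨f, hf⟩ := geometric_hahn_banach_open_point hconv.interior isOpen_interior hyint
  obtain ⟨w', hw'⟩ := exists_D f
  obtain ⟨w, hw⟩ : ∃ w, w = -w' := ⟨_, rfl⟩
  have hmin : ∀ z ∈ P, D w y ≤ D w z := by
    have hcl : P ⊆ closure (interior P) := by
      rw [hconv.closure_interior_eq_closure_of_nonempty_interior ⟨o, ho⟩]
      exact subset_closure
    intro z hz
    have : closure (interior P) ⊆ {z | D w y ≤ D w z} := by
      refine closure_minimal (fun z hz => ?_) (isClosed_le continuous_const (D_cont w))
      have := hf z hz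
      rw [hw', hw'] at this
      simp only [Set.mem_ofPred_eq, hw, D_neg_left]
      linarith
    exact this (hcl hz)
  have hw0 : w ≠ 0 := by
    rintro h0
    have := hf o ho
    have h2 : w' = 0 := by rw [h0] at hw; simpa using hw.symm
    rw [hw', hw', h2] at this
    simp [D] at this
  obtain ⟨F, hF⟩ : ∃ F, F = {z | z ∈ P ∧ D w z = D w y} := ⟨_, rfl⟩
  have hFext : IsExtreme ℝ P F := by
    subst hF
    refine ⟨fun z hz => hz.1, ?_⟩
    rintro p hp q hq z ⟨hz, hz'⟩ ⟨s, t, hs, ht, hst, rfl⟩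
    refine ⟨hp, ?_⟩
    rw [D_add, D_smul, D_smul] at hz'
    have h1 := hmin p hp
    have h2 := hmin q hq
    have h3 : t = 1 - s := by linarith
    subst h3
    nlinarith
  have hFcomp : IsCompact F := by
    subst hF
    exact hcomp.inter_right (isClosed_eq (D_cont w) continuous_const)
  have hFconv : Convex ℝ F := by
    subst hF
    rintro p ⟨hp, hp'⟩ q ⟨hq, hq'⟩ s t hs ht hst
    refine ⟨hconv hp hq hs ht hst, ?_⟩
    rw [D_add, D_smul, D_smul, hp', hq', ← add_mul, hst, one_mul]
  have hyF : y ∈ F := by rw [hF]; exact ⟨hyP, rfl⟩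
  have hsub := hFext.extremePoints_subset_extremePoints
  have hynot : y ∉ Set.extremePoints ℝ P := by
    intro hy
    apply hgen y hy
    obtain ⟨s, t, hs, ht, hst, rfl⟩ := hyseg
    have : s • o + t • x - x = s • (o - x) := by
      have : t = 1 - s := by linarith
      subst this
      ext <;> simp <;> ring
    rw [this, D_smul_left, D_self, mul_zero]
  obtain ⟨a, b, ha, hb, hab⟩ : ∃ a b, a ∈ Set.extremePoints ℝ F ∧ b ∈ Set.extremePoints ℝ F ∧
      a ≠ b := by
    by_contra hcon
    push Not at hcon
    have hkm := closure_convexHull_extremePoints hFcomp hFconv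
    have hss : (Set.extremePoints ℝ F).Subsingleton := fun a ha b hb => hcon a b ha hb
    rcases hss.eq_empty_or_singleton with h0 | ⟨v, hv⟩
    · rw [h0] at hkm
      simp at hkm
      rw [← hkm] at hyF
      exact hyF
    · rw [hv] at hkm
      simp at hkm
      rw [← hkm] at hyF
      have hyv : y = v := hyF
      apply hynot
      apply hsub
      rw [hv, hyv]
      rfl
  have haF : D w a = D w y := by have := ha.1; rw [hF] at this; exact this.2
  have hbF : D w b = D w y := by have := hb.1; rw [hF] at this; exact this.2
  obtain ⟨τ, hτ⟩ := exists_smul_of_D hw0 (show D w (b - a) = 0 by rw [D_sub]; linarith)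
  have hτ0 : τ ≠ 0 := by
    rintro rfl
    rw [zero_smul] at hτ
    exact hab (sub_eq_zero.1 hτ).symm
  have key : ∀ e ∈ EE P, ∀ σ : ℝ, 0 < σ → e.2 - e.1 = σ • w → D w e.1 = D w y → False := by
    intro e he σ hσ hσe hey
    have h1 := h e he
    rw [hσe, D_smul_left, D_sub, hey] at h1
    have h1 := nonneg_of_mul_nonneg_right h1 hσ
    have h2 := D_strict hw0 hmin ho
    obtain ⟨s, t, hs, ht, hst, hy⟩ := hyseg
    have h3 : D w y = s * D w o + t * D w x := by rw [← hy, D_add, D_smul, D_smul]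
    have h4 : t = 1 - s := by linarith
    have h5 : s * (D w o - D w y) + t * (D w x - D w y) = 0 := by rw [h4] at h3 ⊢; linarith
    have h6 : s = 0 := by
      by_contra h0
      have : 0 < s := lt_of_le_of_ne hs (Ne.symm h0)
      nlinarith [mul_pos this (show 0 < D w o - D w y by linarith), mul_nonneg ht h1]
    apply hx
    rw [h4, h6] at hy
    simp at hy
    rw [hy]
    exact hyP
  rcases lt_or_gt_of_ne hτ0 with hneg | hpos
  · refine key (b, a) (EE_of_min (τ := -τ) (w := w) (hsub hb) (hsub ha) (by linarith) ?_ hab.symm ?_)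
      (-τ) (by linarith) ?_ hbF
    · rw [neg_smul, ← hτ]; abel
    · intro z hz; rw [hbF]; exact hmin z hz
    · simp only; rw [neg_smul, ← hτ]; abel
  · exact key (a, b) (EE_of_min (hsub ha) (hsub hb) hpos hτ hab (fun z hz => by
      rw [haF]; exact hmin z hz)) τ hpos hτ haF

theorem EE_isEdge {P : Set Pt} (hconv : Convex ℝ P) {e : Pt × Pt} (he : e ∈ EE P) :
    IsEdgeOf P e.1 e.2 := by
  refine ⟨he.2.2.1, hconv.segment_subset he.1.1 he.2.1.1, ?_⟩
  rintro p hp q hq z hz ⟨s, t, hs, ht, hst, rfl⟩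
  have hz0 : D (e.2 - e.1) (s • p + t • q - e.1) = 0 := by
    obtain ⟨s', t', -, -, hst', hz⟩ := hz
    have h1 : s • p + t • q - e.1 = t' • (e.2 - e.1) := by
      rw [← hz]
      have : s' = 1 - t' := by linarith
      subst this
      ext <;> simp <;> ring
    rw [h1, D_smul, D_self, mul_zero]
  have h1 := he.2.2.2 p hp
  have h2 := he.2.2.2 q hq
  have h3 : s • p + t • q - e.1 = s • (p - e.1) + t • (q - e.1) := by
    have : s = 1 - t := by linarith
    subst this
    ext <;> simp <;> ring
  rw [h3, D_add, D_smul, D_smul] at hz0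
  have h4 : D (e.2 - e.1) (p - e.1) = 0 := by
    by_contra h0
    have := lt_of_le_of_ne h1 (Ne.symm h0)
    nlinarith [mul_pos hs this, mul_nonneg ht.le h2]
  obtain ⟨r, hr0, hr1, rfl⟩ := EE_face he hp h4
  exact ⟨1 - r, r, by linarith, hr0, by ring, by ext <;> simp <;> ring⟩

theorem isEdge_ext {P : Set Pt} {a b : Pt} (h : IsEdgeOf P a b) : a ∈ Set.extremePoints ℝ P := by
  apply h.2.extremePoints_subset_extremePoints
  refine ⟨left_mem_segment _ _ _, ?_⟩
  intro p hp q hq hz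
  have hu : b - a ≠ 0 := sub_ne_zero.2 h.1.symm
  rw [segment_eq_image'] at hp hq
  obtain ⟨r, ⟨hr, -⟩, rfl⟩ := hp
  obtain ⟨r', ⟨hr', -⟩, rfl⟩ := hq
  obtain ⟨s, t, hs, ht, hst, hz⟩ := hz
  have h1 : (s * r + t * r') • (b - a) = 0 := by
    have h2 : s • (a + r • (b - a)) + t • (a + r' • (b - a)) =
      (s + t) • a + (s * r + t * r') • (b - a) := by module
    rw [h2, hst, one_smul] at hz
    simpa using hz
  have h2 : s * r + t * r' = 0 := by
    rcases smul_eq_zero.1 h1 with h | h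
    · exact h
    · exact absurd h hu
  have h3 : r = 0 := by
    have : 0 ≤ t * r' := by positivity
    have : 0 ≤ s * r := by positivity
    have : s * r = 0 := by linarith
    rcases mul_eq_zero.1 this with h | h
    · exact absurd h hs.ne'
    · exact h
  simp [h3]

theorem isEdge_symm {P : Set Pt} {a b : Pt} (h : IsEdgeOf P a b) : IsEdgeOf P b a :=
  ⟨h.1.symm, by rw [segment_symm]; exact h.2⟩

theorem isEdge_line {P : Set Pt} {a b : Pt} (h : IsEdgeOf P a b) {z : Pt} (hz : z ∈ P)
    (h0 : D (b - a) (z - a) = 0) : z ∈ segment ℝ a b := by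
  have hu : b - a ≠ 0 := sub_ne_zero.2 h.1.symm
  obtain ⟨s, hs⟩ := exists_smul_of_D hu h0
  have hz' : z = a + s • (b - a) := by rw [← hs]; abel
  have haP : a ∈ P := h.2.subset (left_mem_segment _ _ _)
  have hbP : b ∈ P := h.2.subset (right_mem_segment _ _ _)
  rcases lt_or_ge s 0 with h1 | h1
  · refine h.2.left_mem_of_mem_openSegment hz hbP (left_mem_segment _ _ _) ?_
    have h3 : (1 - s) ≠ 0 := by linarith
    refine ⟨1 / (1 - s), -s / (1 - s), div_pos (by linarith) (by linarith),
        div_pos (by linarith) (by linarith),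
        by rw [← add_div]; exact (div_eq_one_iff_eq h3).2 (by ring), ?_⟩
    rw [hz']
    ext <;> simp <;> field_simp <;> ring
  rcases lt_or_ge 1 s with h2 | h2
  · refine h.2.left_mem_of_mem_openSegment hz haP (right_mem_segment _ _ _) ?_
    have h3 : s ≠ 0 := by linarith
    refine ⟨1 / s, (s - 1) / s, div_pos (by linarith) (by linarith),
        div_pos (by linarith) (by linarith), by field_simp; ring, ?_⟩
    rw [hz']
    ext <;> simp <;> field_simp <;> ring
  exact ⟨1 - s, s, by linarith, h1, by ring, by rw [hz']; ext <;> simp <;> ring⟩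

theorem isEdge_sign {P : Set Pt} (hconv : Convex ℝ P) {a b : Pt} (h : IsEdgeOf P a b) {x y : Pt}
    (hx : x ∈ P) (hy : y ∈ P) (h1 : D (b - a) (x - a) < 0) (h2 : 0 < D (b - a) (y - a)) :
    False := by
  obtain ⟨α, hα⟩ : ∃ α, α = D (b - a) (x - a) := ⟨_, rfl⟩
  obtain ⟨β, hβ⟩ : ∃ β, β = D (b - a) (y - a) := ⟨_, rfl⟩
  rw [← hα] at h1
  rw [← hβ] at h2
  have hne : β - α ≠ 0 := by linarith
  have hs : 0 < β / (β - α) := div_pos h2 (by linarith)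
  have ht : 0 < -α / (β - α) := div_pos (by linarith) (by linarith)
  have hst : β / (β - α) + -α / (β - α) = 1 := by
    rw [← add_div]; exact (div_eq_one_iff_eq hne).2 (by ring)
  have hz := hconv hx hy hs.le ht.le hst
  have h0 : D (b - a) ((β / (β - α)) • x + (-α / (β - α)) • y - a) = 0 := by
    have : (β / (β - α)) • x + (-α / (β - α)) • y - a =
        (β / (β - α)) • (x - a) + (-α / (β - α)) • (y - a) := by
      have h3 : a = (β / (β - α) + -α / (β - α)) • a := by rw [hst, one_smul]
      conv_lhs => rw [h3]
      module
    rw [this, D_add, D_smul, D_smul, ← hα, ← hβ]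
    field_simp
    ring
  have h3 := h.2.left_mem_of_mem_openSegment hx hy (isEdge_line h hz h0) ⟨_, _, hs, ht, hst, rfl⟩
  rw [segment_eq_image'] at h3
  obtain ⟨r, -, hr⟩ := h3
  have h5 : x - a = r • (b - a) := by rw [← hr]; simp
  rw [h5, D_smul, D_self, mul_zero] at hα
  linarith

theorem isEdge_EE {P : Set Pt} (hconv : Convex ℝ P) {a b : Pt} (h : IsEdgeOf P a b) :
    (a, b) ∈ EE P ∨ (b, a) ∈ EE P := by
  by_cases hc : ∀ x ∈ P, 0 ≤ D (b - a) (x - a)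
  · exact Or.inl ⟨isEdge_ext h, isEdge_ext (isEdge_symm h), h.1, hc⟩
  · right
    push Not at hc
    obtain ⟨x, hx, hx'⟩ := hc
    refine ⟨isEdge_ext (isEdge_symm h), isEdge_ext h, h.1.symm, fun y hy => ?_⟩
    by_contra hy'
    push Not at hy'
    refine isEdge_sign hconv h hx hy hx' ?_
    have : D (b - a) (y - a) = - D (a - b) (y - b) := by simp [D]; ring
    simp only at hy'
    linarith

theorem isEdge_translate {P : Set Pt} {a b c : Pt} :
    IsEdgeOf ((fun p : Pt => p - c) '' P) a b ↔ IsEdgeOf P (a + c) (b + c) := by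
  have hm : ∀ x, x ∈ (fun p : Pt => p - c) '' P ↔ x + c ∈ P := by
    intro x
    constructor
    · rintro ⟨y, hy, rfl⟩; simpa using hy
    · intro h; exact ⟨_, h, by simp⟩
  have hs : ∀ x p q, x + c ∈ segment ℝ (p + c) (q + c) ↔ x ∈ segment ℝ p q := by
    intro x p q
    rw [add_comm x, add_comm p, add_comm q]
    exact mem_segment_translate ℝ c
  have ho : ∀ x p q, x + c ∈ openSegment ℝ (p + c) (q + c) ↔ x ∈ openSegment ℝ p q := by
    intro x p q
    rw [add_comm x, add_comm p, add_comm q]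
    exact mem_openSegment_translate ℝ c
  unfold IsEdgeOf
  rw [isExtreme_iff, isExtreme_iff]
  refine and_congr (by simp) (and_congr ⟨fun h x hx => ?_, fun h x hx => ?_⟩
    ⟨fun h x hx y hy z hz hzo => ?_, fun h x hx y hy z hz hzo => ?_⟩)
  · have := (hm (x - c)).1 (h ((hs _ _ _).1 (by simpa using hx)))
    simpa using this
  · exact (hm x).2 (h ((hs _ _ _).2 hx))
  · have := (hs (x - c) _ _).2 (h (x := x - c) ((hm _).2 (by simpa using hx))
      (y := y - c) ((hm _).2 (by simpa using hy)) (z := z - c) ((hs _ _ _).1 (by simpa using hz))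
      ((ho _ _ _).1 (by simpa using hzo)))
    simpa using this
  · exact (hs _ _ _).1 (h ((hm x).1 hx) ((hm y).1 hy) ((hs _ _ _).2 hz) ((ho _ _ _).2 hzo))

def InW (P : Set Pt) (w q : Pt) : Prop :=
  ∀ e ∈ EE P, 0 < D (e.2 - e.1) (q - e.1) ∨ (D (e.2 - e.1) (q - e.1) = 0 ∧ 0 < D (e.2 - e.1) w)

def InLex (P : Set Pt) (u v q : Pt) : Prop :=
  ∀ e ∈ EE P, 0 < D (e.2 - e.1) (q - e.1) ∨ (D (e.2 - e.1) (q - e.1) = 0 ∧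
    (0 < D (e.2 - e.1) u ∨ (D (e.2 - e.1) u = 0 ∧ 0 < D (e.2 - e.1) v)))

def Gen (P : Set Pt) (w : Pt) : Prop := ∀ e ∈ EE P, D (e.2 - e.1) w ≠ 0

theorem EE_ne {P : Set Pt} {e : Pt × Pt} (he : e ∈ EE P) : e.2 - e.1 ≠ 0 :=
  sub_ne_zero.2 he.2.2.1.symm

theorem InW.mem {P : Set Pt} {n : ℕ} (hP : IsConvexPolygon P n) {w q : Pt} (h : InW P w q) :
    q ∈ P := by
  rw [mem_P_iff hP]
  intro e he
  rcases h e he with h | h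
  · exact h.le
  · exact h.1.ge

theorem InLex.mem {P : Set Pt} {n : ℕ} (hP : IsConvexPolygon P n) {u v q : Pt}
    (h : InLex P u v q) : q ∈ P := by
  rw [mem_P_iff hP]
  intro e he
  rcases h e he with h | h
  · exact h.le
  · exact h.1.ge

theorem interior_pos {P : Set Pt} {q : Pt} (hq : q ∈ interior P) :
    ∀ e ∈ EE P, 0 < D (e.2 - e.1) (q - e.1) := by
  intro e he
  have := D_strict (c := D (e.2 - e.1) e.1) (EE_ne he) (fun x hx => by
    have := he.2.2.2 x hx
    rw [D_sub] at this; linarith) hq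
  rw [D_sub]; linarith

theorem pos_interior {P : Set Pt} {n : ℕ} (hP : IsConvexPolygon P n) {q : Pt}
    (h : ∀ e ∈ EE P, 0 < D (e.2 - e.1) (q - e.1)) : q ∈ interior P := by
  rw [mem_interior_iff_mem_nhds]
  have : ∀ᶠ x in 𝓝 q, ∀ e ∈ EE P, 0 < D (e.2 - e.1) (x - e.1) := by
    rw [Filter.eventually_all_finite (EE_finite hP)]
    intro e he
    have hc : Continuous (fun x => D (e.2 - e.1) (x - e.1)) :=
      (D_cont _).comp (continuous_id.sub continuous_const)
    exact (hc.tendsto q).eventually (lt_mem_nhds (h e he))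
  filter_upwards [this] with x hx
  rw [mem_P_iff hP]
  exact fun e he => (hx e he).le

theorem InW_of_interior {P : Set Pt} {w q : Pt} (hq : q ∈ interior P) : InW P w q :=
  fun e he => Or.inl (interior_pos hq e he)

theorem InW_ev {P : Set Pt} {n : ℕ} (hP : IsConvexPolygon P n) {d : Pt} (hd : Gen P d) (q : Pt) :
    ∀ᶠ ε in 𝓝[>] (0 : ℝ), (q + ε • d ∈ P ↔ InW P d q) ∧ (q + ε • d ∈ interior P ↔ InW P d q) ∧
      ∀ w, InW P w (q + ε • d) ↔ InW P d q := by
  have h1 : ∀ᶠ ε in 𝓝[>] (0 : ℝ), ∀ e ∈ EE P, D (e.2 - e.1) (q + ε • d - e.1) ≠ 0 ∧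
      (0 < D (e.2 - e.1) (q + ε • d - e.1) ↔ 0 < D (e.2 - e.1) (q - e.1) ∨
        (D (e.2 - e.1) (q - e.1) = 0 ∧ 0 < D (e.2 - e.1) d)) := by
    rw [Filter.eventually_all_finite (EE_finite hP)]
    intro e he
    filter_upwards [sign_ev (D (e.2 - e.1) (q - e.1)) _ (Or.inr (hd e he))] with ε hε
    have : D (e.2 - e.1) (q + ε • d - e.1) = D (e.2 - e.1) (q - e.1) + ε * D (e.2 - e.1) d := by
      rw [← D_smul, ← D_add]; congr 1; abel
    rwa [this]
  filter_upwards [h1] with ε hε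
  have key : InW P d q → q + ε • d ∈ interior P := fun h =>
    pos_interior hP fun e he => (hε e he).2.2 (h e he)
  have key2 : q + ε • d ∈ P → InW P d q := fun h e he =>
    (hε e he).2.1 (lt_of_le_of_ne ((mem_P_iff hP _).1 h e he) (hε e he).1.symm)
  exact ⟨⟨key2, fun h => interior_subset (key h)⟩, ⟨fun h => key2 (interior_subset h), key⟩,
    fun w => ⟨fun h => key2 (h.mem hP), fun h => InW_of_interior (key h)⟩⟩

theorem lex_ev {P : Set Pt} {n : ℕ} (hP : IsConvexPolygon P n) {u v : Pt} (huv : D u v ≠ 0) :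
    ∀ᶠ δ in 𝓝[>] (0 : ℝ), Gen P (u + δ • v) ∧ ∀ q, InW P (u + δ • v) q ↔ InLex P u v q := by
  have h1 : ∀ᶠ δ in 𝓝[>] (0 : ℝ), ∀ e ∈ EE P, D (e.2 - e.1) (u + δ • v) ≠ 0 ∧
      (0 < D (e.2 - e.1) (u + δ • v) ↔ 0 < D (e.2 - e.1) u ∨
        (D (e.2 - e.1) u = 0 ∧ 0 < D (e.2 - e.1) v)) := by
    rw [Filter.eventually_all_finite (EE_finite hP)]
    intro e he
    have : D (e.2 - e.1) u ≠ 0 ∨ D (e.2 - e.1) v ≠ 0 := by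
      by_contra h
      push Not at h
      exact EE_ne he (D_basis huv h.1 h.2)
    filter_upwards [sign_ev _ _ this] with δ hδ
    rwa [D_add, D_smul]
  filter_upwards [h1] with δ hδ
  refine ⟨fun e he => (hδ e he).1, fun q => forall₂_congr fun e he => ?_⟩
  rw [(hδ e he).2]

/-! ### lattice facts -/

theorem lat_zero {L : Set Pt} (hL : IsLattice L) : (0 : Pt) ∈ L := by
  obtain ⟨B, rfl⟩ := hL
  exact ⟨0, ⟨0, 0, by simp; rfl⟩, by simp⟩

theorem lat_sub {L : Set Pt} (hL : IsLattice L) {x y : Pt} (hx : x ∈ L) (hy : y ∈ L) :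
    x - y ∈ L := by
  obtain ⟨B, rfl⟩ := hL
  obtain ⟨_, ⟨a, b, rfl⟩, rfl⟩ := hx
  obtain ⟨_, ⟨c, d, rfl⟩, rfl⟩ := hy
  exact ⟨((a : ℝ), (b : ℝ)) - ((c : ℝ), (d : ℝ)), ⟨a - c, b - d, by simp⟩, by rw [map_sub]⟩

theorem lat_neg {L : Set Pt} (hL : IsLattice L) {x : Pt} (hx : x ∈ L) : -x ∈ L := by
  simpa using lat_sub hL (lat_zero hL) hx

theorem lat_add {L : Set Pt} (hL : IsLattice L) {x y : Pt} (hx : x ∈ L) (hy : y ∈ L) :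
    x + y ∈ L := by
  simpa using lat_sub hL hx (lat_neg hL hy)

theorem lat_zsmul {L : Set Pt} (hL : IsLattice L) {x : Pt} (hx : x ∈ L) (m : ℤ) :
    (m : ℝ) • x ∈ L := by
  obtain ⟨B, rfl⟩ := hL
  obtain ⟨_, ⟨a, b, rfl⟩, rfl⟩ := hx
  exact ⟨(m : ℝ) • ((a : ℝ), (b : ℝ)), ⟨m * a, m * b, by simp⟩, by rw [map_smul]⟩

theorem lat_finite {L : Set Pt} (hL : IsLattice L) {S : Set Pt} (hS : Bornology.IsBounded S) :
    {l | l ∈ L ∧ l ∈ S}.Finite := by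
  obtain ⟨B, rfl⟩ := hL
  have hlip := B.symm.toContinuousLinearEquiv.lipschitz
  have hb : Bornology.IsBounded (B.symm '' S) := hlip.isBounded_image hS
  obtain ⟨R, hR⟩ := hb.subset_closedBall 0
  have hfin : ((Set.Icc (-⌈R⌉) ⌈R⌉ ×ˢ Set.Icc (-⌈R⌉) ⌈R⌉ : Set (ℤ × ℤ))).Finite :=
    (Set.finite_Icc _ _).prod (Set.finite_Icc _ _)
  refine (hfin.image (fun z : ℤ × ℤ => B ((z.1 : ℝ), (z.2 : ℝ)))).subset ?_
  rintro _ ⟨⟨_, ⟨a, b, rfl⟩, rfl⟩, hS'⟩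
  refine ⟨(a, b), ?_, rfl⟩
  have h1 := hR ⟨_, hS', rfl⟩
  rw [LinearEquiv.symm_apply_apply, mem_closedBall_zero_iff, Prod.norm_def, sup_le_iff] at h1
  simp only [Real.norm_eq_abs, abs_le] at h1
  have h2 := Int.le_ceil R
  simp only [Set.mem_prod, Set.mem_Icc]
  refine ⟨⟨?_, ?_⟩, ?_, ?_⟩ <;> · rify; linarith

theorem bdd_finite {P L : Set Pt} {n : ℕ} (hP : IsConvexPolygon P n) (hL : IsLattice L) (p : Pt) :
    {l | l ∈ L ∧ ∃ q ∈ P, ‖p - l - q‖ ≤ 1}.Finite := by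
  obtain ⟨R, hR⟩ := hP.2.1.isBounded.subset_closedBall 0
  refine (lat_finite hL (Metric.isBounded_closedBall (x := (0 : Pt)) (r := ‖p‖ + R + 1))).subset ?_
  rintro l ⟨hl, q, hq, h⟩
  refine ⟨hl, ?_⟩
  have h1 := hR hq
  rw [mem_closedBall_zero_iff] at h1 ⊢
  have : l = p - q - (p - l - q) := by abel
  rw [this]
  calc _ ≤ ‖p - q‖ + ‖p - l - q‖ := norm_sub_le _ _
    _ ≤ ‖p‖ + ‖q‖ + ‖p - l - q‖ := by gcongr; exact norm_sub_le _ _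
    _ ≤ _ := by linarith

theorem mem_finite {P L : Set Pt} {n : ℕ} (hP : IsConvexPolygon P n) (hL : IsLattice L) (p : Pt) :
    {l | l ∈ L ∧ p - l ∈ P}.Finite :=
  (bdd_finite hP hL p).subset fun l hl => ⟨hl.1, _, hl.2, by simp⟩

theorem ev_set {P L : Set Pt} {n : ℕ} (hP : IsConvexPolygon P n) (hL : IsLattice L) (p d : Pt)
    (A : ℝ → Pt → Prop) (B : Pt → Prop) (hA : ∀ ε q, A ε q → q + ε • d ∈ P)
    (hB : ∀ q, B q → q ∈ P) (h : ∀ q, ∀ᶠ ε in 𝓝[>] (0 : ℝ), A ε q ↔ B q) :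
    ∀ᶠ ε in 𝓝[>] (0 : ℝ), {l | l ∈ L ∧ A ε (p - l)} = {l | l ∈ L ∧ B (p - l)} := by
  have hK := bdd_finite hP hL p
  have h1 : ∀ᶠ ε in 𝓝[>] (0 : ℝ), ∀ l ∈ {l | l ∈ L ∧ ∃ q ∈ P, ‖p - l - q‖ ≤ 1},
      (A ε (p - l) ↔ B (p - l)) := by
    rw [Filter.eventually_all_finite hK]
    exact fun l _ => h _
  have h2 : ∀ᶠ ε in 𝓝[>] (0 : ℝ), ‖ε • d‖ ≤ 1 := by
    have hc : Continuous (fun ε : ℝ => ‖ε • d‖) := by fun_prop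
    have : ∀ᶠ ε in 𝓝 (0 : ℝ), ‖ε • d‖ < 1 := (hc.tendsto 0).eventually (gt_mem_nhds (by simp))
    exact (this.filter_mono nhdsWithin_le_nhds).mono fun _ h => h.le
  filter_upwards [h1, h2] with ε h1 h2
  ext l
  refine and_congr_right fun hl => ?_
  constructor
  · intro ha
    refine (h1 l ⟨hl, _, hA _ _ ha, ?_⟩).1 ha
    rw [show p - l - (p - l + ε • d) = -(ε • d) by abel, norm_neg]; exact h2
  · intro hb
    exact (h1 l ⟨hl, _, hB _ hb, by simp⟩).2 hb

def CC (P L : Set Pt) (w p : Pt) : ℕ := {l | l ∈ L ∧ InW P w (p - l)}.ncard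

theorem tiling_CC {P L : Set Pt} {n k : ℕ} (hP : IsConvexPolygon P n) (hL : IsLattice L)
    (hT : IsKFoldLatticeTiling P L k) {w : Pt} (hw : Gen P w) (p : Pt) : CC P L w p = k := by
  have h1 := ev_set hP hL p w (fun ε q => q + ε • w ∈ P) (InW P w) (fun _ _ h => h)
    (fun _ h => h.mem hP) (fun q => (InW_ev hP hw q).mono fun ε h => h.1)
  have h2 := ev_set hP hL p w (fun ε q => q + ε • w ∈ interior P) (InW P w)
    (fun _ _ h => interior_subset h)
    (fun _ h => h.mem hP) (fun q => (InW_ev hP hw q).mono fun ε h => h.2.1)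
  obtain ⟨ε, -, h1, h2⟩ := ev_exists (h1.and h2)
  have h3 := hT.2.1 (p + ε • w)
  have h4 := hT.2.2 (p + ε • w)
  have e : ∀ l, p + ε • w - l = p - l + ε • w := fun l => by abel
  simp only [e] at h3 h4
  rw [h1] at h3
  rw [h2] at h4
  have h5 := le_antisymm h4 h3
  rw [CC, Set.ncard, h5]
  simp

theorem tiling_of_CC {P L : Set Pt} {n k : ℕ} (hP : IsConvexPolygon P n) (hL : IsLattice L)
    {w : Pt} (h : ∀ p, CC P L w p = k) : IsKFoldLatticeTiling P L k := by
  have hf : ∀ p, {l | l ∈ L ∧ InW P w (p - l)}.Finite := fun p =>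
    (mem_finite hP hL p).subset fun l hl => ⟨hl.1, hl.2.mem hP⟩
  have he : ∀ p, {l | l ∈ L ∧ InW P w (p - l)}.encard = k := fun p => by
    rw [← h p, CC, (hf p).cast_ncard_eq]
  refine ⟨hL, fun p => ?_, fun p => ?_⟩
  · rw [← he p]
    exact Set.encard_le_encard fun l hl => ⟨hl.1, hl.2.mem hP⟩
  · rw [← he p]
    exact Set.encard_le_encard fun l hl => ⟨hl.1, InW_of_interior hl.2⟩

def NN (L : Set Pt) (p0 : Pt) (r : ℝ) (u p : Pt) : ℕ :=
  {l | l ∈ L ∧ ∃ s : ℝ, 0 ≤ s ∧ s < r ∧ p - l = p0 + s • u}.ncard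

/-- `e` has end points `p0` and `p0 + r u` -/
def Ends (e : Pt × Pt) (p0 : Pt) (r : ℝ) (u : Pt) : Prop :=
  0 < r ∧ ((e.1 = p0 ∧ e.2 = p0 + r • u) ∨ (e.2 = p0 ∧ e.1 = p0 + r • u))

theorem exists_Ends {P : Set Pt} {e : Pt × Pt} (he : e ∈ EE P) {u : Pt} (hu : u ≠ 0)
    (h : D (e.2 - e.1) u = 0) : ∃ p0 r, Ends e p0 r u := by
  obtain ⟨s, hs⟩ := exists_smul_of_D hu (by rw [D_comm, h, neg_zero] : D u (e.2 - e.1) = 0)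
  have hs0 : s ≠ 0 := by
    rintro rfl
    rw [zero_smul] at hs
    exact EE_ne he hs
  rcases lt_or_gt_of_ne hs0 with h | h
  · exact ⟨e.2, -s, by linarith, Or.inr ⟨rfl, by rw [neg_smul, ← hs]; abel⟩⟩
  · exact ⟨e.1, s, h, Or.inl ⟨rfl, by rw [← hs]; abel⟩⟩

theorem Ends_face {P : Set Pt} {e : Pt × Pt} (he : e ∈ EE P) {p0 u : Pt} {r : ℝ}
    (h : Ends e p0 r u) {q : Pt} (hq : q ∈ P) (h0 : D (e.2 - e.1) (q - e.1) = 0) :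
    ∃ s : ℝ, 0 ≤ s ∧ s ≤ r ∧ q = p0 + s • u := by
  obtain ⟨s, h1, h2, rfl⟩ := EE_face he hq h0
  obtain ⟨hr, ⟨h3, h4⟩ | ⟨h3, h4⟩⟩ := h
  · refine ⟨s * r, by positivity, by nlinarith, ?_⟩
    rw [h4, h3]; module
  · refine ⟨r - s * r, by nlinarith, by nlinarith, ?_⟩
    rw [h4, h3]; module

theorem Ends_mem {P : Set Pt} {e : Pt × Pt} (he : e ∈ EE P) {p0 u : Pt} {r : ℝ}
    (h : Ends e p0 r u) : p0 ∈ P ∧ p0 + r • u ∈ P := by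
  obtain ⟨hr, ⟨h3, h4⟩ | ⟨h3, h4⟩⟩ := h
  · exact ⟨h3 ▸ he.1.1, h4 ▸ he.2.1.1⟩
  · exact ⟨h3 ▸ he.2.1.1, h4 ▸ he.1.1⟩

theorem Ends_line {e : Pt × Pt} {p0 u : Pt} {r : ℝ}
    (h : Ends e p0 r u) (h0 : D (e.2 - e.1) u = 0) (s : ℝ) :
    D (e.2 - e.1) (p0 + s • u - e.1) = 0 := by
  obtain ⟨hr, ⟨h3, h4⟩ | ⟨h3, h4⟩⟩ := h
  · rw [show p0 + s • u - e.1 = s • u by rw [h3]; abel, D_smul, h0, mul_zero]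
  · rw [show p0 + s • u - e.1 = (s - r) • u by rw [h4]; module, D_smul, h0, mul_zero]

theorem EE_uniq2 {P : Set Pt} {e e' : Pt × Pt} (he : e ∈ EE P) (he' : e' ∈ EE P) {u v : Pt}
    (hu : u ≠ 0) (h1 : D (e.2 - e.1) u = 0) (h2 : D (e'.2 - e'.1) u = 0)
    (h3 : 0 < D (e.2 - e.1) v) (h4 : 0 < D (e'.2 - e'.1) v) : e = e' := by
  obtain ⟨s, hs⟩ := exists_smul_of_D (EE_ne he) (D_zero_trans hu h1 h2)
  refine EE_uniq he he' ?_ hs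
  rw [hs, D_smul_left] at h4
  exact pos_of_mul_pos_left h4 h3.le

theorem jump1 {P : Set Pt} {n : ℕ} (hP : IsConvexPolygon P n) {u v : Pt} (huv : D u v ≠ 0)
    {e : Pt × Pt} (he : e ∈ EE P) (h1 : D (e.2 - e.1) u = 0) (h2 : 0 < D (e.2 - e.1) v)
    {p0 : Pt} {r : ℝ} (hE : Ends e p0 r u) (q : Pt) :
    (InLex P u v q ∧ ¬ InLex P u (-v) q) ↔ ∃ s : ℝ, 0 ≤ s ∧ s < r ∧ q = p0 + s • u := by
  have hu : u ≠ 0 := by rintro rfl; simp [D] at huv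
  constructor
  · rintro ⟨hq, hq'⟩
    have hqP := hq.mem hP
    obtain ⟨e', he', h3⟩ : ∃ e' ∈ EE P, ¬ (0 < D (e'.2 - e'.1) (q - e'.1) ∨
      (D (e'.2 - e'.1) (q - e'.1) = 0 ∧
      (0 < D (e'.2 - e'.1) u ∨ (D (e'.2 - e'.1) u = 0 ∧ 0 < D (e'.2 - e'.1) (-v))))) := by
      unfold InLex at hq'
      push Not at hq' ⊢
      exact hq'
    have h4 := hq e' he'
    have h5 : D (e'.2 - e'.1) (q - e'.1) = 0 ∧ D (e'.2 - e'.1) u = 0 ∧ 0 < D (e'.2 - e'.1) v := by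
      tauto
    obtain rfl := EE_uniq2 he he' hu h1 h5.2.1 h2 h5.2.2
    obtain ⟨s, hs0, hs1, rfl⟩ := Ends_face he hE hqP h5.1
    refine ⟨s, hs0, lt_of_le_of_ne hs1 ?_, rfl⟩
    rintro rfl
    have hmove : ∀ᶠ ε in 𝓝[>] (0 : ℝ), ∀ e' ∈ EE P, 0 ≤ D (e'.2 - e'.1) (p0 + s • u - e'.1) +
        ε * D (e'.2 - e'.1) u := by
      rw [Filter.eventually_all_finite (EE_finite hP)]
      intro e' he'
      by_cases hz : D (e'.2 - e'.1) u = 0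
      · filter_upwards with ε
        rw [hz, mul_zero, add_zero]
        exact (mem_P_iff hP _).1 hqP e' he'
      · filter_upwards [sign_ev (D (e'.2 - e'.1) (p0 + s • u - e'.1)) _ (Or.inr hz)] with ε hε
        refine (hε.2.2 ?_).le
        have := hq e' he'
        tauto
    obtain ⟨ε, hε, hm⟩ := ev_exists hmove
    have hmem : p0 + (s + ε) • u ∈ P := by
      rw [mem_P_iff hP]
      intro e' he'
      have := hm e' he'
      rwa [← D_smul, ← D_add, show p0 + s • u - e'.1 + ε • u = p0 + (s + ε) • u - e'.1 by module]
        at this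
    obtain ⟨s', -, hs', h6⟩ := Ends_face he hE hmem (Ends_line hE h1 _)
    have h7 : (s + ε - s') • u = 0 := by
      have : (s + ε) • u = s' • u := add_left_cancel h6
      rw [sub_smul, this, sub_self]
    rcases smul_eq_zero.1 h7 with h | h
    · linarith
    · exact hu h
  · rintro ⟨s, hs0, hs1, rfl⟩
    obtain ⟨hp0, hp1⟩ := Ends_mem he hE
    have hr := hE.1
    have hqP : p0 + s • u ∈ P := by
      have h01 : 0 ≤ 1 - s / r := by rw [sub_nonneg, div_le_one hr]; exact hs1.le
      have h02 : 0 ≤ s / r := by positivity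
      have := hP.1 hp0 hp1 h01 h02 (by ring)
      convert this using 1
      rw [show (1 - s / r) • p0 + (s / r) • (p0 + r • u) = p0 + (s / r * r) • u by module,
        div_mul_cancel₀ _ hr.ne']
    constructor
    · intro e' he'
      rcases ((mem_P_iff hP _).1 hqP e' he').lt_or_eq with h | h
      · exact Or.inl h
      right
      refine ⟨h.symm, ?_⟩
      have h3 := (mem_P_iff hP _).1 hp1 e' he'
      rw [show p0 + r • u - e'.1 = (p0 + s • u - e'.1) + (r - s) • u by module, D_add, ← h,
        D_smul, zero_add] at h3
      have h4 : 0 ≤ D (e'.2 - e'.1) u := nonneg_of_mul_nonneg_right h3 (by linarith)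
      rcases h4.lt_or_eq with h5 | h5
      · exact Or.inl h5
      right
      refine ⟨h5.symm, ?_⟩
      obtain ⟨o, ho⟩ := hP.2.2.1
      have h6 := interior_pos ho e he
      have h7 := interior_pos ho e' he'
      obtain ⟨σ, hσ⟩ := exists_smul_of_D (EE_ne he) (D_zero_trans hu h1 h5.symm)
      have h8 := Ends_line hE h1 s
      have h9 : D (e.2 - e.1) (o - e.1) = D (e.2 - e.1) (o - (p0 + s • u)) := by
        rw [D_sub] at h8 ⊢; rw [D_sub _ o]; linarith
      have h10 : D (e'.2 - e'.1) (o - e'.1) = D (e'.2 - e'.1) (o - (p0 + s • u)) := by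
        rw [D_sub] at h ⊢; rw [D_sub _ o]; linarith
      rw [h9] at h6
      rw [h10, hσ, D_smul_left] at h7
      have hσ' := pos_of_mul_pos_left h7 h6.le
      rw [hσ, D_smul_left]
      positivity
    · intro hc
      have h3 := hc e he
      rw [Ends_line hE h1, h1, D_neg] at h3
      rcases h3 with h | ⟨-, h | ⟨-, h⟩⟩ <;> linarith

theorem jump2 {P : Set Pt} {u v : Pt}
    (h : ∀ e ∈ EE P, D (e.2 - e.1) u = 0 → ¬ 0 < D (e.2 - e.1) v) {q : Pt}
    (hq : InLex P u v q) : InLex P u (-v) q := by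
  intro e he
  have h1 := h e he
  have h2 := hq e he
  tauto

theorem ncard_diff_iff {α : Type*} {A B : Set α} (hA : A.Finite) (hB : B.Finite) :
    A.ncard = B.ncard ↔ (A \ B).ncard = (B \ A).ncard := by
  have h1 := Set.ncard_inter_add_ncard_sdiff_eq_ncard A B hA
  have h2 := Set.ncard_inter_add_ncard_sdiff_eq_ncard B A hB
  rw [Set.inter_comm] at h2
  omega

def CL (P L : Set Pt) (u v p : Pt) : ℕ := {l | l ∈ L ∧ InLex P u v (p - l)}.ncard

theorem CL_finite {P L : Set Pt} {n : ℕ} (hP : IsConvexPolygon P n) (hL : IsLattice L)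
    (u v p : Pt) : {l | l ∈ L ∧ InLex P u v (p - l)}.Finite :=
  (mem_finite hP hL p).subset fun _ hl => ⟨hl.1, hl.2.mem hP⟩

theorem CL_iff {P L : Set Pt} {n : ℕ} (hP : IsConvexPolygon P n) (hL : IsLattice L)
    {u v : Pt} (huv : D u v ≠ 0) {e e' : Pt × Pt} (he : e ∈ EE P) (he' : e' ∈ EE P)
    (h1 : D (e.2 - e.1) u = 0) (h2 : 0 < D (e.2 - e.1) v)
    (h1' : D (e'.2 - e'.1) u = 0) (h2' : D (e'.2 - e'.1) v < 0)
    {p0 p0' : Pt} {r r' : ℝ} (hE : Ends e p0 r u) (hE' : Ends e' p0' r' u) (p : Pt) :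
    CL P L u v p = CL P L u (-v) p ↔ NN L p0 r u p = NN L p0' r' u p := by
  unfold CL NN
  rw [ncard_diff_iff (CL_finite hP hL _ _ _) (CL_finite hP hL _ _ _)]
  have e1 : {l | l ∈ L ∧ InLex P u v (p - l)} \ {l | l ∈ L ∧ InLex P u (-v) (p - l)} =
      {l | l ∈ L ∧ ∃ s : ℝ, 0 ≤ s ∧ s < r ∧ p - l = p0 + s • u} := by
    ext l
    have := jump1 hP huv he h1 h2 hE (p - l)
    simp only [Set.mem_sdiff, Set.mem_ofPred_eq]
    rw [← this]
    tauto
  have e2 : {l | l ∈ L ∧ InLex P u (-v) (p - l)} \ {l | l ∈ L ∧ InLex P u v (p - l)} =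
      {l | l ∈ L ∧ ∃ s : ℝ, 0 ≤ s ∧ s < r' ∧ p - l = p0' + s • u} := by
    ext l
    have := jump1 hP (v := -v) (by rw [D_neg]; exact neg_ne_zero.2 huv) he' h1'
      (by rw [D_neg]; linarith) hE' (p - l)
    rw [neg_neg] at this
    simp only [Set.mem_sdiff, Set.mem_ofPred_eq]
    rw [← this]
    tauto
  rw [e1, e2]

/-- In a tiling every lexicographic count is `k`. -/
theorem tiling_CL {P L : Set Pt} {n k : ℕ} (hP : IsConvexPolygon P n) (hL : IsLattice L)
    (hT : IsKFoldLatticeTiling P L k) {u v : Pt} (huv : D u v ≠ 0) (p : Pt) :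
    CL P L u v p = k := by
  obtain ⟨δ, -, h1, h2⟩ := ev_exists (lex_ev hP huv)
  rw [← tiling_CC hP hL hT h1 p]
  unfold CL CC
  simp only [h2]

/-- Existence of the opposite edge in a tiling. -/
theorem tiling_opp {P L : Set Pt} {n k : ℕ} (hP : IsConvexPolygon P n) (hL : IsLattice L)
    (hT : IsKFoldLatticeTiling P L k) {u v : Pt} (huv : D u v ≠ 0) {e : Pt × Pt} (he : e ∈ EE P)
    (h1 : D (e.2 - e.1) u = 0) (h2 : 0 < D (e.2 - e.1) v) :
    ∃ e' ∈ EE P, D (e'.2 - e'.1) u = 0 ∧ D (e'.2 - e'.1) v < 0 := by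
  have hu : u ≠ 0 := by rintro rfl; simp [D] at huv
  by_contra hcon
  push Not at hcon
  obtain ⟨p0, r, hE⟩ := exists_Ends he hu h1
  have huv' : D u (-v) ≠ 0 := by rw [D_neg]; exact neg_ne_zero.2 huv
  have h3 := (tiling_CL hP hL hT huv p0).trans (tiling_CL hP hL hT huv' p0).symm
  have h4 := fun q => jump2 (P := P) (u := u) (v := -v) (q := q) (fun e he h5 h6 => by
    rw [D_neg] at h6
    linarith [hcon e he h5])
  have hsub : {l | l ∈ L ∧ InLex P u (-v) (p0 - l)} ⊆ {l | l ∈ L ∧ InLex P u v (p0 - l)} :=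
    fun l hl => ⟨hl.1, by have := h4 _ hl.2; rwa [neg_neg] at this⟩
  have heq := Set.eq_of_subset_of_ncard_le hsub h3.le (CL_finite hP hL _ _ _)
  have h5 := (jump1 hP huv he h1 h2 hE p0).2 ⟨0, le_rfl, hE.1, by simp⟩
  apply h5.2
  have h6 : (0 : Pt) ∈ {l | l ∈ L ∧ InLex P u v (p0 - l)} := ⟨lat_zero hL, by simpa using h5.1⟩
  rw [← heq] at h6
  simpa using h6.2

def XX (L : Set Pt) (u : Pt) (r σ : ℝ) : ℕ :=
  {τ : ℝ | τ • u ∈ L ∧ 0 ≤ σ - τ ∧ σ - τ < r}.ncard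

theorem NN_eq {L : Set Pt} (hL : IsLattice L) {u : Pt} (hu : u ≠ 0) {p0 l1 p : Pt} {r σ : ℝ}
    (hl1 : l1 ∈ L) (hp : p = p0 + l1 + σ • u) : NN L p0 r u p = XX L u r σ := by
  unfold NN XX
  have hinj : Function.Injective (fun τ : ℝ => l1 + τ • u) := by
    intro τ τ' h
    exact smul_left_injective ℝ hu (add_left_cancel h)
  rw [← Set.ncard_image_of_injective _ hinj]
  congr 1
  ext l
  constructor
  · rintro ⟨hl, s, h0, h1, h2⟩
    have h3 : l = l1 + (σ - s) • u := by
      have : l = p - (p0 + s • u) := by rw [← h2]; abel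
      rw [this, hp]; module
    refine ⟨σ - s, ⟨?_, by linarith, by linarith⟩, h3.symm⟩
    have : (σ - s) • u = l - l1 := by rw [h3]; abel
    rw [this]
    exact lat_sub hL hl hl1
  · rintro ⟨τ, ⟨h0, h1, h2⟩, rfl⟩
    exact ⟨lat_add hL hl1 h0, σ - τ, h1, h2, by rw [hp]; module⟩

theorem XX_finite {L : Set Pt} (hL : IsLattice L) {u : Pt} (hu : u ≠ 0) (r σ : ℝ) :
    {τ : ℝ | τ • u ∈ L ∧ 0 ≤ σ - τ ∧ σ - τ < r}.Finite := by
  have hinj : Function.Injective (fun τ : ℝ => τ • u) := smul_left_injective ℝ hu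
  refine Set.Finite.of_finite_image (f := fun τ : ℝ => τ • u) ?_ hinj.injOn
  have hb : Bornology.IsBounded ((fun τ : ℝ => τ • u) '' Set.Icc (σ - r) σ) :=
    (isCompact_Icc.image (by fun_prop)).isBounded
  refine (lat_finite hL hb).subset ?_
  rintro _ ⟨τ, ⟨h0, h1, h2⟩, rfl⟩
  exact ⟨h0, τ, ⟨by linarith, by linarith⟩, rfl⟩

theorem XX_inv {L : Set Pt} (hL : IsLattice L) {u : Pt} (hu : u ≠ 0) {r : ℝ} (hr : 0 < r)
    (hrL : r • u ∈ L) (σ σ' : ℝ) : XX L u r σ ≤ XX L u r σ' := by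
  unfold XX
  refine Set.ncard_le_ncard_of_injOn (fun τ => τ + r * ⌊(σ' - τ) / r⌋) ?_ ?_ (XX_finite hL hu _ _)
  · rintro τ ⟨h0, h1, h2⟩
    have h3 := Int.floor_le ((σ' - τ) / r)
    have h4 := Int.lt_floor_add_one ((σ' - τ) / r)
    rw [le_div_iff₀ hr] at h3
    rw [div_lt_iff₀ hr] at h4
    refine ⟨?_, by nlinarith, by nlinarith⟩
    rw [add_smul, mul_comm, mul_smul]
    exact lat_add hL h0 (lat_zsmul hL hrL _)
  · rintro τ ⟨h0, h1, h2⟩ τ' ⟨h0', h1', h2'⟩ h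
    simp only at h
    have h3 : τ - τ' = r * ((⌊(σ' - τ') / r⌋ - ⌊(σ' - τ) / r⌋ : ℤ) : ℝ) := by
      push_cast; linarith
    generalize (⌊(σ' - τ') / r⌋ - ⌊(σ' - τ) / r⌋ : ℤ) = m at h3
    have h4 : m < 1 := by
      by_contra hc
      push Not at hc
      have : (1 : ℝ) ≤ m := by exact_mod_cast hc
      nlinarith
    have h5 : -1 < m := by
      by_contra hc
      push Not at hc
      have : (m : ℝ) ≤ -1 := by exact_mod_cast hc
      nlinarith
    have h6 : m = 0 := by omega
    rw [h6] at h3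
    simp at h3
    linarith

theorem XX_strict {L : Set Pt} (hL : IsLattice L) {u : Pt} (hu : u ≠ 0) {r r' : ℝ}
    (hrr : r < r') (hrL : (r' - r) • u ∈ L) (hr0 : 0 < r) : XX L u r 0 < XX L u r' 0 := by
  unfold XX
  refine Set.ncard_lt_ncard ?_ (XX_finite hL hu _ _)
  refine ⟨fun τ ⟨h0, h1, h2⟩ => ⟨h0, h1, by linarith⟩, fun hsub => ?_⟩
  have hρ : 0 < r' - r := by linarith
  have h1 := Int.le_ceil (r / (r' - r))
  have h2 := Int.ceil_lt_add_one (r / (r' - r))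
  have h5 : r / (r' - r) * (r' - r) = r := div_mul_cancel₀ _ hρ.ne'
  have h3 : r ≤ ⌈r / (r' - r)⌉ * (r' - r) := by
    nlinarith [mul_le_mul_of_nonneg_right h1 hρ.le]
  have h4 : ⌈r / (r' - r)⌉ * (r' - r) < r' := by
    nlinarith [mul_lt_mul_of_pos_right h2 hρ]
  have := hsub (a := -(⌈r / (r' - r)⌉ * (r' - r))) ⟨?_, by linarith, by linarith⟩
  · linarith [this.2.2]
  · rw [neg_smul, mul_smul]
    exact lat_neg hL (lat_zsmul hL hrL _)

theorem NN_finite {L : Set Pt} (hL : IsLattice L) (p0 : Pt) (r : ℝ) (u p : Pt) :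
    {l | l ∈ L ∧ ∃ s : ℝ, 0 ≤ s ∧ s ≤ r ∧ p - l = p0 + s • u}.Finite := by
  have hb : Bornology.IsBounded ((fun s : ℝ => p - (p0 + s • u)) '' Set.Icc 0 r) :=
    (isCompact_Icc.image (by fun_prop)).isBounded
  refine (lat_finite hL hb).subset ?_
  rintro l ⟨hl, s, h0, h1, h2⟩
  exact ⟨hl, s, ⟨h0, h1⟩, by simp only; rw [← h2]; abel⟩

open Classical in
theorem NN_closed {L : Set Pt} (hL : IsLattice L) {u : Pt} (hu : u ≠ 0) (p0 p : Pt) {r : ℝ}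
    (hr : 0 < r) :
    {l | l ∈ L ∧ ∃ s : ℝ, 0 ≤ s ∧ s ≤ r ∧ p - l = p0 + s • u}.ncard =
    NN L p0 r u p + (if p - (p0 + r • u) ∈ L then 1 else 0) := by
  have hne : ∀ l, l ∈ {l | l ∈ L ∧ ∃ s : ℝ, 0 ≤ s ∧ s < r ∧ p - l = p0 + s • u} ↔
      l ∈ {l | l ∈ L ∧ ∃ s : ℝ, 0 ≤ s ∧ s ≤ r ∧ p - l = p0 + s • u} ∧ l ≠ p - (p0 + r • u) := by
    intro l
    constructor
    · rintro ⟨hl, s, h0, h1, h2⟩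
      refine ⟨⟨hl, s, h0, h1.le, h2⟩, ?_⟩
      rintro rfl
      rw [sub_sub_cancel] at h2
      have := smul_left_injective ℝ hu (add_left_cancel h2)
      linarith
    · rintro ⟨⟨hl, s, h0, h1, h2⟩, h3⟩
      refine ⟨hl, s, h0, lt_of_le_of_ne h1 ?_, h2⟩
      rintro rfl
      apply h3
      rw [← h2]; abel
  have hset : {l | l ∈ L ∧ ∃ s : ℝ, 0 ≤ s ∧ s < r ∧ p - l = p0 + s • u} =
      {l | l ∈ L ∧ ∃ s : ℝ, 0 ≤ s ∧ s ≤ r ∧ p - l = p0 + s • u} \ {p - (p0 + r • u)} := by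
    ext l
    rw [hne l]
    rfl
  unfold NN
  split_ifs with h
  · rw [hset, Set.ncard_sdiff_singleton_add_one _ (NN_finite hL _ _ _ _)]
    exact ⟨h, r, hr.le, le_rfl, by abel⟩
  · rw [hset, Set.sdiff_singleton_eq_self, add_zero]
    exact fun h' => h h'.1

open Classical in
theorem NN_flip {L : Set Pt} (hL : IsLattice L) {u : Pt} (hu : u ≠ 0) (p0 p : Pt) {r : ℝ}
    (hr : 0 < r) :
    NN L p0 r u p + (if p - (p0 + r • u) ∈ L then 1 else 0) =
    NN L (p0 + r • u) r (-u) p + (if p - p0 ∈ L then 1 else 0) := by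
  rw [← NN_closed hL hu p0 p hr]
  have h := NN_closed hL (neg_ne_zero.2 hu) (p0 + r • u) p hr
  rw [show p0 + r • u + r • -u = p0 by module] at h
  rw [← h]
  congr 1
  ext l
  refine and_congr_right fun _ => ⟨?_, ?_⟩
  · rintro ⟨s, h0, h1, h2⟩
    exact ⟨r - s, by linarith, by linarith, by rw [h2]; module⟩
  · rintro ⟨s, h0, h1, h2⟩
    exact ⟨r - s, by linarith, by linarith, by rw [h2]; module⟩

theorem segF {L : Set Pt} (hL : IsLattice L) {u : Pt} (hu : u ≠ 0) {a d : Pt} {t : ℝ} (ht : 0 < t)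
    (h1 : ∀ p, NN L a 1 u p = NN L d t u p)
    (h2 : ∀ p, NN L (a + (1 : ℝ) • u) 1 (-u) p = NN L (d + t • u) t (-u) p) :
    t = 1 ∧ (d - a ∈ L ∨ (u ∈ L ∧ ∃ σ : ℝ, d - a + σ • u ∈ L)) := by
  classical
  have hflip : ∀ p, (if p - a ∈ L then 1 else 0) + (if p - (d + t • u) ∈ L then 1 else 0) =
      (if p - (a + (1 : ℝ) • u) ∈ L then 1 else 0) + (if p - d ∈ L then 1 else 0) := by
    intro p
    have e1 := NN_flip hL hu a p one_pos
    have e2 := NN_flip hL hu d p ht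
    rw [h1, h2] at e1
    omega
  have hA : NN L a 1 u a = XX L u 1 0 := NN_eq hL hu (lat_zero hL) (by simp)
  have hfin : (t - 1) • u ∈ L → XX L u 1 0 = XX L u t 0 → t = 1 := by
    intro hmem heq
    rcases lt_trichotomy t 1 with h | h | h
    · have := XX_strict hL hu h (by
        have := lat_neg hL hmem
        rwa [← neg_smul, neg_sub] at this) ht
      omega
    · exact h
    · have := XX_strict hL hu h hmem one_pos
      omega
  by_cases huL : u ∈ L
  · skip
    have hpos : 0 < XX L u 1 0 := by
      unfold XX
      rw [Set.ncard_pos (XX_finite hL hu _ _)]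
      exact ⟨0, by simpa using lat_zero hL, by simp, by simp⟩
    have hne : {l | l ∈ L ∧ ∃ s : ℝ, 0 ≤ s ∧ s < t ∧ a - l = d + s • u}.Nonempty := by
      rw [← hA, h1] at hpos
      exact Set.nonempty_of_ncard_ne_zero hpos.ne'
    obtain ⟨l, hl, s, hs0, hs1, hs⟩ := hne
    have hae : a = d + l + s • u := by
      rw [show d + l + s • u = l + (d + s • u) by abel, ← hs]; abel
    have hB : NN L d t u a = XX L u t s := NN_eq hL hu hl hae
    have htu : t • u ∈ L := by
      have e := hflip d
      have hab : d - a ∈ L ↔ d - (a + (1 : ℝ) • u) ∈ L := by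
        rw [one_smul]
        constructor
        · intro h
          have := lat_sub hL h huL
          rwa [show d - a - u = d - (a + u) by abel] at this
        · intro h
          have := lat_add hL h huL
          rwa [show d - (a + u) + u = d - a by abel] at this
      rw [sub_self, if_pos (lat_zero hL)] at e
      simp only [hab] at e
      have : d - (d + t • u) ∈ L := by
        by_contra hc
        rw [if_neg hc] at e
        omega
      have := lat_neg hL this
      rwa [show -(d - (d + t • u)) = t • u by abel] at this
    refine ⟨hfin ?_ ?_, Or.inr ⟨huL, s, ?_⟩⟩
    · rw [sub_smul, one_smul]; exact lat_sub hL htu huL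
    · rw [← hA, h1, hB]
      exact le_antisymm (XX_inv hL hu ht htu _ _) (XX_inv hL hu ht htu _ _)
    · rw [hae, show d - (d + l + s • u) + s • u = -l by abel]
      exact lat_neg hL hl
  · have had : a - d ∈ L := by
      have e := hflip a
      rw [sub_self, if_pos (lat_zero hL), if_neg (c := a - (a + (1 : ℝ) • u) ∈ L)] at e
      · by_contra hc
        rw [if_neg hc] at e
        omega
      · intro h
        have := lat_neg hL h
        rw [one_smul, show -(a - (a + u)) = u by abel] at this
        exact huL this
    have hbc : a + u - (d + t • u) ∈ L := by
      have e := hflip (a + u)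
      rw [one_smul, sub_self, if_pos (lat_zero hL), if_neg (c := a + u - a ∈ L)] at e
      · by_contra hc
        rw [if_neg hc] at e
        omega
      · intro h
        rw [show a + u - a = u by abel] at h
        exact huL h
    have hB : NN L d t u a = XX L u t 0 := NN_eq hL hu had (by simp)
    refine ⟨hfin ?_ ?_, Or.inl ?_⟩
    · have := lat_sub hL had hbc
      rwa [show a - d - (a + u - (d + t • u)) = (t - 1) • u by module] at this
    · rw [← hA, h1, hB]
    · rw [← neg_sub]; exact lat_neg hL had

theorem NN_shift_le {L : Set Pt} (hL : IsLattice L) {u : Pt} (hu : u ≠ 0) {a a' l0 p : Pt} {σ : ℝ}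
    (hl0 : l0 ∈ L) (h : (u ∈ L) ∨ σ = 0) (ha : a' = a + σ • u + l0) :
    NN L a 1 u p ≤ NN L a' 1 u p := by
  by_cases h0 : NN L a 1 u p = 0
  · omega
  obtain ⟨l, hl, s, -, -, hs⟩ := Set.nonempty_of_ncard_ne_zero h0
  rw [NN_eq (σ := s) hL hu hl (by rw [add_right_comm, ← hs]; abel),
    NN_eq (σ := s - σ) hL hu (lat_sub hL hl hl0) (by
      rw [ha, show a + σ • u + l0 + (l - l0) + (s - σ) • u = (a + s • u) + l by module, ← hs]; abel)]
  rcases h with h | h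
  · exact XX_inv hL hu one_pos (by rwa [one_smul]) _ _
  · rw [h, sub_zero]

theorem NN_shift {L : Set Pt} (hL : IsLattice L) {u : Pt} (hu : u ≠ 0) {a a' l0 p : Pt} {σ : ℝ}
    (hl0 : l0 ∈ L) (h : (u ∈ L) ∨ σ = 0) (ha : a' = a + σ • u + l0) :
    NN L a 1 u p = NN L a' 1 u p :=
  le_antisymm (NN_shift_le hL hu hl0 h ha) (NN_shift_le (σ := -σ) hL hu (lat_neg hL hl0)
    (by simpa using h) (by rw [ha]; module))

/-- In a tiling every edge has an opposite edge of the same length. -/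
theorem opp_edge {P L : Set Pt} {n k : ℕ} (hP : IsConvexPolygon P n) (hL : IsLattice L)
    (hT : IsKFoldLatticeTiling P L k) {e : Pt × Pt} (he : e ∈ EE P) :
    ∃ e' ∈ EE P, e'.2 - e'.1 = -(e.2 - e.1) ∧ (e'.2 - e.1 ∈ L ∨
      (e.2 - e.1 ∈ L ∧ ∃ σ : ℝ, e'.2 - e.1 + σ • (e.2 - e.1) ∈ L)) := by
  obtain ⟨u, hu⟩ : ∃ u, u = e.2 - e.1 := ⟨_, rfl⟩
  have hu0 : u ≠ 0 := by rw [hu]; exact EE_ne he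
  have huv := D_perp_pos hu0
  have h1 : D (e.2 - e.1) u = 0 := by rw [← hu]; exact D_self u
  have h2 : 0 < D (e.2 - e.1) (perp u) := by rw [← hu]; exact huv
  obtain ⟨e', he', h1', h2'⟩ := tiling_opp hP hL hT huv.ne' he h1 h2
  obtain ⟨s, hs⟩ := exists_smul_of_D hu0 (by rw [D_comm, h1', neg_zero] : D u (e'.2 - e'.1) = 0)
  have hs0 : s < 0 := by
    rw [hs, D_smul_left] at h2'
    by_contra h
    push Not at h
    nlinarith
  obtain ⟨t, rfl⟩ : ∃ t, s = -t := ⟨-s, by ring⟩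
  have ht : 0 < t := by linarith
  have e2 : e.2 = e.1 + (1 : ℝ) • u := by rw [hu]; module
  have e1' : e'.1 = e'.2 + t • u := by
    have : e'.1 = e'.2 - (e'.2 - e'.1) := by abel
    rw [this, hs]; module
  have hE : Ends e e.1 1 u := ⟨one_pos, Or.inl ⟨rfl, e2⟩⟩
  have hE' : Ends e' e'.2 t u := ⟨ht, Or.inr ⟨rfl, e1'⟩⟩
  have hF : Ends e (e.1 + (1 : ℝ) • u) 1 (-u) := ⟨one_pos, Or.inr ⟨e2, by module⟩⟩
  have hF' : Ends e' (e'.2 + t • u) t (-u) := ⟨ht, Or.inl ⟨e1', by module⟩⟩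
  have huvn : D (-u) (perp u) ≠ 0 := by rw [D_neg_left]; exact neg_ne_zero.2 huv.ne'
  have huv' : D u (-perp u) ≠ 0 := by rw [D_neg]; exact neg_ne_zero.2 huv.ne'
  have huvn' : D (-u) (-perp u) ≠ 0 := by rw [D_neg]; exact neg_ne_zero.2 huvn
  have hN : ∀ p, NN L e.1 1 u p = NN L e'.2 t u p := fun p =>
    (CL_iff hP hL huv.ne' he he' h1 h2 h1' h2' hE hE' p).1
      (by rw [tiling_CL hP hL hT huv.ne', tiling_CL hP hL hT huv'])
  have hM : ∀ p, NN L (e.1 + (1 : ℝ) • u) 1 (-u) p = NN L (e'.2 + t • u) t (-u) p := fun p =>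
    (CL_iff hP hL huvn he he' (by rw [D_neg, h1, neg_zero]) h2 (by rw [D_neg, h1', neg_zero]) h2'
      hF hF' p).1
      (by rw [tiling_CL hP hL hT huvn, tiling_CL hP hL hT huvn'])
  obtain ⟨rfl, h⟩ := segF hL hu0 ht hN hM
  refine ⟨e', he', by rw [hs, ← hu]; module, ?_⟩
  rw [← hu]
  exact h

/-- locally constant relation argument -/
theorem PC {α : Type*} (R : ℝ → α → Prop) (hR : ∀ t y z, R t y → R t z → y = z)
    (h : ∀ t, ∃ z, ∀ᶠ s in 𝓝[>] (0 : ℝ), R (t + s) z ∧ R (t - s) z) :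
    ∃ z, ∀ t, ∀ᶠ s in 𝓝[>] (0 : ℝ), R (t + s) z ∧ R (t - s) z := by
  choose z hz using h
  have h1 : ∀ t, ∃ ε : ℝ, 0 < ε ∧ ∀ r, r ≠ t → |r - t| < ε → R r (z t) := by
    intro t
    obtain ⟨ε, hε, h⟩ := mem_nhdsGT_iff_exists_Ioo_subset.1 (hz t)
    refine ⟨ε, hε, fun r hr hr' => ?_⟩
    rcases lt_or_gt_of_ne hr with h1 | h1
    · have := (h (show t - r ∈ Ioo 0 ε from ⟨by linarith, by rw [abs_of_neg (by linarith)] at hr'; linarith⟩)).2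
      simpa using this
    · have := (h (show r - t ∈ Ioo 0 ε from ⟨by linarith, by rw [abs_of_pos (by linarith)] at hr'; linarith⟩)).1
      simpa using this
  choose ε hε h2 using h1
  have h3 : IsLocallyConstant z := by
    rw [IsLocallyConstant.iff_eventually_eq]
    intro t
    filter_upwards [Metric.ball_mem_nhds t (hε t)] with s hs
    rw [Metric.mem_ball, Real.dist_eq] at hs
    by_cases hst : s = t
    · rw [hst]
    have hp : 0 < |s - t| := abs_pos.2 (sub_ne_zero.2 hst)
    obtain ⟨δ, hδ, hδ'⟩ := exists_between (show 0 < min (ε s) (min (ε t - |s - t|) |s - t|) from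
      lt_min (hε s) (lt_min (by linarith) hp))
    rw [lt_min_iff, lt_min_iff] at hδ'
    have hab : |δ| = δ := abs_of_pos hδ
    refine hR (s + δ) _ _ (h2 s _ (by linarith) (by rw [add_sub_cancel_left, hab]; exact hδ'.1))
      (h2 t _ ?_ ?_)
    · intro hc
      have : s - t = -δ := by linarith
      rw [this, abs_neg, hab] at hδ'
      linarith [hδ'.2.2]
    · have := abs_add_le (s - t) δ
      rw [show s - t + δ = s + δ - t by ring, hab] at this
      linarith [hδ'.2.1]
  refine ⟨z 0, fun t => ?_⟩
  rw [h3.apply_eq_of_preconnectedSpace 0 t]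
  exact hz t

def UM (P : Set Pt) (w x : Pt) : Prop :=
  x ∈ extremePoints ℝ P ∧ ∀ v ∈ extremePoints ℝ P, v ≠ x → D w x < D w v

def LM (P : Set Pt) (w m x : Pt) : Prop :=
  x ∈ extremePoints ℝ P ∧ ∀ v ∈ extremePoints ℝ P, v ≠ x →
    D w x < D w v ∨ (D w x = D w v ∧ D m x < D m v)

theorem UM.LM {P : Set Pt} {w x : Pt} (h : UM P w x) (m : Pt) : LM P w m x :=
  ⟨h.1, fun v hv hne => Or.inl (h.2 v hv hne)⟩

theorem UM.uniq {P : Set Pt} {w x y : Pt} (h : UM P w x) (h' : UM P w y) : x = y := by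
  by_contra hne
  have h1 := h.2 y h'.1 (Ne.symm hne)
  have h2 := h'.2 x h.1 hne
  linarith

theorem exists_LM {P : Set Pt} {n : ℕ} (hP : IsConvexPolygon P n) {w m : Pt} (hwm : D w m ≠ 0) :
    ∃ x, LM P w m x := by
  have hfin := hP.2.2.2.1
  have hne : (extremePoints ℝ P).Nonempty := by
    rw [Set.nonempty_iff_ne_empty]
    intro h
    have h1 := hP.2.2.2.2.2
    rw [h, convexHull_empty] at h1
    have h2 := hP.2.2.1
    rw [h1, interior_empty] at h2
    exact Set.not_nonempty_empty h2
  obtain ⟨x, hx, hmin⟩ := Set.exists_min_image _ (fun v => toLex (D w v, D m v)) hfin hne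
  refine ⟨x, hx, fun v hv hvx => ?_⟩
  have := hmin v hv
  simp only [Prod.Lex.toLex_le_toLex] at this
  rcases this with h | ⟨h1, h2⟩
  · exact Or.inl h
  · refine Or.inr ⟨h1, lt_of_le_of_ne h2 fun h3 => hvx ?_⟩
    refine sub_eq_zero.1 (D_basis (u := w) (v := m) hwm ?_ ?_)
    · rw [D_comm, D_sub]; linarith
    · rw [D_comm, D_sub]; linarith

theorem LM.ev {P : Set Pt} {n : ℕ} (hP : IsConvexPolygon P n) {w m x : Pt} (h : LM P w m x) :
    ∀ᶠ s in 𝓝[>] (0 : ℝ), UM P (w + s • m) x := by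
  have h1 : ∀ᶠ s in 𝓝[>] (0 : ℝ), ∀ v ∈ extremePoints ℝ P, v ≠ x →
      D (w + s • m) x < D (w + s • m) v := by
    rw [Filter.eventually_all_finite hP.2.2.2.1]
    intro v hv
    by_cases hvx : v = x
    · exact Eventually.of_forall fun s hs => absurd hvx hs
    have h2 := h.2 v hv hvx
    have h3 : D w (v - x) ≠ 0 ∨ D m (v - x) ≠ 0 := by
      rw [D_sub, D_sub]
      rcases h2 with h2 | h2
      · exact Or.inl (by linarith)
      · exact Or.inr (by linarith [h2.2])
    filter_upwards [sign_ev _ _ h3] with s hs _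
    have h4 := hs.2.2 (by
      rw [D_sub, D_sub]
      rcases h2 with h2 | h2
      · exact Or.inl (by linarith)
      · exact Or.inr ⟨by linarith [h2.1], by linarith [h2.2]⟩)
    rw [D_sub, D_sub] at h4
    rw [D_add_left, D_add_left, D_smul_left, D_smul_left]
    nlinarith
  filter_upwards [h1] with s hs
  exact ⟨h.1, hs⟩

theorem LM.min {P : Set Pt} {n : ℕ} (hP : IsConvexPolygon P n) {w m x : Pt} (h : LM P w m x) :
    ∀ y ∈ P, D w x ≤ D w y := by
  have h1 : P ⊆ {y | D w x ≤ D w y} := by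
    conv_lhs => rw [hP.2.2.2.2.2]
    refine convexHull_min ?_ ?_
    · intro v hv
      by_cases hvx : v = x
      · rw [hvx]; exact le_refl (D w x)
      · rcases h.2 v hv hvx with h | h
        · exact h.le
        · exact h.1.le
    · intro a ha b hb s t hs ht hst
      simp only [Set.mem_ofPred_eq] at ha hb ⊢
      rw [D_add, D_smul, D_smul]
      have : D w x = s * D w x + t * D w x := by rw [← add_mul, hst, one_mul]
      rw [this]
      gcongr
  exact fun y hy => h1 hy

theorem LM.pick {P : Set Pt} {w m x a b : Pt} (h : LM P w m x) (hx : x = a ∨ x = b)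
    (ha : a ∈ extremePoints ℝ P) (h1 : D w a = D w b) (h2 : D m a < D m b) : x = a := by
  rcases hx with hx | rfl
  · exact hx
  · by_contra hne
    rcases h.2 a ha (Ne.symm hne) with h | h
    · linarith
    · linarith [h.2]

def OppE (P : Set Pt) : Prop := ∀ e ∈ EE P, ∃ e' ∈ EE P, e'.2 - e'.1 = -(e.2 - e.1)

theorem jumpE {P : Set Pt} {n : ℕ} (hP : IsConvexPolygon P n) (hO : OppE P) {w m x x' y y' : Pt}
    (hwm : D w m ≠ 0) {a b : Pt} (hab : (a, b) ∈ EE P) {τ : ℝ} (hτ : 0 < τ) (hba : b - a = τ • w)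
    (hx : LM P w m x) (hx' : LM P w (-m) x') (hy : LM P (-w) (-m) y) (hy' : LM P (-w) m y') :
    x + y = x' + y' := by
  obtain ⟨⟨c, d⟩, hcd, hopp⟩ := hO _ hab
  simp only at hopp
  rw [hba] at hopp
  have wba : D w a = D w b := by
    have : D w (b - a) = 0 := by rw [hba, D_smul, D_self, mul_zero]
    rw [D_sub] at this; linarith
  have wcd : D w c = D w d := by
    have : D w (d - c) = 0 := by rw [hopp, D_neg, D_smul, D_self]; simp
    rw [D_sub] at this; linarith
  have hmin1 : ∀ z ∈ P, D w a ≤ D w z := by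
    intro z hz
    have := hab.2.2.2 z hz
    simp only at this
    rw [hba, D_smul_left, D_sub] at this
    have := nonneg_of_mul_nonneg_right this hτ
    linarith
  have hmin2 : ∀ z ∈ P, D w z ≤ D w c := by
    intro z hz
    have := hcd.2.2.2 z hz
    simp only at this
    rw [hopp, D_neg_left, D_smul_left, D_sub, ← mul_neg] at this
    have := nonneg_of_mul_nonneg_right this hτ
    linarith
  have f1 : ∀ z m', LM P w m' z → z = a ∨ z = b := by
    intro z m' hz
    refine EE_ext_face hab hz.1 ?_
    simp only
    have h1 := hz.min hP a hab.1.1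
    have h2 := hmin1 z hz.1.1
    rw [hba, D_smul_left, D_sub, le_antisymm h1 h2, sub_self, mul_zero]
  have f2 : ∀ z m', LM P (-w) m' z → z = c ∨ z = d := by
    intro z m' hz
    refine EE_ext_face hcd hz.1 ?_
    simp only
    have h1 := hz.min hP c hcd.1.1
    rw [D_neg_left, D_neg_left] at h1
    have h2 := hmin2 z hz.1.1
    rw [hopp, D_neg_left, D_smul_left, D_sub, le_antisymm h2 (by linarith), sub_self, mul_zero, neg_zero]
  have mba : D m b - D m a = τ * D m w := by rw [← D_sub, hba, D_smul]
  have mdc : D m d - D m c = -(τ * D m w) := by rw [← D_sub, hopp, D_neg, D_smul]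
  have hmw : D m w ≠ 0 := by rw [D_comm]; exact neg_ne_zero.2 hwm
  have hsum : a + c = b + d := by
    have h1 : b = a + τ • w := by rw [← hba]; abel
    have h2 : d = c + -(τ • w) := by rw [← hopp]; abel
    rw [h1, h2]; abel
  have nw : D (-w) c = D (-w) d := by rw [D_neg_left, D_neg_left, wcd]
  rcases lt_or_gt_of_ne hmw with h | h
  · have hk : τ * D m w < 0 := mul_neg_of_pos_of_neg hτ h
    rw [hx.pick (f1 _ _ hx).symm hab.2.1 wba.symm (by linarith),
      hx'.pick (f1 _ _ hx') hab.1 wba (by rw [D_neg_left, D_neg_left]; linarith),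
      hy.pick (f2 _ _ hy).symm hcd.2.1 nw.symm (by rw [D_neg_left, D_neg_left]; linarith),
      hy'.pick (f2 _ _ hy') hcd.1 nw (by linarith)]
    exact hsum.symm
  · have hk : 0 < τ * D m w := mul_pos hτ h
    rw [hx.pick (f1 _ _ hx) hab.1 wba (by linarith),
      hx'.pick (f1 _ _ hx').symm hab.2.1 wba.symm (by rw [D_neg_left, D_neg_left]; linarith),
      hy.pick (f2 _ _ hy) hcd.1 nw (by rw [D_neg_left, D_neg_left]; linarith),
      hy'.pick (f2 _ _ hy').symm hcd.2.1 nw.symm (by linarith)]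
    exact hsum

theorem jumpX {P : Set Pt} {n : ℕ} (hP : IsConvexPolygon P n) (hO : OppE P) {w m x x' y y' : Pt}
    (hwm : D w m ≠ 0) (hne : x ≠ x')
    (hx : LM P w m x) (hx' : LM P w (-m) x') (hy : LM P (-w) (-m) y) (hy' : LM P (-w) m y') :
    x + y = x' + y' := by
  have hw : w ≠ 0 := by rintro rfl; simp [D] at hwm
  have h1 := hx.min hP x' hx'.1.1
  have h2 := hx'.min hP x hx.1.1
  obtain ⟨τ, hτ⟩ := exists_smul_of_D hw (x := x' - x) (by rw [D_sub]; linarith)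
  have hτ0 : τ ≠ 0 := by
    rintro rfl
    rw [zero_smul] at hτ
    exact hne (sub_eq_zero.1 hτ).symm
  rcases lt_or_gt_of_ne hτ0 with h | h
  · have hh : x - x' = (-τ) • w := by rw [neg_smul, ← hτ]; abel
    exact jumpE hP hO hwm (EE_of_min hx'.1 hx.1 (neg_pos.2 h) hh (Ne.symm hne) (hx'.min hP))
      (neg_pos.2 h) hh hx hx' hy hy'
  · exact jumpE hP hO hwm (EE_of_min hx.1 hx'.1 h hτ hne (hx.min hP)) h hτ hx hx' hy hy'

theorem jump {P : Set Pt} {n : ℕ} (hP : IsConvexPolygon P n) (hO : OppE P) {w m x x' y y' : Pt}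
    (hwm : D w m ≠ 0)
    (hx : LM P w m x) (hx' : LM P w (-m) x') (hy : LM P (-w) (-m) y) (hy' : LM P (-w) m y') :
    x + y = x' + y' := by
  by_cases h : x = x'
  · by_cases h' : y = y'
    · rw [h, h']
    · have := jumpX hP hO (w := -w) (m := -m) (x := y) (x' := y') (y := x) (y' := x')
        (by rw [D_neg, D_neg_left, neg_neg]; exact hwm) h' hy (by rwa [neg_neg])
        (by rwa [neg_neg, neg_neg]) (by rwa [neg_neg])
      rw [add_comm x, this, add_comm]
  · exact jumpX hP hO hwm h hx hx' hy hy'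

def PR (P : Set Pt) (w z : Pt) : Prop := ∃ x y, UM P w x ∧ UM P (-w) y ∧ z = x + y

theorem PR.uniq {P : Set Pt} {w z z' : Pt} (h : PR P w z) (h' : PR P w z') : z = z' := by
  obtain ⟨x, y, h1, h2, rfl⟩ := h
  obtain ⟨x', y', h1', h2', rfl⟩ := h'
  rw [h1.uniq h1', h2.uniq h2']

theorem PR_ev {P : Set Pt} {n : ℕ} (hP : IsConvexPolygon P n) {w m x y : Pt}
    (hx : LM P w m x) (hy : LM P (-w) (-m) y) :
    ∀ᶠ s in 𝓝[>] (0 : ℝ), PR P (w + s • m) (x + y) := by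
  filter_upwards [hx.ev hP, hy.ev hP] with s h1 h2
  refine ⟨x, y, h1, ?_, rfl⟩
  rwa [show -(w + s • m) = -w + s • -m by module]

theorem PR_const1 {P : Set Pt} {n : ℕ} (hP : IsConvexPolygon P n) (hO : OppE P) {w0 w1 z0 z1 : Pt}
    (h : D w0 w1 ≠ 0) (h0 : PR P w0 z0) (h1 : PR P w1 z1) : z0 = z1 := by
  obtain ⟨z, hz⟩ := PC (fun t z => PR P (w0 + t • (w1 - w0)) z) (fun t y z => PR.uniq) (by
    intro t
    have hD : D (w0 + t • (w1 - w0)) (w1 - w0) ≠ 0 := by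
      rw [D_add_left, D_smul_left, D_self, mul_zero, add_zero, D_sub, D_self, sub_zero]
      exact h
    generalize hm : w1 - w0 = m at hD ⊢
    obtain ⟨x, hx⟩ := exists_LM hP hD
    obtain ⟨x', hx'⟩ := exists_LM hP (w := w0 + t • m) (m := -m)
      (by rw [D_neg]; exact neg_ne_zero.2 hD)
    obtain ⟨y, hy⟩ := exists_LM hP (w := -(w0 + t • m)) (m := -m)
      (by rw [D_neg_left, D_neg, neg_neg]; exact hD)
    obtain ⟨y', hy'⟩ := exists_LM hP (w := -(w0 + t • m)) (m := m)
      (by rw [D_neg_left]; exact neg_ne_zero.2 hD)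
    refine ⟨x + y, ?_⟩
    filter_upwards [PR_ev hP hx hy, PR_ev hP hx' (by rwa [neg_neg])] with s h1 h2
    constructor
    · rwa [add_smul, ← add_assoc]
    · rw [jump hP hO hD hx hx' hy hy']
      rwa [show w0 + (t - s) • m = w0 + t • m + s • -m by module])
  have e0 : z0 = z := by
    obtain ⟨x, y, hx, hy, rfl⟩ := h0
    obtain ⟨s, hs, a1, a2⟩ := ev_exists ((hz 0).and (PR_ev hP (hx.LM (w1 - w0)) (hy.LM _)))
    rw [zero_add] at a1
    exact a2.uniq a1.1
  have e1 : z1 = z := by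
    obtain ⟨x, y, hx, hy, rfl⟩ := h1
    obtain ⟨s, hs, a1, a2⟩ := ev_exists ((hz 1).and (PR_ev hP (hx.LM (w1 - w0)) (hy.LM _)))
    rw [show w0 + (1 + s) • (w1 - w0) = w1 + s • (w1 - w0) by module] at a1
    exact a2.uniq a1.1
  rw [e0, e1]

theorem exists_PR {P : Set Pt} {n : ℕ} (hP : IsConvexPolygon P n) {w m : Pt} (h : D w m ≠ 0) :
    ∃ (s : ℝ) (z : Pt), 0 < s ∧ PR P (w + s • m) z := by
  obtain ⟨x, hx⟩ := exists_LM hP h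
  obtain ⟨y, hy⟩ := exists_LM hP (w := -w) (m := -m) (by rwa [D_neg_left, D_neg, neg_neg])
  obtain ⟨s, hs, h⟩ := ev_exists (PR_ev hP hx hy)
  exact ⟨s, _, hs, h⟩

theorem PR_const {P : Set Pt} {n : ℕ} (hP : IsConvexPolygon P n) (hO : OppE P) {w0 w1 z0 z1 : Pt}
    (hw0 : w0 ≠ 0) (hw1 : w1 ≠ 0) (h0 : PR P w0 z0) (h1 : PR P w1 z1) : z0 = z1 := by
  by_cases h : D w0 w1 = 0
  · have hp := D_perp_pos hw0
    obtain ⟨s, z, hs, hz⟩ := exists_PR hP (w := perp w0) (m := w0)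
      (by rw [D_comm]; exact neg_ne_zero.2 hp.ne')
    have h2 : D w0 (perp w0 + s • w0) ≠ 0 := by
      rw [D_add, D_smul, D_self, mul_zero, add_zero]; exact hp.ne'
    obtain ⟨r, rfl⟩ := exists_smul_of_D hw0 h
    have hr : r ≠ 0 := by rintro rfl; exact hw1 (zero_smul _ _)
    rw [PR_const1 hP hO h2 h0 hz, PR_const1 hP hO (by
      rw [D_smul_left]; exact mul_ne_zero hr h2) h1 hz]
  · exact PR_const1 hP hO h h0 h1

theorem exists_UM {P : Set Pt} {n : ℕ} (hP : IsConvexPolygon P n) {v : Pt}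
    (hv : v ∈ extremePoints ℝ P) : ∃ w, w ≠ 0 ∧ UM P w v := by
  have h1 : v ∉ convexHull ℝ (extremePoints ℝ P \ {v}) := by
    intro h
    have h2 := (hP.1.mem_extremePoints_iff_convex_sdiff.1 hv).2
    have h3 : convexHull ℝ (extremePoints ℝ P \ {v}) ⊆ P \ {v} :=
      convexHull_min (Set.sdiff_subset_sdiff_left extremePoints_subset) h2
    exact (h3 h).2 rfl
  have hc : IsClosed (convexHull ℝ (extremePoints ℝ P \ {v})) :=
    ((hP.2.2.2.1.subset Set.sdiff_subset).isCompact_convexHull ℝ).isClosed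
  obtain ⟨f, c, hf1, hf2⟩ := geometric_hahn_banach_point_closed (convex_convexHull ℝ _) hc h1
  obtain ⟨w, hw⟩ := exists_D f
  have h4 : UM P w v := by
    refine ⟨hv, fun b hb hbv => ?_⟩
    rw [← hw, ← hw]
    exact hf1.trans (hf2 b (subset_convexHull _ _ ⟨hb, hbv⟩))
  by_cases h0 : w = 0
  · refine ⟨(1, 0), by simp, hv, fun b hb hbv => ?_⟩
    have := h4.2 b hb hbv
    simp [h0, D] at this
  · exact ⟨w, h0, h4⟩

theorem central {P : Set Pt} {n : ℕ} (hP : IsConvexPolygon P n) (hO : OppE P) :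
    ∃ c : Pt, ∀ x : Pt, x ∈ P ↔ c + c - x ∈ P := by
  obtain ⟨z, hz⟩ : ∃ z, ∀ v ∈ extremePoints ℝ P, z - v ∈ extremePoints ℝ P := by
    have hne : (1, 0) ≠ (0 : Pt) := by simp
    obtain ⟨s0, z, hs0, hz⟩ := exists_PR hP (w := (1, 0)) (m := (0, 1)) (by simp [D])
    refine ⟨z, fun v hv => ?_⟩
    obtain ⟨w, hw, hU⟩ := exists_UM hP hv
    have hp := D_perp_pos hw
    obtain ⟨y, hy⟩ := exists_LM hP (w := -w) (m := -perp w)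
      (by rw [D_neg_left, D_neg, neg_neg]; exact hp.ne')
    obtain ⟨s, hs, h⟩ := ev_exists (PR_ev hP (hU.LM (perp w)) hy)
    have := PR_const hP hO ?_ ?_ hz h
    · rw [this, add_sub_cancel_left]; exact hy.1
    · intro h; simp at h
    · intro h
      have h2 : D w (w + s • perp w) = s * D w (perp w) := by
        rw [D_add, D_smul, D_self, zero_add]
      rw [h] at h2
      have : 0 < s * D w (perp w) := mul_pos hs hp
      simp [D] at h2 this
      rcases h2 with h2 | h2 <;> nlinarith
  have hsub : ∀ x ∈ P, z - x ∈ P := by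
    have h1 : P ⊆ {x | z - x ∈ P} := by
      conv_lhs => rw [hP.2.2.2.2.2]
      refine convexHull_min (fun v hv => (hz v hv).1) ?_
      intro a ha b hb s t hs ht hst
      simp only [Set.mem_ofPred_eq] at ha hb ⊢
      have := hP.1 ha hb hs ht hst
      have e : s • (z - a) + t • (z - b) = z - (s • a + t • b) := by
        have : z = (s + t) • z := by rw [hst, one_smul]
        conv_rhs => rw [this]
        module
      rwa [e] at this
    exact fun x hx => h1 hx
  refine ⟨(2⁻¹ : ℝ) • z, fun x => ?_⟩
  have e : (2⁻¹ : ℝ) • z + (2⁻¹ : ℝ) • z = z := by module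
  rw [e]
  refine ⟨hsub x, fun h => ?_⟩
  have := hsub _ h
  rwa [sub_sub_cancel] at this

def CD (L : Set Pt) (a b : Pt) : Prop :=
  a + b ∈ L ∨ (b - a ∈ L ∧ ∃ σ : ℝ, a + b + σ • (b - a) ∈ L)

theorem CD_symm {L : Set Pt} (hL : IsLattice L) {a b : Pt} (h : CD L a b) : CD L b a := by
  rcases h with h | ⟨h, σ, hσ⟩
  · exact Or.inl (by rwa [add_comm])
  · refine Or.inr ⟨by rw [← neg_sub]; exact lat_neg hL h, -σ, ?_⟩
    rwa [show b + a + -σ • (a - b) = a + b + σ • (b - a) by module]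

theorem CD_iff {L : Set Pt} (hL : IsLattice L) (a b : Pt) :
    ((∃ w ∈ halfSet L, w ∈ openSegment ℝ a b) ∧ (midpoint ℝ a b ∉ halfSet L → b - a ∈ L)) ↔
      CD L a b := by
  have hmid : midpoint ℝ a b = (2⁻¹ : ℝ) • (a + b) := by
    rw [midpoint_eq_smul_add, invOf_eq_inv]
  have hm : midpoint ℝ a b ∈ halfSet L ↔ a + b ∈ L := by
    rw [hmid]
    constructor
    · rintro ⟨l, hl, h⟩
      have h2 : l = a + b := by
        have := congrArg (fun x => (2 : ℝ) • x) h
        simpa [smul_smul] using this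
      rwa [← h2]
    · intro h
      exact ⟨_, h, rfl⟩
  rw [hm]
  constructor
  · rintro ⟨⟨_, ⟨l, hl, rfl⟩, s, t, hs, ht, hst, h⟩, h2⟩
    by_cases hab : a + b ∈ L
    · exact Or.inl hab
    · refine Or.inr ⟨h2 hab, t - s, ?_⟩
      have h3 : l = a + b + (t - s) • (b - a) := by
        have h4 : l = (2 : ℝ) • (s • a + t • b) := by
          rw [h]; simp [smul_smul]
        have h5 : s = 1 - t := by linarith
        rw [h4, h5]; module
      rwa [← h3]
  · rintro (h | ⟨h, σ, hσ⟩)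
    · refine ⟨⟨midpoint ℝ a b, hm.2 h, 2⁻¹, 2⁻¹, by norm_num, by norm_num, by norm_num, ?_⟩,
        fun h' => absurd h h'⟩
      rw [hmid]; module
    · refine ⟨?_, fun _ => h⟩
      refine ⟨(2⁻¹ : ℝ) • (a + b + σ • (b - a) - ((round σ : ℤ) : ℝ) • (b - a)),
        ⟨_, lat_sub hL hσ (lat_zsmul hL h _), rfl⟩, ?_⟩
      have hr := abs_le.1 (abs_sub_round σ)
      refine ⟨(1 - (σ - (round σ : ℤ))) / 2, (1 + (σ - (round σ : ℤ))) / 2, by linarith, by linarith,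
        by ring, ?_⟩
      module

theorem ext_refl {P : Set Pt} {c : Pt} (hc : ∀ x : Pt, x ∈ P ↔ c + c - x ∈ P) {x : Pt}
    (hx : x ∈ extremePoints ℝ P) : c + c - x ∈ extremePoints ℝ P := by
  refine ⟨(hc x).1 hx.1, ?_⟩
  rintro y hy z hz ⟨s, t, hs, ht, hst, h⟩
  have := hx.2 ((hc y).1 hy) ((hc z).1 hz) ⟨s, t, hs, ht, hst, by
    have h1 : x = c + c - (s • y + t • z) := by rw [h]; abel
    have h2 : s = 1 - t := by linarith
    rw [h1, h2]; module⟩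
  rw [← this]; abel

theorem EE_refl {P : Set Pt} {c : Pt} (hc : ∀ x : Pt, x ∈ P ↔ c + c - x ∈ P) {e : Pt × Pt}
    (he : e ∈ EE P) : (c + c - e.1, c + c - e.2) ∈ EE P := by
  refine ⟨ext_refl hc he.1, ext_refl hc he.2.1, ?_, ?_⟩
  · intro h
    exact he.2.2.1 (sub_right_injective h)
  · intro x hx
    have := he.2.2.2 _ ((hc x).1 hx)
    simp only
    rw [show c + c - e.2 - (c + c - e.1) = -(e.2 - e.1) by abel,
      show x - (c + c - e.1) = -(c + c - x - e.1) by abel, D_neg, D_neg_left, neg_neg]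
    exact this

theorem forward {P L : Set Pt} {n k : ℕ} (hP : IsConvexPolygon P n) (hL : IsLattice L)
    (hT : IsKFoldLatticeTiling P L k) :
    ∃ c : Pt, (∀ x : Pt, x ∈ P ↔ c + c - x ∈ P) ∧ ∀ e ∈ EE P, CD L (e.1 - c) (e.2 - c) := by
  obtain ⟨c, hc⟩ := central hP (fun e he => by
    obtain ⟨e', he', h, -⟩ := opp_edge hP hL hT he
    exact ⟨e', he', h⟩)
  refine ⟨c, hc, fun e he => ?_⟩
  obtain ⟨e', he', h, h2⟩ := opp_edge hP hL hT he
  have h3 := EE_uniq (EE_refl hc he) he' one_pos (by rw [h]; simp only; module)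
  rw [← h3] at h2
  simp only at h2
  rcases h2 with h2 | ⟨h2, σ, h4⟩
  · refine Or.inl ?_
    rw [show e.1 - c + (e.2 - c) = -(c + c - e.2 - e.1) by abel]
    exact lat_neg hL h2
  · refine Or.inr ⟨by rwa [sub_sub_sub_cancel_right], -σ, ?_⟩
    rw [show e.1 - c + (e.2 - c) + -σ • (e.2 - c - (e.1 - c)) =
      -(c + c - e.2 - e.1 + σ • (e.2 - e.1)) by module]
    exact lat_neg hL h4

theorem NN_scale {L : Set Pt} {p0 u p : Pt} {r : ℝ} (hr : 0 < r) :
    NN L p0 r u p = NN L p0 1 (r • u) p := by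
  unfold NN
  congr 1
  ext l
  simp only [Set.mem_ofPred_eq]
  refine and_congr_right fun _ => ⟨?_, ?_⟩
  · rintro ⟨s, h1, h2, h3⟩
    refine ⟨s / r, by positivity, by rwa [div_lt_one hr], ?_⟩
    rw [h3, smul_smul, div_mul_cancel₀ _ hr.ne']
  · rintro ⟨s, h1, h2, h3⟩
    refine ⟨s * r, by positivity, by nlinarith, ?_⟩
    rw [h3, smul_smul]

theorem NN_opp {P L : Set Pt} (hL : IsLattice L) {c : Pt} {e : Pt × Pt} (he : e ∈ EE P)
    (h : CD L (e.1 - c) (e.2 - c)) {p0 u : Pt} {r : ℝ} (hE : Ends e p0 r u) (p : Pt) :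
    NN L p0 r u p = NN L (c + c - (p0 + r • u)) r u p := by
  obtain ⟨hr, hE⟩ := hE
  have h' : CD L (p0 - c) (p0 + r • u - c) := by
    rcases hE with ⟨h1, h2⟩ | ⟨h1, h2⟩
    · rwa [h2, h1] at h
    · rw [h2, h1] at h
      exact CD_symm hL h
  have hne := EE_ne he
  have hu : r • u ≠ 0 := by
    intro h0
    apply hne
    rcases hE with ⟨h1, h2⟩ | ⟨h1, h2⟩
    · rw [h2, h1, h0]; abel
    · rw [h2, h1, h0]; abel
  rw [NN_scale hr, NN_scale hr]
  rcases h' with h' | ⟨h', σ, h2⟩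
  · exact NN_shift (σ := 0) hL hu (lat_neg hL h') (Or.inr rfl) (by module)
  · refine NN_shift (σ := σ) hL hu (lat_neg hL h2) (Or.inl ?_) (by module)
    rwa [show p0 + r • u - c - (p0 - c) = r • u by abel] at h'

theorem CL_neg {P L : Set Pt} {n : ℕ} (hP : IsConvexPolygon P n) (hL : IsLattice L) {c : Pt}
    (hc : ∀ x : Pt, x ∈ P ↔ c + c - x ∈ P) (hC : ∀ e ∈ EE P, CD L (e.1 - c) (e.2 - c))
    {u v : Pt} (huv : D u v ≠ 0) (p : Pt) : CL P L u v p = CL P L u (-v) p := by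
  have hu : u ≠ 0 := by rintro rfl; simp [D] at huv
  have href : ∀ e : Pt × Pt, c + c - e.2 - (c + c - e.1) = -(e.2 - e.1) := fun e => by abel
  by_cases hex : ∃ e ∈ EE P, D (e.2 - e.1) u = 0 ∧ 0 < D (e.2 - e.1) v
  · obtain ⟨e, he, h1, h2⟩ := hex
    obtain ⟨p0, r, hE⟩ := exists_Ends he hu h1
    refine (CL_iff hP hL huv he (EE_refl hc he) h1 h2 ?_ ?_ hE (p0' := c + c - (p0 + r • u))
      (r' := r) ?_ p).2 (NN_opp hL he (hC e he) hE p)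
    · simp only
      rw [href, D_neg_left, h1, neg_zero]
    · simp only
      rw [href, D_neg_left]; linarith
    · refine ⟨hE.1, ?_⟩
      rcases hE.2 with ⟨h3, h4⟩ | ⟨h3, h4⟩
      · right
        simp only
        rw [h3, h4]
        exact ⟨rfl, by module⟩
      · left
        simp only
        rw [h3, h4]
        exact ⟨rfl, by module⟩
  · push Not at hex
    have h1 : ∀ e ∈ EE P, D (e.2 - e.1) u = 0 → ¬ 0 < D (e.2 - e.1) v :=
      fun e he h => not_lt.2 (hex e he h)
    have h2 : ∀ e ∈ EE P, D (e.2 - e.1) u = 0 → ¬ 0 < D (e.2 - e.1) (-v) := by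
      intro e he h
      have := hex _ (EE_refl hc he) (by simp only; rw [href, D_neg_left, h, neg_zero])
      simp only at this
      rw [href, D_neg_left] at this
      rw [D_neg]
      linarith
    have h3 : ∀ q, InLex P u v q ↔ InLex P u (-v) q := fun q =>
      ⟨jump2 h1, fun h => by simpa using jump2 h2 h⟩
    unfold CL
    simp only [h3]

theorem CC_rot {P L : Set Pt} {n : ℕ} (hP : IsConvexPolygon P n)
    (hN : ∀ u v p, D u v ≠ 0 → CL P L u v p = CL P L u (-v) p) {w0 w1 : Pt}
    (h : D w0 w1 ≠ 0) (h0 : Gen P w0) (h1 : Gen P w1) (p : Pt) : CC P L w0 p = CC P L w1 p := by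
  have hlex : ∀ u v, D u v ≠ 0 → ∀ᶠ s in 𝓝[>] (0 : ℝ), CC P L (u + s • v) p = CL P L u v p := by
    intro u v huv
    filter_upwards [lex_ev hP huv] with s hs
    unfold CC CL
    simp only [hs.2]
  have hgen : ∀ w v, Gen P w → CL P L w v p = CC P L w p := by
    intro w v hw
    have : ∀ q, InLex P w v q ↔ InW P w q := by
      intro q
      refine forall_congr' fun e => forall_congr' fun he => ?_
      have := hw e he
      tauto
    unfold CC CL
    simp only [this]
  have hD : ∀ t : ℝ, D (w0 + t • (w1 - w0)) (w1 - w0) ≠ 0 := by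
    intro t
    rw [D_add_left, D_smul_left, D_self, mul_zero, add_zero, D_sub, D_self, sub_zero]
    exact h
  obtain ⟨z, hz⟩ := PC (fun t z => CC P L (w0 + t • (w1 - w0)) p = z)
    (fun t y z h1 h2 => h1.symm.trans h2) (by
    intro t
    refine ⟨CL P L (w0 + t • (w1 - w0)) (w1 - w0) p, ?_⟩
    filter_upwards [hlex _ _ (hD t), hlex (w0 + t • (w1 - w0)) (-(w1 - w0))
      (by rw [D_neg]; exact neg_ne_zero.2 (hD t))] with s h1 h2
    constructor
    · rw [← h1]; congr 1; module
    · rw [hN _ _ _ (hD t), ← h2]; congr 1; module)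
  have e0 : CC P L w0 p = z := by
    have := hD 0
    rw [zero_smul, add_zero] at this
    obtain ⟨s, -, a1, a2⟩ := ev_exists ((hz 0).and (hlex _ _ this))
    rw [hgen _ _ h0] at a2
    rw [← a2, ← a1.1, zero_add]
  have e1 : CC P L w1 p = z := by
    have := hD 1
    rw [show w0 + (1 : ℝ) • (w1 - w0) = w1 by module] at this
    obtain ⟨s, -, a1, a2⟩ := ev_exists ((hz 1).and (hlex _ _ this))
    rw [hgen _ _ h1] at a2
    rw [← a2, ← a1.1]
    congr 1; module
  rw [e0, e1]

theorem CC_trans {P L : Set Pt} {n : ℕ} (hP : IsConvexPolygon P n) (hL : IsLattice L)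
    (hN : ∀ u v p, D u v ≠ 0 → CL P L u v p = CL P L u (-v) p) {w d : Pt}
    (h : D w d ≠ 0) (h0 : Gen P w) (h1 : Gen P d) (p : Pt) : CC P L w (p + d) = CC P L w p := by
  have hev : ∀ d', Gen P d' → D w d' ≠ 0 → ∀ x, ∀ᶠ ε in 𝓝[>] (0 : ℝ),
      CC P L w (x + ε • d') = CC P L w x := by
    intro d' hd' hwd x
    have := ev_set hP hL x d' (fun ε q => InW P w (q + ε • d')) (InW P d')
      (fun _ _ h => h.mem hP) (fun _ h => h.mem hP)
      (fun q => (InW_ev hP hd' q).mono fun ε h => h.2.2 w)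
    filter_upwards [this] with ε hε
    rw [CC_rot hP hN hwd h0 hd' x]
    unfold CC
    rw [← hε]
    congr 1
    ext l
    simp only [Set.mem_ofPred_eq]
    rw [show x + ε • d' - l = x - l + ε • d' by abel]
  have hR : ∀ t : ℝ, ∀ᶠ s in 𝓝[>] (0 : ℝ), CC P L w (p + (t + s) • d) = CC P L w (p + t • d) ∧
      CC P L w (p + (t - s) • d) = CC P L w (p + t • d) := by
    intro t
    filter_upwards [hev d h1 h (p + t • d), hev (-d) (fun e he => by
      rw [D_neg]; exact neg_ne_zero.2 (h1 e he)) (by rw [D_neg]; exact neg_ne_zero.2 h)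
      (p + t • d)] with s a1 a2
    constructor
    · rw [← a1]; congr 1; module
    · rw [← a2]; congr 1; module
  obtain ⟨z, hz⟩ := PC (fun t z => CC P L w (p + t • d) = z)
    (fun t y z h1 h2 => h1.symm.trans h2) (fun t => ⟨_, hR t⟩)
  have hz' : ∀ t : ℝ, CC P L w (p + t • d) = z := by
    intro t
    obtain ⟨s, -, a1, a2⟩ := ev_exists ((hz t).and (hR t))
    rw [← a2.1, a1.1]
  have e0 := hz' 0
  have e1 := hz' 1
  rw [zero_smul, add_zero] at e0
  rw [one_smul] at e1
  rw [e0, e1]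

theorem backward {P L : Set Pt} {n : ℕ} (hP : IsConvexPolygon P n) (hL : IsLattice L) {c : Pt}
    (hc : ∀ x : Pt, x ∈ P ↔ c + c - x ∈ P) (hC : ∀ e ∈ EE P, CD L (e.1 - c) (e.2 - c)) :
    ∃ k : ℕ, 0 < k ∧ IsKFoldLatticeTiling P L k := by
  have hN : ∀ u v p, D u v ≠ 0 → CL P L u v p = CL P L u (-v) p :=
    fun u v p h => CL_neg hP hL hc hC h p
  have hSf : ∀ y : Pt, (insert y ((fun e : Pt × Pt => e.2 - e.1) '' EE P)).Finite :=
    fun y => ((EE_finite hP).image _).insert y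
  have hS0 : ∀ y : Pt, y ≠ 0 → ∀ z ∈ insert y ((fun e : Pt × Pt => e.2 - e.1) '' EE P), z ≠ 0 := by
    rintro y hy z (rfl | ⟨e, he, rfl⟩)
    · exact hy
    · exact EE_ne he
  obtain ⟨w, hw⟩ := exists_generic_s12 _ (hSf (1, 0)) (hS0 (1, 0) (by simp))
  have hw0 : w ≠ 0 := by
    rintro rfl
    exact hw (1, 0) (Set.mem_insert _ _) (by simp [D])
  have hwg : Gen P w := fun e he => hw _ (Set.mem_insert_of_mem _ ⟨e, he, rfl⟩)
  obtain ⟨g, hg⟩ := exists_generic_s12 _ (hSf w) (hS0 w hw0)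
  have hconst : ∀ p d, CC P L w (p + d) = CC P L w p := by
    intro p d
    have hev : ∀ᶠ δ in 𝓝[>] (0 : ℝ),
        ∀ y ∈ insert w ((fun e : Pt × Pt => e.2 - e.1) '' EE P), D y (d + δ • g) ≠ 0 := by
      rw [Filter.eventually_all_finite (hSf w)]
      intro y hy
      filter_upwards [sign_ev (D y d) (D y g) (Or.inr (hg y hy))] with δ hδ
      rw [D_add, D_smul]
      exact hδ.1
    obtain ⟨δ, hδ, h⟩ := ev_exists hev
    have a1 := CC_trans hP hL hN (h w (Set.mem_insert _ _)) hwg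
      (fun e he => h _ (Set.mem_insert_of_mem _ ⟨e, he, rfl⟩)) p
    have a2 := CC_trans hP hL hN (d := δ • g) (by
      rw [D_smul]; exact mul_ne_zero hδ.ne' (hg w (Set.mem_insert _ _))) hwg
      (fun e he => by
        rw [D_smul]; exact mul_ne_zero hδ.ne' (hg _ (Set.mem_insert_of_mem _ ⟨e, he, rfl⟩))) (p + d)
    rw [← a2, add_assoc, a1]
  obtain ⟨o, ho⟩ := hP.2.2.1
  refine ⟨CC P L w o, ?_, tiling_of_CC hP hL (w := w) fun p => ?_⟩
  · unfold CC
    rw [Set.ncard_pos ((mem_finite hP hL o).subset fun l hl => ⟨hl.1, hl.2.mem hP⟩)]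
    exact ⟨0, lat_zero hL, by rw [sub_zero]; exact InW_of_interior ho⟩
  · rw [← hconst o (p - o), add_sub_cancel]


/-- Bolle's criterion: a convex polygon `P` forms a `k`-fold lattice tiling with
a lattice `Λ` for some positive integer `k` if and only if (1) `P` is centrally symmetric, and,
translating `P` so that its center is the origin, (2) the relative interior of each edge meets
`(1/2)Λ`, and (3) each edge whose midpoint is not in `(1/2)Λ` is a lattice vector of `Λ`. -/
theorem bolle_criterion (P : Set Pt) (n : ℕ) (hn : 3 ≤ n) (hP : IsConvexPolygon P n)
    (L : Set Pt) (hL : IsLattice L) :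
    (∃ k : ℕ, 0 < k ∧ IsKFoldLatticeTiling P L k) ↔
    (∃ c : Pt, (∀ x : Pt, x ∈ P ↔ c + c - x ∈ P) ∧
      ∀ a b : Pt, IsEdgeOf ((fun p : Pt => p - c) '' P) a b →
        ((∃ w ∈ halfSet L, w ∈ openSegment ℝ a b) ∧
         (midpoint ℝ a b ∉ halfSet L → b - a ∈ L))) := by

  constructor
  · rintro ⟨k, -, hT⟩
    obtain ⟨c, hc, h⟩ := forward hP hL hT
    refine ⟨c, hc, fun a b hab => ?_⟩
    rw [CD_iff hL]
    rw [isEdge_translate] at hab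
    rcases isEdge_EE hP.1 hab with h1 | h1
    · have := h _ h1
      simpa using this
    · have := h _ h1
      exact CD_symm hL (by simpa using this)
  · rintro ⟨c, hc, h⟩
    refine backward hP hL hc fun e he => ?_
    rw [← CD_iff hL]
    refine h _ _ ?_
    rw [isEdge_translate, sub_add_cancel, sub_add_cancel]
    exact EE_isEdge hP.1 he
end
end
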